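/- arXiv:2505.07074 — 4 statements merged into one kernel-verified Lean document; each statement's English description precedes it below -/
import Mathlib

section
/- Let p ≥ 3 be an odd integer and let q = 3p − 2 (note that p and q are then coprime). Then every mass μ on ℝ² admits a (q,p)-spiral equicovering. -/
open MeasureTheory

noncomputable section

/-- An affine line in the plane. -/
def IsAffineLine (L : Set (ℝ × ℝ)) : Prop :=
  ∃ a b : ℝ × ℝ, b ≠ 0 ∧ L = {x | ∃ t : ℝ, x = a + t • b}

/-- A mass: a Borel probability measure on the plane giving measure zero to every line. -/
def IsMass (μ : Measure (ℝ × ℝ)) : Prop :=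
  IsProbabilityMeasure μ ∧ ∀ L : Set (ℝ × ℝ), IsAffineLine L → μ L = 0

/-- The wedge with apex `O` spanned by angles in `[α, β]`. -/
def Wedge (O : ℝ × ℝ) (α β : ℝ) : Set (ℝ × ℝ) :=
  {O} ∪ {x | ∃ r : ℝ, 0 < r ∧ ∃ θ ∈ Set.Icc α β, x = O + r • (Real.cos θ, Real.sin θ)}

/-- A `(q,p)`-spiral equicovering of the measure `μ`: a point `O` and a weakly increasing
sequence of angles `θ : ℤ → ℝ` with `θ (j+q) = θ j + 2π`, such that every `p`-wedge
`W(O, θ i, θ (i+p))` is convex and has `μ`-measure `p/q`. -/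
def IsSpiralEquicovering (μ : Measure (ℝ × ℝ)) (q p : ℕ) : Prop :=
  ∃ (O : ℝ × ℝ) (θ : ℤ → ℝ),
    (∀ j : ℤ, θ (j + (q : ℤ)) = θ j + 2 * Real.pi) ∧
    (∀ j : ℤ, θ j ≤ θ (j + 1)) ∧
    (∀ i : ℤ, Convex ℝ (Wedge O (θ i) (θ (i + (p : ℤ)))) ∧
      μ (Wedge O (θ i) (θ (i + (p : ℤ)))) = ENNReal.ofReal ((p : ℝ) / (q : ℝ)))

/-- On a preconnected set, a continuous real function with positive cosine stays in a single
interval of positivity of the cosine. -/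
lemma IsPreconnected.exists_abs_sub_two_pi_mul_lt {X : Type*} [TopologicalSpace X] {S : Set X}
    (hS : IsPreconnected S) {f : X → ℝ} (hf : Continuous f) (hcos : ∀ x ∈ S, 0 < Real.cos (f x)) :
    ∃ m : ℤ, ∀ x ∈ S, |f x - 2 * Real.pi * m| < Real.pi / 2 := by
  have hpi := Real.pi_pos
  rcases S.eq_empty_or_nonempty with rfl | ⟨x₀, hx₀⟩
  · exact ⟨0, by simp⟩
  have key : ∀ x ∈ S, ∀ m : ℤ, |f x - 2 * Real.pi * m| ≠ Real.pi / 2 := by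
    intro x hx m h
    have h1 := hcos x hx
    have h2 : Real.cos (f x) = Real.cos (|f x - 2 * Real.pi * m|) := by
      rw [Real.cos_abs, show f x - 2 * Real.pi * m = f x - m * (2 * Real.pi) by ring,
        Real.cos_sub_int_mul_two_pi]
    rw [h2, h, Real.cos_pi_div_two] at h1
    exact lt_irrefl _ h1
  set m : ℤ := round (f x₀ / (2 * Real.pi)) with hm
  have hle : |f x₀ - 2 * Real.pi * m| ≤ Real.pi := by
    have h := abs_sub_round (f x₀ / (2 * Real.pi))
    rw [← hm] at h
    have e : f x₀ - 2 * Real.pi * m = (2 * Real.pi) * (f x₀ / (2 * Real.pi) - m) := by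
      field_simp
    rw [e, abs_mul, abs_of_pos (by positivity)]
    nlinarith
  have hlt : |f x₀ - 2 * Real.pi * m| < Real.pi / 2 := by
    by_contra hge
    push Not at hge
    have h1 := hcos x₀ hx₀
    have h2 : Real.cos (f x₀) = Real.cos (|f x₀ - 2 * Real.pi * m|) := by
      rw [Real.cos_abs, show f x₀ - 2 * Real.pi * m = f x₀ - m * (2 * Real.pi) by ring,
        Real.cos_sub_int_mul_two_pi]
    have h3 := Real.cos_nonpos_of_pi_div_two_le_of_le hge (by linarith)
    linarith
  refine ⟨m, fun x hx => ?_⟩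
  by_contra hge
  push Not at hge
  have hc : Continuous fun x => |f x - 2 * Real.pi * m| := by fun_prop
  obtain ⟨y, hy, hy'⟩ := hS.intermediate_value hx₀ hx hc.continuousOn ⟨hlt.le, hge⟩
  exact key y hy m hy'

/-- A continuous nowhere vanishing planar field cannot turn once more around the origin along the
left side of a square than along the three other sides. -/
lemma false_of_turning_field {Φ : ℝ × ℝ → ℂ} (hΦ : Continuous Φ) (hne : ∀ O, Φ O ≠ 0)
    {t : ℝ × ℝ → ℝ} (ht : Continuous t) (κ R : ℝ)
    (hS : ∀ O : ℝ × ℝ, (R ≤ O.1 ∨ R ≤ O.2 ∨ O.2 ≤ -R) →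
      0 < (Φ O * Complex.exp (-(κ : ℂ) * Complex.I)).re)
    (hL : ∀ O : ℝ × ℝ, O.1 ≤ -R →
      0 < (Φ O * Complex.exp (-((κ + 2 * Real.pi * t O : ℝ) : ℂ) * Complex.I)).re)
    (h0 : |t (-R, R)| ≤ 1 / 8) (h1 : |t (-R, -R) - 1| ≤ 1 / 8) : False := by
  have hpi := Real.pi_pos
  obtain ⟨L, ⟨-, hL'⟩, -⟩ := Complex.isCoveringMapOn_exp.existsUnique_continuousMap_lifts
    (A := ℝ × ℝ) ⟨Φ, hΦ⟩ (a₀ := 0) (e₀ := Complex.log (Φ 0)) (Complex.exp_log (hne 0))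
    (fun a => hne a)
  have hexp : ∀ O, Complex.exp (L O) = Φ O := fun O => congrFun hL' O
  set ψ : ℝ × ℝ → ℝ := fun O => (L O).im with hψ
  have hψc : Continuous ψ := Complex.continuous_im.comp L.continuous
  have hcos : ∀ (O : ℝ × ℝ) (c : ℝ), 0 < (Φ O * Complex.exp (-(c : ℂ) * Complex.I)).re →
      0 < Real.cos (ψ O - c) := by
    intro O c h
    rw [← hexp, ← Complex.exp_add, Complex.exp_re] at h
    have : (L O + -(c : ℂ) * Complex.I).im = ψ O - c := by simp [hψ]; ring
    rw [this] at h
    exact pos_of_mul_pos_right h (Real.exp_pos _).le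
  have hSc : IsPreconnected {O : ℝ × ℝ | R ≤ O.1 ∨ R ≤ O.2 ∨ O.2 ≤ -R} := by
    have c1 : Convex ℝ {O : ℝ × ℝ | R ≤ O.1} :=
      convex_halfSpace_ge (f := fun O : ℝ × ℝ => O.1) ⟨fun _ _ => rfl, fun _ _ => rfl⟩ R
    have c2 : Convex ℝ {O : ℝ × ℝ | R ≤ O.2} :=
      convex_halfSpace_ge (f := fun O : ℝ × ℝ => O.2) ⟨fun _ _ => rfl, fun _ _ => rfl⟩ R
    have c3 : Convex ℝ {O : ℝ × ℝ | O.2 ≤ -R} :=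
      convex_halfSpace_le (f := fun O : ℝ × ℝ => O.2) ⟨fun _ _ => rfl, fun _ _ => rfl⟩ (-R)
    have u1 := IsPreconnected.union (R, R) (by simp) (by simp) c1.isPreconnected c2.isPreconnected
    have u2 := IsPreconnected.union (R, -R) (by simp) (by simp) u1 c3.isPreconnected
    convert u2 using 1
    ext O
    simp [or_assoc]
  have hLc : IsPreconnected {O : ℝ × ℝ | O.1 ≤ -R} :=
    (convex_halfSpace_le (f := fun O : ℝ × ℝ => O.1)
      ⟨fun _ _ => rfl, fun _ _ => rfl⟩ (-R)).isPreconnected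
  obtain ⟨m, hm⟩ := hSc.exists_abs_sub_two_pi_mul_lt (f := fun O => ψ O - κ) (by fun_prop)
    (fun O hO => hcos O κ (hS O hO))
  obtain ⟨n, hn⟩ := hLc.exists_abs_sub_two_pi_mul_lt (f := fun O => ψ O - (κ + 2 * Real.pi * t O))
    (by fun_prop) (fun O hO => hcos O _ (hL O hO))
  have a1 := abs_lt.1 (hm (-R, R) (by simp))
  have a2 := abs_lt.1 (hn (-R, R) (by simp))
  have b1 := abs_lt.1 (hm (-R, -R) (by simp))
  have b2 := abs_lt.1 (hn (-R, -R) (by simp))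
  have h0' := abs_le.1 h0
  have h1' := abs_le.1 h1
  have e1 : (m : ℝ) - n < 1 := by
    by_contra h
    push Not at h
    nlinarith
  have e2 : (0 : ℝ) < m - n := by
    by_contra h
    push Not at h
    nlinarith
  have f1 : m - n < 1 := by exact_mod_cast e1
  have f2 : 0 < m - n := by exact_mod_cast e2
  omega

/-- A nonnegative periodic weight whose support lies, modulo `q`, in less than half of the circle
around `c` has a vector sum pointing towards `c`. -/
lemma re_sum_mul_exp_pos {q : ℕ} (hq : 0 < q) {w : ℤ → ℝ} (hw : ∀ i, 0 ≤ w i)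
    (hper : ∀ i, w (i + q) = w i) (hex : ∃ i, 0 < w i) (c : ℝ)
    (hc : ∀ i, 0 < w i → ∃ m : ℤ, |(i : ℝ) - m * q - c| < (q : ℝ) / 4) :
    0 < ((∑ i ∈ Finset.range q,
        (w i : ℂ) * Complex.exp ((2 * Real.pi * i / q : ℝ) * Complex.I)) *
      Complex.exp (-((2 * Real.pi * c / q : ℝ) : ℂ) * Complex.I)).re := by
  have hpi := Real.pi_pos
  have hq' : (0 : ℝ) < q := by exact_mod_cast hq
  have hterm : ∀ i : ℕ, ((w i : ℂ) * Complex.exp ((2 * Real.pi * i / q : ℝ) * Complex.I) *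
      Complex.exp (-((2 * Real.pi * c / q : ℝ) : ℂ) * Complex.I)).re =
      w i * Real.cos (2 * Real.pi * (i - c) / q) := by
    intro i
    rw [mul_assoc, ← Complex.exp_add, Complex.re_ofReal_mul, Complex.exp_re]
    simp
    left
    congr 1
    ring
  have hpos : ∀ i : ℕ, 0 < w i → 0 < Real.cos (2 * Real.pi * (i - c) / q) := by
    intro i hi
    obtain ⟨m, hm⟩ := hc i hi
    have e : 2 * Real.pi * ((i : ℝ) - c) / q =
        2 * Real.pi * (((i : ℤ) : ℝ) - m * q - c) / q + m * (2 * Real.pi) := by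
      push_cast
      field_simp
      ring
    rw [e, Real.cos_add_int_mul_two_pi]
    obtain ⟨h1, h2⟩ := abs_lt.1 hm
    apply Real.cos_pos_of_mem_Ioo
    constructor
    · rw [lt_div_iff₀ hq']
      nlinarith
    · rw [div_lt_iff₀ hq']
      nlinarith
  rw [Finset.sum_mul, Complex.re_sum, Finset.sum_congr rfl fun i _ => hterm i]
  apply Finset.sum_pos'
  · intro i _
    rcases (hw i).eq_or_lt with h | h
    · rw [← h]; simp
    · exact (mul_pos h (hpos i h)).le
  · obtain ⟨i, hi⟩ := hex
    have hwmod : w (i % q) = w i := by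
      have hp : Function.Periodic w (q : ℤ) := hper
      rw [Int.emod_def, mul_comm]
      exact hp.sub_zsmul_eq (i / q) |> fun h => by simpa using h
    obtain ⟨n, hn⟩ := Int.eq_ofNat_of_zero_le (Int.emod_nonneg i (b := q) (by omega))
    have hn' : n < q := by
      have := Int.emod_lt_of_pos i (b := q) (by omega)
      omega
    rw [hn] at hwmod
    refine ⟨n, Finset.mem_range.2 hn', ?_⟩
    have : 0 < w n := hwmod ▸ hi
    exact mul_pos this (hpos n this)

/-- A quasiperiodic integer sequence shifts by any integer number of periods. -/
lemma map_add_int_mul_of_map_add {q : ℕ} {T : ℤ → ℝ} {c : ℝ} (hper : ∀ j, T (j + q) = T j + c)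
    (m j : ℤ) : T (j + m * q) = T j + m * c := by
  induction m with
  | zero => simp
  | succ n ih =>
    rw [show j + ((n : ℤ) + 1) * q = (j + n * q) + q by ring, hper, ih]
    push_cast
    ring
  | pred n ih =>
    have := hper (j + (-(n : ℤ) - 1) * q)
    rw [show j + (-(n : ℤ) - 1) * q + q = j + -(n : ℤ) * q by ring, ih] at this
    push_cast at this ⊢
    linarith

/-- Blocks of `p` consecutive sectors spanning more than a half-turn pairwise overlap; when
`q = 3 p - 2`, this forces their starting indices into a short window modulo `q`. -/
lemma exists_center_of_reflex_blocks {p q : ℕ} (hp : 3 ≤ p) (hq : q + 2 = 3 * p) {T : ℤ → ℝ}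
    (hT : StrictMono T) (hper : ∀ j, T (j + q) = T j + 2 * Real.pi)
    (hex : ∃ i, Real.pi < T (i + p) - T i) :
    ∃ c : ℝ, ∀ i, Real.pi < T (i + p) - T i → ∃ m : ℤ, |(i : ℝ) - m * q - c| < (q : ℝ) / 4 := by
  have hshift := map_add_int_mul_of_map_add hper
  have hbadshift : ∀ (m j : ℤ), Real.pi < T (j + p) - T j →
      Real.pi < T (j + m * q + p) - T (j + m * q) := by
    intro m j h
    rw [show j + m * q + p = (j + p) + m * q by ring, hshift, hshift]
    linarith
  have hpair : ∀ i j : ℤ, Real.pi < T (i + p) - T i → Real.pi < T (j + p) - T j →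
      i + p ≤ j → j + p ≤ i + q → False := by
    intro i j hi hj h1 h2
    have e1 := hT.monotone h1
    have e2 := hT.monotone h2
    rw [hper] at e2
    linarith
  obtain ⟨i₀, hi₀⟩ := hex
  obtain ⟨a, ⟨ha, ha1, ha2⟩, hmin⟩ := Int.exists_least_of_bdd
    (P := fun a => Real.pi < T (a + p) - T a ∧ i₀ - p < a ∧ a ≤ i₀)
    ⟨i₀ - p, fun z hz => hz.2.1.le⟩ ⟨i₀, hi₀, by omega, le_rfl⟩
  refine ⟨a + ((p : ℝ) - 1) / 2, fun j hj => ⟨(j - a) / q, ?_⟩⟩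
  set m := (j - a) / q with hm
  have hqpos : (0 : ℤ) < q := by omega
  have hdiv := Int.emod_add_mul_ediv (j - a) q
  have hr0 := Int.emod_nonneg (j - a) hqpos.ne'
  have hr1 := Int.emod_lt_of_pos (j - a) hqpos
  set r := (j - a) % q with hr
  rw [← hm] at hdiv
  have hb := hbadshift (-m) j hj
  rw [show j + -m * q = a + r by linarith] at hb
  have hrp : r < p := by
    by_contra hge
    push Not at hge
    by_cases h2 : a + r + p ≤ a + q
    · exact hpair a (a + r) ha hb (by omega) h2
    · push Not at h2
      have hb' := hbadshift (-1) (a + r) hb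
      rw [show a + r + -1 * q = a + r - q by ring] at hb'
      by_cases h3 : i₀ - p < a + r - q
      · have := hmin _ ⟨hb', h3, by omega⟩
        omega
      · exact hpair _ i₀ hb' hi₀ (by omega) (by omega)
  have e : (j : ℝ) - m * q = a + r := by
    have : j - m * q = a + r := by linarith
    exact_mod_cast this
  have hr0' : (0 : ℝ) ≤ r := by exact_mod_cast hr0
  have hrp' : (r : ℝ) + 1 ≤ p := by exact_mod_cast hrp
  have hq' : (q : ℝ) + 2 = 3 * p := by exact_mod_cast hq
  have hp' : (3 : ℝ) ≤ p := by exact_mod_cast hp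
  rw [e, abs_lt]
  constructor <;> linarith

/-- If a half-turn `[α, α + π]` carries almost no mass, then every block of `p` sectors spanning
more than a half-turn nearly contains each direction `β` of that half-turn. -/
lemma abs_sub_center_le_of_reflex_block {p q : ℕ} (hqpos : 0 < q) {g : ℝ → ℝ} (hg : StrictMono g)
    (hshift : ∀ θ, g (θ + 2 * Real.pi) = g θ + 1) {T : ℤ → ℝ} (hT : ∀ j : ℤ, g (T j) = j / q)
    (hper : ∀ (m j : ℤ), T (j + m * q) = T j + m * (2 * Real.pi))
    {α β η : ℝ} (hαβ : α ≤ β) (hβα : β ≤ α + Real.pi) (hη : g (α + Real.pi) - g α ≤ η)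
    {i : ℤ} (hi : Real.pi < T (i + p) - T i) :
    ∃ m : ℤ, |(i : ℝ) - m * q - (q * g β - p / 2)| ≤ (p : ℝ) / 2 + η * q := by
  have hpi := Real.pi_pos
  have hq' : (0 : ℝ) < q := by exact_mod_cast hqpos
  have hη0 : 0 ≤ η := by
    have := hg.monotone (show α ≤ α + Real.pi by linarith)
    linarith
  obtain ⟨m, hm1, hm2⟩ : ∃ m : ℤ, α < T (i - m * q) ∧ T (i - m * q) ≤ α + 2 * Real.pi := by
    obtain ⟨m, hm, -⟩ := existsUnique_sub_zsmul_mem_Ioc (show (0 : ℝ) < 2 * Real.pi by positivity)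
      (T i) α
    refine ⟨m, ?_⟩
    have := hper (-m) i
    rw [show i - m * q = i + -m * q by ring, this]
    simp only [zsmul_eq_mul, Set.mem_Ioc] at hm
    push_cast
    constructor <;> linarith [hm.1, hm.2]
  have hbad : Real.pi < T (i - m * q + p) - T (i - m * q) := by
    have h1 := hper (-m) i
    have h2 := hper (-m) (i + p)
    rw [show i - m * q + p = (i + p) + -m * q by ring, show i - m * q = i + -m * q by ring, h1, h2]
    linarith
  have t1 := hT (i - m * q)
  have t2 := hT (i - m * q + p)
  push_cast at t1 t2
  have hgα := hg.monotone hαβ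
  have hgβ := hg.monotone hβα
  have hηq : 0 ≤ η * q := by positivity
  by_cases hcase : T (i - m * q) ≤ α + Real.pi
  · have u1 := hg.monotone hcase
    have u2 := hg.monotone (show β ≤ T (i - m * q + p) by linarith)
    rw [t1, div_le_iff₀ hq'] at u1
    rw [t2, le_div_iff₀ hq'] at u2
    refine ⟨m, abs_le.2 ⟨by linarith, ?_⟩⟩
    nlinarith
  · push Not at hcase
    have u1 := hg.monotone (show T (i - m * q) ≤ β + 2 * Real.pi by linarith)
    have u2 := hg.monotone (show α + 2 * Real.pi ≤ T (i - m * q + p) by linarith)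
    rw [t1, hshift, div_le_iff₀ hq'] at u1
    rw [t2, hshift, le_div_iff₀ hq'] at u2
    refine ⟨m + 1, abs_le.2 ⟨?_, ?_⟩⟩ <;> push_cast <;> nlinarith

/-- If a half-turn carries little mass, some block of `p` sectors spans more than a half-turn. -/
lemma exists_reflex_block {p q : ℕ} (hp : 3 ≤ p) (hqpos : 0 < q) {g : ℝ → ℝ} (hg : StrictMono g)
    {T : ℤ → ℝ} (hT : ∀ j : ℤ, g (T j) = j / q) {α : ℝ}
    (hα : g (α + Real.pi) - g α ≤ 1 / (8 * q)) :
    ∃ i : ℤ, Real.pi < T (i + p) - T i := by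
  have hq' : (0 : ℝ) < q := by exact_mod_cast hqpos
  have hp' : (3 : ℝ) ≤ p := by exact_mod_cast hp
  refine ⟨⌊q * g α⌋, ?_⟩
  have h1 := Int.floor_le (q * g α)
  have h2 := Int.lt_floor_add_one (q * g α)
  have t1 : T ⌊q * g α⌋ ≤ α := by
    rw [← hg.le_iff_le, hT, div_le_iff₀ hq']
    linarith
  have t2 : α + Real.pi < T (⌊q * g α⌋ + p) := by
    rw [← hg.lt_iff_lt, hT, lt_div_iff₀ hq']
    push_cast
    have : (g (α + Real.pi) - g α) * q ≤ 1 / 8 := by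
      calc (g (α + Real.pi) - g α) * q ≤ 1 / (8 * q) * q := by gcongr
        _ = 1 / 8 := by field_simp
    nlinarith
  linarith

/-- A continuous family of strictly increasing angular distribution functions, which look almost
concentrated on the inner side far away, has a point whose `q`-fan has all its `p`-blocks convex. -/
theorem exists_fan_with_convex_blocks {p q : ℕ} (hp : 3 ≤ p) (hq : q + 2 = 3 * p)
    {G : ℝ × ℝ → ℝ → ℝ} (hmono : ∀ O, StrictMono (G O)) (hcont : ∀ O, Continuous (G O))
    (hshift : ∀ O θ, G O (θ + 2 * Real.pi) = G O θ + 1) (hzero : ∀ O, G O 0 = 0)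
    (hO : ∀ θ, Continuous fun O => G O θ) {R : ℝ}
    (hright : ∀ O : ℝ × ℝ, R ≤ O.1 →
      G O (-(Real.pi / 2) + Real.pi) - G O (-(Real.pi / 2)) ≤ 1 / (8 * q))
    (hleft : ∀ O : ℝ × ℝ, O.1 ≤ -R →
      G O (Real.pi / 2 + Real.pi) - G O (Real.pi / 2) ≤ 1 / (8 * q))
    (htop : ∀ O : ℝ × ℝ, R ≤ O.2 → G O (0 + Real.pi) - G O 0 ≤ 1 / (8 * q))
    (hbot : ∀ O : ℝ × ℝ, O.2 ≤ -R →
      G O (-Real.pi + Real.pi) - G O (-Real.pi) ≤ 1 / (8 * q)) :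
    ∃ (O : ℝ × ℝ) (T : ℤ → ℝ), (|O.1| ≤ R ∧ |O.2| ≤ R) ∧ (∀ j : ℤ, G O (T j) = j / q) ∧
      ∀ i, T (i + p) - T i ≤ Real.pi := by
  have hpi := Real.pi_pos
  have hqpos : 0 < q := by omega
  have hq' : (0 : ℝ) < q := by exact_mod_cast hqpos
  have hpq : (q : ℝ) + 2 = 3 * p := by exact_mod_cast hq
  have hp' : (3 : ℝ) ≤ p := by exact_mod_cast hp
  have hint : ∀ O (n : ℤ), G O (n * (2 * Real.pi)) = n := by
    intro O n
    induction n with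
    | zero => simpa using hzero O
    | succ n ih =>
      rw [show (((n : ℤ) + 1 : ℤ) : ℝ) * (2 * Real.pi) = ((n : ℤ) : ℝ) * (2 * Real.pi) + 2 * Real.pi
        by push_cast; ring, hshift, ih]
      push_cast; ring
    | pred n ih =>
      have := hshift O (((-(n : ℤ) - 1 : ℤ) : ℝ) * (2 * Real.pi))
      rw [show ((-(n : ℤ) - 1 : ℤ) : ℝ) * (2 * Real.pi) + 2 * Real.pi =
        ((-(n : ℤ) : ℤ) : ℝ) * (2 * Real.pi) by push_cast; ring, ih] at this
      push_cast at this ⊢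
      linarith
  have hsurj : ∀ O, Function.Surjective (G O) := by
    intro O s
    refine mem_range_of_exists_le_of_exists_ge (hcont O) ⟨⌊s⌋ * (2 * Real.pi), ?_⟩
      ⟨⌈s⌉ * (2 * Real.pi), ?_⟩
    · rw [hint]; exact Int.floor_le s
    · rw [hint]; exact Int.le_ceil s
  choose T hT using fun (O : ℝ × ℝ) (j : ℤ) => hsurj O ((j : ℝ) / q)
  have hTmono : ∀ O, StrictMono (T O) := by
    intro O i j hij
    rw [← (hmono O).lt_iff_lt, hT, hT]
    have : (i : ℝ) < j := by exact_mod_cast hij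
    gcongr
  have hTper : ∀ O (j : ℤ), T O (j + q) = T O j + 2 * Real.pi := by
    intro O j
    apply (hmono O).injective
    rw [hshift, hT, hT]
    push_cast
    field_simp
  have hTshift := fun O => map_add_int_mul_of_map_add (hTper O)
  have hTcont : ∀ j, Continuous fun O => T O j := by
    intro j
    rw [continuous_iff_continuousAt]
    intro O
    refine tendsto_order.2 ⟨fun a ha => ?_, fun a ha => ?_⟩
    · have h := (hmono O) ha
      rw [hT] at h
      filter_upwards [(hO a).continuousAt.eventually (gt_mem_nhds h)] with O' h'
      rw [← (hmono O').lt_iff_lt, hT]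
      exact h'
    · have h := (hmono O) ha
      rw [hT] at h
      filter_upwards [(hO a).continuousAt.eventually (lt_mem_nhds h)] with O' h'
      rw [← (hmono O').lt_iff_lt, hT]
      exact h'
  by_cases hgood : ∃ O, ∀ i, T O (i + p) - T O i ≤ Real.pi
  · obtain ⟨O, hOg⟩ := hgood
    have hnone : ∀ α, ¬ G O (α + Real.pi) - G O α ≤ 1 / (8 * q) := by
      intro α hα
      obtain ⟨i, hi⟩ := exists_reflex_block hp hqpos (hmono O) (hT O) hα
      exact absurd (hOg i) (not_le.2 hi)
    refine ⟨O, T O, ⟨abs_le.2 ⟨?_, ?_⟩, abs_le.2 ⟨?_, ?_⟩⟩, hT O, hOg⟩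
    · by_contra h; exact hnone _ (hleft O (by linarith))
    · by_contra h; exact hnone _ (hright O (by linarith))
    · by_contra h; exact hnone _ (hbot O (by linarith))
    · by_contra h; exact hnone _ (htop O (by linarith))
  exfalso
  push Not at hgood
  set w : ℝ × ℝ → ℤ → ℝ := fun O i => max 0 (T O (i + p) - T O i - Real.pi) with hw
  have hwpos : ∀ O i, 0 < w O i ↔ Real.pi < T O (i + p) - T O i := by
    intro O i
    simp [hw, lt_sub_iff_add_lt]
  have hw0 : ∀ O i, 0 ≤ w O i := fun O i => le_max_left _ _
  have hwper : ∀ O (i : ℤ), w O (i + q) = w O i := by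
    intro O i
    simp only [hw]
    rw [show i + q + p = i + p + (q : ℤ) by ring, hTper, hTper]
    congr 1
    ring
  have hwex : ∀ O, ∃ i, 0 < w O i := fun O => (hgood O).imp fun i hi => (hwpos O i).2 hi
  set Φ : ℝ × ℝ → ℂ := fun O => ∑ i ∈ Finset.range q,
    (w O i : ℂ) * Complex.exp ((2 * Real.pi * i / q : ℝ) * Complex.I) with hΦ
  have hΦc : Continuous Φ := by
    refine continuous_finsetSum _ fun i _ => ?_
    have := hTcont i
    have := hTcont (i + p)
    fun_prop
  have hΦpos : ∀ O c, (∀ i, Real.pi < T O (i + p) - T O i →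
      ∃ m : ℤ, |(i : ℝ) - m * q - c| < (q : ℝ) / 4) →
      0 < (Φ O * Complex.exp (-((2 * Real.pi * c / q : ℝ) : ℂ) * Complex.I)).re :=
    fun O c h => re_sum_mul_exp_pos hqpos (hw0 O) (hwper O) (hwex O) c
      fun i hi => h i ((hwpos O i).1 hi)
  have hΦne : ∀ O, Φ O ≠ 0 := by
    intro O h
    obtain ⟨c, hc⟩ := exists_center_of_reflex_blocks hp hq (hTmono O) (hTper O) (hgood O)
    have := hΦpos O c hc
    simp [h] at this
  have hfar : ∀ O α β, α ≤ β → β ≤ α + Real.pi → G O (α + Real.pi) - G O α ≤ 1 / (8 * q) →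
      0 < (Φ O * Complex.exp
        (-((-(Real.pi * p / q) + 2 * Real.pi * G O β : ℝ) : ℂ) * Complex.I)).re := by
    intro O α β h1 h2 h3
    have := hΦpos O (q * G O β - p / 2) fun i hi => by
      obtain ⟨m, hm⟩ := abs_sub_center_le_of_reflex_block hqpos (hmono O) (hshift O) (hT O)
        (hTshift O) h1 h2 h3 hi
      refine ⟨m, hm.trans_lt ?_⟩
      have : 1 / (8 * (q : ℝ)) * q = 1 / 8 := by field_simp
      rw [this]
      linarith
    rwa [show 2 * Real.pi * (q * G O β - p / 2) / q =
      -(Real.pi * p / q) + 2 * Real.pi * G O β by field_simp; ring] at this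
  have h8 : 1 / (8 * (q : ℝ)) ≤ 1 / 8 := by
    have : (1 : ℝ) ≤ q := by exact_mod_cast hqpos
    apply one_div_le_one_div_of_le <;> linarith
  refine false_of_turning_field hΦc hΦne (hO Real.pi) (-(Real.pi * p / q)) R ?_ ?_ ?_ ?_
  · intro O h
    have : ∃ α : ℝ, α ≤ 0 ∧ 0 ≤ α + Real.pi ∧ G O (α + Real.pi) - G O α ≤ 1 / (8 * q) := by
      rcases h with h | h | h
      · exact ⟨_, by linarith, by linarith, hright O h⟩
      · exact ⟨_, by linarith, by linarith, htop O h⟩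
      · exact ⟨_, by linarith, by linarith, hbot O h⟩
    obtain ⟨α, h1, h2, h3⟩ := this
    have := hfar O α 0 h1 h2 h3
    simpa [hzero] using this
  · intro O h
    exact hfar O (Real.pi / 2) Real.pi (by linarith) (by linarith) (hleft O h)
  · have := htop (-R, R) le_rfl
    rw [zero_add, hzero] at this
    have h' := hmono (-R, R) hpi
    rw [hzero] at h'
    rw [abs_le]
    constructor <;> linarith
  · have := hbot (-R, -R) le_rfl
    rw [neg_add_cancel, hzero] at this
    have h' := hmono (-R, -R) (show -Real.pi < 0 by linarith)
    have h2 := hshift (-R, -R) (-Real.pi)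
    rw [show -Real.pi + 2 * Real.pi = Real.pi by ring] at h2
    rw [hzero] at h'
    rw [abs_le]
    constructor <;> linarith

/-- The direction of `x` seen from `O`, as a number in `(0, 2π]`. -/
def directionAngle (O x : ℝ × ℝ) : ℝ :=
  Real.pi + Complex.arg (⟨O.1 - x.1, O.2 - x.2⟩ : ℂ)

lemma directionAngle_pos (O x : ℝ × ℝ) : 0 < directionAngle O x := by
  have := Complex.neg_pi_lt_arg (⟨O.1 - x.1, O.2 - x.2⟩ : ℂ)
  unfold directionAngle
  linarith

lemma directionAngle_le (O x : ℝ × ℝ) : directionAngle O x ≤ 2 * Real.pi := by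
  have := Complex.arg_le_pi (⟨O.1 - x.1, O.2 - x.2⟩ : ℂ)
  unfold directionAngle
  linarith

/-- Polar coordinates around `O`. -/
lemma exists_polar (O x : ℝ × ℝ) : ∃ r : ℝ, 0 ≤ r ∧ (x ≠ O → 0 < r) ∧
    x = O + r • (Real.cos (directionAngle O x), Real.sin (directionAngle O x)) := by
  set z : ℂ := ⟨O.1 - x.1, O.2 - x.2⟩ with hz
  have h1 : ‖z‖ * Real.cos z.arg = O.1 - x.1 := by
    rw [Complex.norm_mul_cos_arg]
  have h2 : ‖z‖ * Real.sin z.arg = O.2 - x.2 := by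
    rw [Complex.norm_mul_sin_arg]
  refine ⟨‖z‖, norm_nonneg _, fun hne => norm_pos_iff.2 fun h0 => hne ?_, ?_⟩
  · have e1 := congrArg Complex.re h0
    have e2 := congrArg Complex.im h0
    simp only [hz, Complex.zero_re, Complex.zero_im] at e1 e2
    ext <;> linarith
  · have hd : directionAngle O x = z.arg + Real.pi := by rw [directionAngle, add_comm]
    ext
    · simp only [hd, Real.cos_add_pi, Prod.fst_add, Prod.smul_fst, smul_eq_mul]
      linarith
    · simp only [hd, Real.sin_add_pi, Prod.snd_add, Prod.smul_snd, smul_eq_mul]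
      linarith

lemma exists_eq_directionAngle_add {O : ℝ × ℝ} {r θ : ℝ} (hr : 0 < r) :
    ∃ k : ℤ, θ = directionAngle O (O + r • (Real.cos θ, Real.sin θ)) + k * (2 * Real.pi) := by
  obtain ⟨ρ, hρ, -, h⟩ := exists_polar O (O + r • (Real.cos θ, Real.sin θ))
  set a := directionAngle O (O + r • (Real.cos θ, Real.sin θ))
  have h1 := congrArg Prod.fst h
  have h2 := congrArg Prod.snd h
  simp only [Prod.fst_add, Prod.snd_add, Prod.smul_fst, Prod.smul_snd, smul_eq_mul,
    add_right_inj] at h1 h2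
  have hsq : r ^ 2 = ρ ^ 2 := by
    calc r ^ 2 = (r * Real.cos θ) ^ 2 + (r * Real.sin θ) ^ 2 := by
          linear_combination -(r ^ 2) * Real.sin_sq_add_cos_sq θ
      _ = ρ ^ 2 := by
          rw [h1, h2]
          linear_combination (ρ ^ 2) * Real.sin_sq_add_cos_sq a
  have hrρ : r = ρ := by nlinarith
  rw [← hrρ] at h1 h2
  have c1 := mul_left_cancel₀ hr.ne' h1
  have c2 := mul_left_cancel₀ hr.ne' h2
  have hcos : Real.cos (θ - a) = 1 := by
    rw [Real.cos_sub, c1, c2]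
    linear_combination Real.sin_sq_add_cos_sq a
  obtain ⟨k, hk⟩ := (Real.cos_eq_one_iff _).1 hcos
  exact ⟨k, by linarith⟩

lemma continuousAt_directionAngle {O x : ℝ × ℝ} (h : x.2 ≠ O.2) :
    ContinuousAt (fun P => directionAngle P x) O := by
  have hmem : (⟨O.1 - x.1, O.2 - x.2⟩ : ℂ) ∈ Complex.slitPlane :=
    Or.inr (sub_ne_zero.2 h.symm)
  have hc : Continuous fun P : ℝ × ℝ => (⟨P.1 - x.1, P.2 - x.2⟩ : ℂ) := by
    have : (fun P : ℝ × ℝ => (⟨P.1 - x.1, P.2 - x.2⟩ : ℂ)) =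
        fun P => Complex.equivRealProdCLM.symm (P.1 - x.1, P.2 - x.2) := rfl
    rw [this]
    fun_prop
  exact continuousAt_const.add
    (ContinuousAt.comp (f := fun P : ℝ × ℝ => (⟨P.1 - x.1, P.2 - x.2⟩ : ℂ))
      (Complex.continuousAt_arg hmem) hc.continuousAt)

lemma measurable_directionAngle (O : ℝ × ℝ) : Measurable (directionAngle O) := by
  have hc : Continuous fun x : ℝ × ℝ => (⟨O.1 - x.1, O.2 - x.2⟩ : ℂ) := by
    have : (fun x : ℝ × ℝ => (⟨O.1 - x.1, O.2 - x.2⟩ : ℂ)) =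
        fun x => Complex.equivRealProdCLM.symm (O.1 - x.1, O.2 - x.2) := rfl
    rw [this]
    fun_prop
  exact (Complex.measurable_arg.comp hc.measurable).const_add _

/-- The number of times the direction of `x` has been swept by the ray from `O` turning from
angle `0` to angle `θ`. -/
def sweepCount (O : ℝ × ℝ) (θ : ℝ) (x : ℝ × ℝ) : ℤ :=
  ⌊(θ - directionAngle O x) / (2 * Real.pi)⌋ + 1

/-- The mass swept by the ray from `O` turning from angle `0` to angle `θ`. -/
def sweptMass (μ : Measure (ℝ × ℝ)) (O : ℝ × ℝ) (θ : ℝ) : ℝ :=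
  ∫ x, (sweepCount O θ x : ℝ) ∂μ

lemma abs_sweepCount_le (O : ℝ × ℝ) (θ : ℝ) (x : ℝ × ℝ) : |(sweepCount O θ x : ℝ)| ≤ |θ| + 2 := by
  have hpi := Real.pi_gt_three
  have h1 := directionAngle_pos O x
  have h2 := directionAngle_le O x
  have h3 := Int.floor_le ((θ - directionAngle O x) / (2 * Real.pi))
  have h4 := Int.lt_floor_add_one ((θ - directionAngle O x) / (2 * Real.pi))
  have h5 : (θ - directionAngle O x) / (2 * Real.pi) ≤ |θ| := by
    rw [div_le_iff₀ (by positivity)]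
    nlinarith [le_abs_self θ, abs_nonneg θ]
  have h6 : -(|θ| + 1) ≤ (θ - directionAngle O x) / (2 * Real.pi) := by
    rw [le_div_iff₀ (by positivity)]
    nlinarith [neg_abs_le θ, abs_nonneg θ]
  rw [sweepCount, abs_le]
  push_cast
  constructor <;> linarith

lemma measurable_sweepCount (O : ℝ × ℝ) (θ : ℝ) : Measurable (sweepCount O θ) := by
  have := measurable_directionAngle O
  unfold sweepCount
  fun_prop

lemma integrable_sweepCount (μ : Measure (ℝ × ℝ)) [IsFiniteMeasure μ] (O : ℝ × ℝ) (θ : ℝ) :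
    Integrable (fun x => (sweepCount O θ x : ℝ)) μ := by
  refine Integrable.of_bound (C := |θ| + 2) ?_ (Filter.Eventually.of_forall fun x => ?_)
  · have := measurable_sweepCount O θ
    exact (by fun_prop : Measurable fun x => (sweepCount O θ x : ℝ)).aestronglyMeasurable
  · exact abs_sweepCount_le O θ x

lemma sweepCount_add_two_pi (O : ℝ × ℝ) (θ : ℝ) (x : ℝ × ℝ) :
    sweepCount O (θ + 2 * Real.pi) x = sweepCount O θ x + 1 := by
  have hpi := Real.pi_pos
  unfold sweepCount
  rw [show (θ + 2 * Real.pi - directionAngle O x) / (2 * Real.pi) =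
    (θ - directionAngle O x) / (2 * Real.pi) + 1 by field_simp; ring, Int.floor_add_one]

lemma sweptMass_add_two_pi (μ : Measure (ℝ × ℝ)) [IsProbabilityMeasure μ] (O : ℝ × ℝ) (θ : ℝ) :
    sweptMass μ O (θ + 2 * Real.pi) = sweptMass μ O θ + 1 := by
  unfold sweptMass
  simp only [sweepCount_add_two_pi, Int.cast_add, Int.cast_one]
  rw [integral_add (integrable_sweepCount μ O θ) (integrable_const _)]
  simp

lemma sweptMass_zero (μ : Measure (ℝ × ℝ)) (O : ℝ × ℝ) : sweptMass μ O 0 = 0 := by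
  have hpi := Real.pi_pos
  have : ∀ x, sweepCount O 0 x = 0 := by
    intro x
    have h1 := directionAngle_pos O x
    have h2 := directionAngle_le O x
    have : ⌊(0 - directionAngle O x) / (2 * Real.pi)⌋ = -1 := by
      rw [Int.floor_eq_iff, le_div_iff₀ (by positivity), div_lt_iff₀ (by positivity)]
      push_cast
      constructor <;> linarith
    rw [sweepCount, this]
    norm_num
  simp [sweptMass, this]

lemma monotone_sweptMass (μ : Measure (ℝ × ℝ)) [IsFiniteMeasure μ] (O : ℝ × ℝ) :
    Monotone (sweptMass μ O) := by
  intro α β h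
  refine integral_mono (integrable_sweepCount μ O α) (integrable_sweepCount μ O β) fun x => ?_
  have hpi := Real.pi_pos
  simp only [sweepCount, Int.cast_le, add_le_add_iff_right]
  exact Int.floor_le_floor (by gcongr)

/-- Almost every point lies neither on the horizontal line through `O` nor on the line through `O`
with direction `θ`. -/
lemma IsMass.ae_generic {μ : Measure (ℝ × ℝ)} (hμ : IsMass μ) (O : ℝ × ℝ) (θ : ℝ) :
    ∀ᵐ x ∂μ, x ≠ O ∧ x.2 ≠ O.2 ∧ ∀ k : ℤ, (θ - directionAngle O x) / (2 * Real.pi) ≠ k := by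
  have hpi := Real.pi_pos
  have n1 := hμ.2 {x | ∃ t : ℝ, x = O + t • ((1 : ℝ), (0 : ℝ))} ⟨O, (1, 0), by simp, rfl⟩
  have n2 := hμ.2 {x | ∃ t : ℝ, x = O + t • (Real.cos θ, Real.sin θ)}
    ⟨O, (Real.cos θ, Real.sin θ), fun h => by
      have e1 := congrArg Prod.fst h
      have e2 := congrArg Prod.snd h
      have := Real.sin_sq_add_cos_sq θ
      simp only [Prod.fst_zero, Prod.snd_zero] at e1 e2
      rw [e1, e2] at this
      norm_num at this, rfl⟩
  filter_upwards [measure_eq_zero_iff_ae_notMem.1 n1, measure_eq_zero_iff_ae_notMem.1 n2]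
    with x h1 h2
  have h2' : x.2 ≠ O.2 := fun h => h1 ⟨x.1 - O.1, by ext <;> simp [h]⟩
  refine ⟨fun h => h2' (by rw [h]), h2', fun k hk => h2 ?_⟩
  obtain ⟨r, -, -, hr⟩ := exists_polar O x
  rw [div_eq_iff (by positivity)] at hk
  have e : directionAngle O x = θ - k * (2 * Real.pi) := by linarith
  rw [e, Real.cos_sub_int_mul_two_pi, Real.sin_sub_int_mul_two_pi] at hr
  exact ⟨r, hr⟩

lemma IsMass.continuous_sweptMass {μ : Measure (ℝ × ℝ)} (hμ : IsMass μ) :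
    Continuous fun P : (ℝ × ℝ) × ℝ => sweptMass μ P.1 P.2 := by
  have := hμ.1
  have hpi := Real.pi_pos
  rw [continuous_iff_continuousAt]
  rintro ⟨O, θ⟩
  refine tendsto_integral_filter_of_dominated_convergence (fun _ => |θ| + 1 + 2)
    (Filter.Eventually.of_forall fun P => (integrable_sweepCount μ P.1 P.2).1) ?_
    (integrable_const _) ?_
  · have : ∀ᶠ P : (ℝ × ℝ) × ℝ in nhds (O, θ), |P.2| < |θ| + 1 :=
      (continuous_snd.abs.tendsto (O, θ)).eventually (gt_mem_nhds (lt_add_one _))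
    filter_upwards [this] with P hP
    refine Filter.Eventually.of_forall fun x => (abs_sweepCount_le P.1 P.2 x).trans ?_
    linarith
  · filter_upwards [hμ.ae_generic O θ] with x hgen
    obtain ⟨-, hx, hk⟩ := hgen
    have hc : ContinuousAt (fun P : (ℝ × ℝ) × ℝ => (P.2 - directionAngle P.1 x) / (2 * Real.pi))
        (O, θ) := by
      have h1 : ContinuousAt (fun P : (ℝ × ℝ) × ℝ => directionAngle P.1 x) (O, θ) :=
        ContinuousAt.comp (f := fun P : (ℝ × ℝ) × ℝ => P.1) (continuousAt_directionAngle hx)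
          continuousAt_fst
      exact (continuousAt_snd.sub h1).div_const _
    set y := (θ - directionAngle O x) / (2 * Real.pi) with hy
    have hlt : (⌊y⌋ : ℝ) < y := lt_of_le_of_ne (Int.floor_le y) (hk _).symm
    have hev := hc.eventually (Ioo_mem_nhds hlt (Int.lt_floor_add_one y))
    refine tendsto_const_nhds.congr' ?_
    filter_upwards [hev] with P hP
    have : ⌊(P.2 - directionAngle P.1 x) / (2 * Real.pi)⌋ = ⌊y⌋ :=
      Int.floor_eq_iff.2 ⟨hP.1.le, hP.2⟩
    rw [sweepCount, sweepCount, this]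

lemma tendsto_uncurried {f : ℝ × ℝ → ℝ → ℝ} (hf : Continuous fun P : (ℝ × ℝ) × ℝ => f P.1 P.2)
    {ι : Type*} {l : Filter ι} {P : ι → ℝ × ℝ} {t : ι → ℝ} {O : ℝ × ℝ} {θ : ℝ}
    (hP : Filter.Tendsto P l (nhds O)) (ht : Filter.Tendsto t l (nhds θ)) :
    Filter.Tendsto (fun n => f (P n) (t n)) l (nhds (f O θ)) := by
  have h := (hf.tendsto (O, θ)).comp (hP.prodMk_nhds ht)
  exact h

lemma IsMass.tendsto_sweptMass {μ : MeasureTheory.Measure (ℝ × ℝ)} (hμ : IsMass μ)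
    {ι : Type*} {l : Filter ι}
    {P : ι → ℝ × ℝ} {t : ι → ℝ} {O : ℝ × ℝ} {θ : ℝ} (hP : Filter.Tendsto P l (nhds O))
    (ht : Filter.Tendsto t l (nhds θ)) :
    Filter.Tendsto (fun n => sweptMass μ (P n) (t n)) l (nhds (sweptMass μ O θ)) :=
  tendsto_uncurried (f := sweptMass μ) hμ.continuous_sweptMass hP ht

/-- Swept mass computes the mass of wedges. -/
lemma IsMass.measureReal_wedge {μ : Measure (ℝ × ℝ)} (hμ : IsMass μ) (O : ℝ × ℝ) {α β : ℝ}
    (h1 : α ≤ β) (h2 : β ≤ α + 2 * Real.pi) :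
    μ.real (Wedge O α β) = sweptMass μ O β - sweptMass μ O α := by
  have := hμ.1
  have hpi := Real.pi_pos
  set M : Set (ℝ × ℝ) := {x | sweepCount O β x = sweepCount O α x + 1} with hM
  have hMm : MeasurableSet M := by
    have m1 := measurable_sweepCount O β
    have m2 := measurable_sweepCount O α
    exact measurableSet_eq_fun m1 (m2.add_const 1)
  have hae : Wedge O α β =ᵐ[μ] M := by
    filter_upwards [hμ.ae_generic O α] with x hgen
    obtain ⟨hxO, -, hk⟩ := hgen
    rw [eq_iff_iff]
    set a := directionAngle O x with ha
    obtain ⟨r, -, hr, hx⟩ := exists_polar O x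
    constructor
    · rintro (hx' | ⟨s, hs, θ, hθ, rfl⟩)
      · exact absurd hx' hxO
      · obtain ⟨k, hk'⟩ := exists_eq_directionAngle_add (O := O) (θ := θ) hs
        rw [← ha] at hk'
        have hlt : (α - a) / (2 * Real.pi) < k := by
          refine lt_of_le_of_ne ?_ (hk k)
          rw [div_le_iff₀ (by positivity)]
          linarith [hθ.1]
        have hα : ⌊(α - a) / (2 * Real.pi)⌋ < k := Int.floor_lt.2 hlt
        have hβ : k ≤ ⌊(β - a) / (2 * Real.pi)⌋ := by
          rw [Int.le_floor, le_div_iff₀ (by positivity)]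
          linarith [hθ.2]
        have hle : ⌊(β - a) / (2 * Real.pi)⌋ ≤ ⌊(α - a) / (2 * Real.pi)⌋ + 1 := by
          rw [← Int.floor_add_one]
          apply Int.floor_le_floor
          rw [div_add_one (by positivity)]
          gcongr
          linarith
        change sweepCount O β _ = sweepCount O α _ + 1
        simp only [sweepCount, ← ha]
        omega
    · intro hx'
      change sweepCount O β x = sweepCount O α x + 1 at hx'
      simp only [sweepCount, ← ha] at hx'
      right
      set k := ⌊(β - a) / (2 * Real.pi)⌋ with hk'
      have u1 : (k : ℝ) ≤ (β - a) / (2 * Real.pi) := Int.floor_le _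
      have u2 : (α - a) / (2 * Real.pi) < k := by
        have := Int.lt_floor_add_one ((α - a) / (2 * Real.pi))
        have e : k = ⌊(α - a) / (2 * Real.pi)⌋ + 1 := by omega
        rw [e]
        push_cast
        exact this
      rw [le_div_iff₀ (by positivity)] at u1
      rw [div_lt_iff₀ (by positivity)] at u2
      refine ⟨r, hr hxO, a + k * (2 * Real.pi), ⟨by linarith, by linarith⟩, ?_⟩
      rw [Real.cos_add_int_mul_two_pi, Real.sin_add_int_mul_two_pi]
      exact hx
  have hdiff : ∀ x, (sweepCount O β x : ℝ) - sweepCount O α x = M.indicator (fun _ => 1) x := by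
    intro x
    set a := directionAngle O x with ha
    have l1 : ⌊(α - a) / (2 * Real.pi)⌋ ≤ ⌊(β - a) / (2 * Real.pi)⌋ :=
      Int.floor_le_floor (by gcongr)
    have l2 : ⌊(β - a) / (2 * Real.pi)⌋ ≤ ⌊(α - a) / (2 * Real.pi)⌋ + 1 := by
      rw [← Int.floor_add_one]
      apply Int.floor_le_floor
      rw [div_add_one (by positivity)]
      gcongr
      linarith
    by_cases hx : x ∈ M
    · rw [Set.indicator_of_mem hx, show sweepCount O β x = sweepCount O α x + 1 from hx]
      push_cast
      ring
    · rw [Set.indicator_of_notMem hx]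
      have hx' : sweepCount O β x ≠ sweepCount O α x + 1 := hx
      have : sweepCount O β x = sweepCount O α x := by
        simp only [sweepCount, ← ha] at hx' ⊢
        omega
      rw [this, sub_self]
  rw [measureReal_congr hae, sweptMass, sweptMass,
    ← integral_sub (integrable_sweepCount μ O β) (integrable_sweepCount μ O α)]
  simp only [hdiff]
  rw [integral_indicator_const _ hMm]
  simp

/-- A nonnegative combination of two unit vectors at angular distance at most `π` points in a
direction between them. -/
lemma exists_polar_add {r s θ φ : ℝ} (hr : 0 ≤ r) (hs : 0 ≤ s) (h1 : θ ≤ φ)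
    (h2 : φ ≤ θ + Real.pi) :
    ∃ ρ : ℝ, 0 ≤ ρ ∧ ∃ χ ∈ Set.Icc θ φ,
      r • (Real.cos θ, Real.sin θ) + s • (Real.cos φ, Real.sin φ) =
        ρ • (Real.cos χ, Real.sin χ) := by
  have hpi := Real.pi_pos
  obtain ⟨δ, rfl⟩ : ∃ δ, φ = θ + δ := ⟨φ - θ, by ring⟩
  have hδ0 : 0 ≤ δ := by linarith
  have hδ1 : δ ≤ Real.pi := by linarith
  have hsin := Real.sin_nonneg_of_nonneg_of_le_pi hδ0 hδ1
  set z : ℂ := ⟨r + s * Real.cos δ, s * Real.sin δ⟩ with hz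
  have c1 : ‖z‖ * Real.cos z.arg = r + s * Real.cos δ := Complex.norm_mul_cos_arg z
  have c2 : ‖z‖ * Real.sin z.arg = s * Real.sin δ := Complex.norm_mul_sin_arg z
  have harg0 : 0 ≤ z.arg := Complex.arg_nonneg_iff.2 (mul_nonneg hs hsin)
  have hargδ : z.arg ≤ δ := by
    by_contra hlt
    push Not at hlt
    have hz0 : z ≠ 0 := fun h => by
      rw [h, Complex.arg_zero] at hlt
      linarith
    have hle := Complex.arg_le_pi z
    rcases (show z.arg - δ ≤ Real.pi by linarith).lt_or_eq with h | h
    · have hp := mul_pos (norm_pos_iff.2 hz0) (Real.sin_pos_of_pos_of_lt_pi (by linarith) h)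
      rw [Real.sin_sub] at hp
      have : ‖z‖ * (Real.sin z.arg * Real.cos δ - Real.cos z.arg * Real.sin δ) =
          -(r * Real.sin δ) := by
        linear_combination Real.cos δ * c2 - Real.sin δ * c1
      rw [this] at hp
      nlinarith [mul_nonneg hr hsin]
    · have hδ : δ = 0 := by linarith
      have harg : z.arg = Real.pi := by linarith
      rw [hδ, harg, Real.cos_pi, Real.cos_zero] at c1
      have := norm_pos_iff.2 hz0
      linarith
  refine ⟨‖z‖, norm_nonneg z, θ + z.arg, ⟨by linarith, by linarith⟩, ?_⟩
  ext
  · simp only [Prod.fst_add, Prod.smul_fst, smul_eq_mul, Real.cos_add]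
    linear_combination -Real.cos θ * c1 + Real.sin θ * c2
  · simp only [Prod.snd_add, Prod.smul_snd, smul_eq_mul, Real.sin_add]
    linear_combination -Real.sin θ * c1 - Real.cos θ * c2

lemma mem_wedge_iff {O x : ℝ × ℝ} {α β : ℝ} (h : α ≤ β) :
    x ∈ Wedge O α β ↔
      ∃ r : ℝ, 0 ≤ r ∧ ∃ θ ∈ Set.Icc α β, x = O + r • (Real.cos θ, Real.sin θ) := by
  constructor
  · rintro (rfl | ⟨r, hr, hx⟩)
    · exact ⟨0, le_rfl, α, ⟨le_rfl, h⟩, by simp⟩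
    · exact ⟨r, hr.le, hx⟩
  · rintro ⟨r, hr, θ, hθ, rfl⟩
    rcases hr.eq_or_lt with rfl | hr
    · left; simp
    · exact Or.inr ⟨r, hr, θ, hθ, rfl⟩

lemma convex_wedge (O : ℝ × ℝ) {α β : ℝ} (h1 : α ≤ β) (h2 : β ≤ α + Real.pi) :
    Convex ℝ (Wedge O α β) := by
  intro x hx y hy a b ha hb hab
  rw [mem_wedge_iff h1] at hx hy ⊢
  obtain ⟨r, hr, θ, hθ, rfl⟩ := hx
  obtain ⟨s, hs, φ, hφ, rfl⟩ := hy
  have hO : a • O + b • O = O := by rw [← add_smul, hab, one_smul]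
  have e : a • (O + r • (Real.cos θ, Real.sin θ)) + b • (O + s • (Real.cos φ, Real.sin φ)) =
      O + ((a * r) • (Real.cos θ, Real.sin θ) + (b * s) • (Real.cos φ, Real.sin φ)) := by
    nth_rewrite 3 [← hO]
    simp only [smul_add, smul_smul]
    abel
  rw [e]
  rcases le_total θ φ with h | h
  · obtain ⟨ρ, hρ, χ, hχ, hsum⟩ := exists_polar_add (mul_nonneg ha hr) (mul_nonneg hb hs) h
      (by linarith [hφ.2, hθ.1])
    exact ⟨ρ, hρ, χ, ⟨hθ.1.trans hχ.1, hχ.2.trans hφ.2⟩, by rw [hsum]⟩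
  · obtain ⟨ρ, hρ, χ, hχ, hsum⟩ := exists_polar_add (mul_nonneg hb hs) (mul_nonneg ha hr) h
      (by linarith [hθ.2, hφ.1])
    exact ⟨ρ, hρ, χ, ⟨hφ.1.trans hχ.1, hχ.2.trans hθ.2⟩, by rw [add_comm (_ • _), hsum]⟩

/-- Points of a half-turn wedge lie on one side of its boundary line. -/
lemma wedge_half_turn_nonneg {O x : ℝ × ℝ} {α : ℝ} (hx : x ∈ Wedge O α (α + Real.pi)) :
    0 ≤ (x.2 - O.2) * Real.cos α - (x.1 - O.1) * Real.sin α := by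
  have hpi := Real.pi_pos
  obtain ⟨r, hr, θ, hθ, rfl⟩ := (mem_wedge_iff (by linarith)).1 hx
  have hsin : 0 ≤ Real.sin (θ - α) :=
    Real.sin_nonneg_of_nonneg_of_le_pi (by linarith [hθ.1]) (by linarith [hθ.2])
  rw [Real.sin_sub] at hsin
  simp only [Prod.fst_add, Prod.snd_add, Prod.smul_fst, Prod.smul_snd, smul_eq_mul,
    add_sub_cancel_left]
  nlinarith

/-- Angular distribution functions mixing the mass with a small uniform angular density. -/
def mixedSweptMass (μ : Measure (ℝ × ℝ)) (ε : ℝ) (O : ℝ × ℝ) (θ : ℝ) : ℝ :=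
  (1 - ε) * sweptMass μ O θ + ε * (θ / (2 * Real.pi))

lemma IsMass.mixedSweptMass_half_turn_le {μ : Measure (ℝ × ℝ)} (hμ : IsMass μ) {ε η R : ℝ}
    (hε0 : 0 ≤ ε) (hεη : ε ≤ η) (hR : μ.real {x | R ≤ ‖x‖} ≤ η) {O : ℝ × ℝ} {α : ℝ}
    (hsub : ∀ x : ℝ × ℝ, 0 ≤ (x.2 - O.2) * Real.cos α - (x.1 - O.1) * Real.sin α → R ≤ ‖x‖) :
    mixedSweptMass μ ε O (α + Real.pi) - mixedSweptMass μ ε O α ≤ 2 * η := by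
  have := hμ.1
  have hpi := Real.pi_pos
  have h1 := hμ.measureReal_wedge O (show α ≤ α + Real.pi by linarith) (by linarith)
  have h2 : μ.real (Wedge O α (α + Real.pi)) ≤ η :=
    (measureReal_mono fun x hx => hsub x (wedge_half_turn_nonneg hx)).trans hR
  have h3 : 0 ≤ μ.real (Wedge O α (α + Real.pi)) := measureReal_nonneg
  have h4 : mixedSweptMass μ ε O (α + Real.pi) - mixedSweptMass μ ε O α =
      (1 - ε) * (sweptMass μ O (α + Real.pi) - sweptMass μ O α) + ε / 2 := by
    unfold mixedSweptMass
    field_simp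
    ring
  rw [h4, ← h1]
  nlinarith

lemma exists_measureReal_norm_ge_le (μ : Measure (ℝ × ℝ)) [IsFiniteMeasure μ] {η : ℝ}
    (hη : 0 < η) : ∃ R : ℝ, μ.real {x | R ≤ ‖x‖} ≤ η := by
  have h := tendsto_measure_norm_gt_of_isTightMeasureSet (isTightMeasureSet_singleton (μ := μ))
  have h' := h.eventually (gt_mem_nhds (ENNReal.ofReal_pos.2 hη))
  obtain ⟨r, hr⟩ := h'.exists
  simp only [Set.mem_singleton_iff, iSup_iSup_eq_left] at hr
  refine ⟨r + 1, ENNReal.toReal_le_of_le_ofReal hη.le ((measure_mono fun x hx => ?_).trans hr.le)⟩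
  exact (lt_add_one r).trans_le hx

/-- Fans with convex blocks exist for the mass mixed with a small uniform angular density, within
a square that does not depend on the mixing parameter. -/
lemma IsMass.exists_fan {μ : Measure (ℝ × ℝ)} (hμ : IsMass μ) {p q : ℕ} (hp : 3 ≤ p)
    (hq : q + 2 = 3 * p) {ε R : ℝ} (hε0 : 0 < ε) (hε : ε ≤ 1 / (16 * q))
    (hR : μ.real {x | R ≤ ‖x‖} ≤ 1 / (16 * q)) :
    ∃ (O : ℝ × ℝ) (T : ℤ → ℝ), (|O.1| ≤ R ∧ |O.2| ≤ R) ∧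
      (∀ j : ℤ, mixedSweptMass μ ε O (T j) = j / q) ∧ (∀ j : ℤ, |T j| ≤ 2 * Real.pi * |(j : ℝ)|) ∧
      (∀ j : ℤ, T (j + q) = T j + 2 * Real.pi) ∧ (∀ j, T j ≤ T (j + 1)) ∧
      ∀ i, T (i + p) - T i ≤ Real.pi := by
  have := hμ.1
  have hpi := Real.pi_pos
  have hq1 : (1 : ℝ) ≤ q := by exact_mod_cast (show 1 ≤ q by omega)
  have hε1 : ε < 1 := by
    refine hε.trans_lt ?_
    rw [div_lt_one (by positivity)]
    linarith
  have hmono : ∀ O, StrictMono (mixedSweptMass μ ε O) := by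
    intro O a b hab
    have h1 := mul_le_mul_of_nonneg_left (monotone_sweptMass μ O hab.le) (sub_nonneg.2 hε1.le)
    have h2 : ε * (a / (2 * Real.pi)) < ε * (b / (2 * Real.pi)) := by gcongr
    unfold mixedSweptMass
    linarith
  have hcont := hμ.continuous_sweptMass
  have hshift : ∀ O θ, mixedSweptMass μ ε O (θ + 2 * Real.pi) = mixedSweptMass μ ε O θ + 1 := by
    intro O θ
    unfold mixedSweptMass
    rw [sweptMass_add_two_pi]
    field_simp
    ring
  have hzero : ∀ O, mixedSweptMass μ ε O 0 = 0 := fun O => by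
    simp [mixedSweptMass, sweptMass_zero]
  have h8 : 1 / (8 * (q : ℝ)) = 2 * (1 / (16 * q)) := by field_simp; norm_num
  have hn1 : ∀ x : ℝ × ℝ, |x.1| ≤ ‖x‖ := fun x => norm_fst_le x
  have hn2 : ∀ x : ℝ × ℝ, |x.2| ≤ ‖x‖ := fun x => norm_snd_le x
  obtain ⟨O, T, hOR, hT, hconv⟩ := exists_fan_with_convex_blocks hp hq (R := R) hmono
    (fun O => by
      have : Continuous fun θ => sweptMass μ O θ := hcont.comp (by fun_prop : Continuous (O, ·))
      unfold mixedSweptMass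
      fun_prop) hshift hzero
    (fun θ => by
      have : Continuous fun O => sweptMass μ O θ := hcont.comp (by fun_prop : Continuous (·, θ))
      unfold mixedSweptMass
      fun_prop)
    (fun O hO => h8 ▸ hμ.mixedSweptMass_half_turn_le hε0.le hε hR fun x hx => by
      simp only [Real.cos_neg, Real.sin_neg, Real.cos_pi_div_two, Real.sin_pi_div_two] at hx
      linarith [le_abs_self x.1, hn1 x])
    (fun O hO => h8 ▸ hμ.mixedSweptMass_half_turn_le hε0.le hε hR fun x hx => by
      simp only [Real.cos_pi_div_two, Real.sin_pi_div_two] at hx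
      linarith [neg_abs_le x.1, hn1 x])
    (fun O hO => h8 ▸ hμ.mixedSweptMass_half_turn_le hε0.le hε hR fun x hx => by
      simp only [Real.cos_zero, Real.sin_zero] at hx
      linarith [le_abs_self x.2, hn2 x])
    (fun O hO => h8 ▸ hμ.mixedSweptMass_half_turn_le hε0.le hε hR fun x hx => by
      simp only [Real.cos_neg, Real.sin_neg, Real.cos_pi, Real.sin_pi] at hx
      linarith [neg_abs_le x.2, hn2 x])
  have hq' : (0 : ℝ) < q := by linarith
  have hTle : ∀ i j : ℤ, i ≤ j → T i ≤ T j := by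
    intro i j hij
    rw [← (hmono O).le_iff_le, hT, hT]
    have : (i : ℝ) ≤ j := by exact_mod_cast hij
    gcongr
  have hTper : ∀ j : ℤ, T (j + q) = T j + 2 * Real.pi := by
    intro j
    apply (hmono O).injective
    rw [hshift, hT, hT]
    push_cast
    field_simp
  have hT0 : T 0 = 0 := (hmono O).injective (by rw [hT, hzero]; simp)
  have hTmul : ∀ m : ℤ, T (m * q) = m * (2 * Real.pi) := by
    intro m
    have := map_add_int_mul_of_map_add hTper m 0
    rwa [zero_add, hT0, zero_add] at this
  refine ⟨O, T, hOR, hT, fun j => ?_, hTper, fun j => hTle _ _ (by omega), hconv⟩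
  have hqz : (1 : ℤ) ≤ q := by omega
  have hj : |j| ≤ |j| * q := le_mul_of_one_le_right (abs_nonneg j) hqz
  have u1 := hTle j (|j| * q) ((le_abs_self j).trans hj)
  have u2 := hTle (-|j| * q) j (by linarith [neg_abs_le j])
  rw [hTmul] at u1 u2
  push_cast at u1 u2
  exact abs_le.2 ⟨by linarith, by linarith⟩

/-- If `p ≥ 3` is odd and `q = 3p - 2`, every mass admits a `(q,p)`-spiral
equicovering. -/
theorem spiral_equicovering_of_q_eq_three_p_sub_two (p q : ℕ) (hp : 3 ≤ p)
    (hodd : Odd p) (hq : q + 2 = 3 * p) :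
    ∀ μ : Measure (ℝ × ℝ), IsMass μ → IsSpiralEquicovering μ q p := by
  intro μ hμ
  have := hμ.1
  have hpi := Real.pi_pos
  have hq1 : (1 : ℝ) ≤ q := by exact_mod_cast (show 1 ≤ q by omega)
  have hq' : (0 : ℝ) < q := by linarith
  obtain ⟨R, hR⟩ := exists_measureReal_norm_ge_le μ (show (0 : ℝ) < 1 / (16 * q) by positivity)
  set ε : ℕ → ℝ := fun n => 1 / (16 * q) * (1 / ((n : ℝ) + 1)) with hε
  have hε0 : ∀ n, 0 < ε n := fun n => by positivity
  have hε1 : ∀ n, ε n ≤ 1 / (16 * q) := by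
    intro n
    have : 1 / ((n : ℝ) + 1) ≤ 1 := by
      rw [div_le_one (by positivity)]
      linarith [(Nat.cast_nonneg n : (0 : ℝ) ≤ n)]
    exact mul_le_of_le_one_right (by positivity) this
  choose O T hOR hT hTbd hTper hTmono hTconv using
    fun n => hμ.exists_fan hp hq (hε0 n) (hε1 n) hR
  obtain ⟨𝒰, h𝒰⟩ : ∃ 𝒰 : Ultrafilter ℕ, (𝒰 : Filter ℕ) ≤ Filter.atTop :=
    ⟨Filter.hyperfilter ℕ, Nat.hyperfilter_le_atTop⟩
  have hlim : ∀ {X : Type} [TopologicalSpace X] {K : Set X} (_ : IsCompact K) {u : ℕ → X}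
      (_ : ∀ n, u n ∈ K), ∃ x, Filter.Tendsto u 𝒰 (nhds x) := by
    intro X _ K hK u hu
    obtain ⟨x, -, hx⟩ := hK.ultrafilter_le_nhds (𝒰.map u)
      (Filter.le_principal_iff.2 (Filter.mem_map.2 (Filter.Eventually.of_forall hu)))
    exact ⟨x, hx⟩
  obtain ⟨O', hO'⟩ := hlim (isCompact_closedBall (0 : ℝ × ℝ) R) (u := O) fun n =>
    mem_closedBall_zero_iff.2 (max_le (hOR n).1 (hOR n).2)
  choose θ hθ using fun j : ℤ => hlim (isCompact_Icc (a := -(2 * Real.pi * |(j : ℝ)|))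
    (b := 2 * Real.pi * |(j : ℝ)|)) (u := fun n => T n j) fun n => abs_le.1 (hTbd n j)
  have hε' : Filter.Tendsto ε 𝒰 (nhds 0) := by
    have := (tendsto_one_div_add_atTop_nhds_zero_nat (𝕜 := ℝ)).const_mul (1 / (16 * (q : ℝ)))
    rw [mul_zero] at this
    exact this.mono_left h𝒰
  have hswept : ∀ j : ℤ, sweptMass μ O' (θ j) = j / q := by
    intro j
    have h1 : Filter.Tendsto (fun n => sweptMass μ (O n) (T n j)) 𝒰 (nhds (sweptMass μ O' (θ j))) := 
      hμ.tendsto_sweptMass hO' (hθ j)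
    have h2 : Filter.Tendsto (fun n => mixedSweptMass μ (ε n) (O n) (T n j)) 𝒰
        (nhds ((1 - 0) * sweptMass μ O' (θ j) + 0 * (θ j / (2 * Real.pi)))) := by
      unfold mixedSweptMass
      exact ((tendsto_const_nhds.sub hε').mul h1).add (hε'.mul ((hθ j).div_const _))
    simp only [hT] at h2
    have := tendsto_nhds_unique h2 tendsto_const_nhds
    linarith
  have hmono : ∀ j, θ j ≤ θ (j + 1) := fun j =>
    le_of_tendsto_of_tendsto' (hθ j) (hθ (j + 1)) fun n => hTmono n j
  have hle : ∀ i : ℤ, θ i ≤ θ (i + p) := fun i =>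
    monotone_int_of_le_succ hmono (by omega)
  have hconv : ∀ i : ℤ, θ (i + p) - θ i ≤ Real.pi := fun i =>
    le_of_tendsto' ((hθ (i + p)).sub (hθ i)) fun n => hTconv n i
  refine ⟨O', θ, fun j => ?_, hmono, fun i => ⟨?_, ?_⟩⟩
  · refine tendsto_nhds_unique (hθ (j + q)) ?_
    simp only [hTper]
    exact (hθ j).add_const _
  · exact convex_wedge O' (hle i) (by linarith [hconv i])
  · have h := hμ.measureReal_wedge O' (hle i) (by linarith [hconv i])
    rw [hswept, hswept] at h
    rw [← ENNReal.ofReal_toReal (measure_ne_top μ (Wedge O' (θ i) (θ (i + p))))]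
    congr 1
    rw [← measureReal_def, h]
    push_cast
    ring
end
end

section
/- Let μ be a mass on ℝ² and let a, b, c ≥ 0 be real numbers with a + b + c = 1/2. Then there exist a point O ∈ ℝ² and angles θ_1 ≤ θ_2 ≤ θ_3 ≤ θ_1 + π such that, setting θ_{j+3} := θ_j + π for j = 1, 2, 3, 4 (so the six rays from O at angles θ_1, …, θ_6 form three concurrent lines), the six wedges W(O, θ_j, θ_{j+1}) for j = 1, …, 6 have μ-measures a, b, c, a, b, c respectively. -/
open MeasureTheory

noncomputable section

namespace MassPartition

open Real Set Filter Topology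

/-- The unit vector at angle `θ`. -/
def dir (θ : ℝ) : ℝ × ℝ := (cos θ, sin θ)

/-- The signed distance of `x` to the line through the origin at angle `θ`. -/
def side (θ : ℝ) (x : ℝ × ℝ) : ℝ := cos θ * x.2 - sin θ * x.1

/-- The open sector with apex `O` between the angles `θ` and `φ`, for `θ ≤ φ ≤ θ + π`. -/
def sector (θ φ : ℝ) (O : ℝ × ℝ) : Set (ℝ × ℝ) :=
  {x | 0 < side θ (x - O) ∧ side φ (x - O) < 0}

/-- The point with coordinates `(t, k)` in the orthonormal frame at angle `θ`. -/
def framePoint (θ k t : ℝ) : ℝ × ℝ := t • dir θ + k • dir (θ + π / 2)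

/-- All lines are null sets. -/
def LineNull (μ : Measure (ℝ × ℝ)) : Prop := ∀ θ k, μ {x | side θ x = k} = 0

lemma side_add (θ : ℝ) (x y : ℝ × ℝ) : side θ (x + y) = side θ x + side θ y := by
  simp [side]; ring

lemma side_sub (θ : ℝ) (x y : ℝ × ℝ) : side θ (x - y) = side θ x - side θ y := by
  simp [side]; ring

lemma side_smul (θ r : ℝ) (x : ℝ × ℝ) : side θ (r • x) = r * side θ x := by
  simp [side]; ring

lemma side_dir (θ φ : ℝ) : side θ (dir φ) = sin (φ - θ) := by
  simp [side, dir, sin_sub]; ring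

lemma side_add_pi (θ : ℝ) (x : ℝ × ℝ) : side (θ + π) x = -side θ x := by
  simp [side]; ring

lemma side_framePoint (θ α k t : ℝ) :
    side (θ + α) (framePoint θ k t) = -t * sin α + k * cos α := by
  rw [framePoint, side_add, side_smul, side_smul, side_dir, side_dir,
    show θ - (θ + α) = -α by ring, show θ + π / 2 - (θ + α) = π / 2 - α by ring, sin_neg,
    sin_pi_div_two_sub]
  ring

lemma side_framePoint_self (θ k t : ℝ) : side θ (framePoint θ k t) = k := by
  simpa using side_framePoint θ 0 k t

lemma framePoint_add_pi (θ k t : ℝ) : framePoint (θ + π) (-k) (-t) = framePoint θ k t := by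
  have : θ + π + π / 2 = θ + π / 2 + π := by ring
  simp only [framePoint, dir, this, cos_add_pi, sin_add_pi]
  ext <;> simp

/-- Three linear forms in the plane are linearly dependent. -/
lemma side_relation (θ φ ψ : ℝ) (x : ℝ × ℝ) :
    sin (ψ - φ) * side θ x + sin (φ - θ) * side ψ x = sin (ψ - θ) * side φ x := by
  simp only [side, sin_sub]
  ring

lemma continuous_side_right (θ : ℝ) : Continuous (side θ) := by
  unfold side; fun_prop

lemma continuous_framePoint {X : Type*} [TopologicalSpace X] {f k t : X → ℝ} (hf : Continuous f)
    (hk : Continuous k) (ht : Continuous t) : Continuous fun x => framePoint (f x) (k x) (t x) := by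
  unfold framePoint dir; fun_prop

lemma isOpen_sector (θ φ : ℝ) (O : ℝ × ℝ) : IsOpen (sector θ φ O) := by
  have h1 := continuous_side_right θ
  have h2 := continuous_side_right φ
  exact (isOpen_lt continuous_const (h1.comp (continuous_id.sub continuous_const))).inter
    (isOpen_lt (h2.comp (continuous_id.sub continuous_const)) continuous_const)

lemma sector_add_two_pi (θ φ : ℝ) (O : ℝ × ℝ) :
    sector (θ + 2 * π) (φ + 2 * π) O = sector θ φ O := by
  simp [sector, side]

lemma sector_self (θ : ℝ) (O : ℝ × ℝ) : sector θ θ O = ∅ := by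
  ext x; simp only [sector, mem_ofPred_eq, mem_empty_iff_false, iff_false]; intro h; linarith [h.1, h.2]

lemma sector_subset_left {θ φ ψ : ℝ} (h1 : θ ≤ φ) (h2 : φ ≤ ψ) (h3 : ψ ≤ θ + π) (O : ℝ × ℝ) :
    sector θ φ O ⊆ sector θ ψ O := by
  rintro x ⟨hx1, hx2⟩
  refine ⟨hx1, ?_⟩
  rcases h1.eq_or_lt with rfl | h1
  · linarith
  rcases h2.eq_or_lt with rfl | h2
  · exact hx2
  have hr := side_relation θ φ ψ (x - O)
  have s1 : 0 < sin (φ - θ) := sin_pos_of_pos_of_lt_pi (by linarith) (by linarith)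
  have s2 : 0 < sin (ψ - φ) := sin_pos_of_pos_of_lt_pi (by linarith) (by linarith)
  have s3 : 0 ≤ sin (ψ - θ) := sin_nonneg_of_nonneg_of_le_pi (by linarith) (by linarith)
  by_contra! h
  linarith [mul_pos s2 hx1, mul_nonneg s1.le h, mul_nonneg s3 (neg_nonneg.2 hx2.le)]

lemma sector_subset_right {θ φ ψ : ℝ} (h1 : θ ≤ φ) (h2 : φ ≤ ψ) (h3 : ψ ≤ θ + π) (O : ℝ × ℝ) :
    sector φ ψ O ⊆ sector θ ψ O := by
  rintro x ⟨hx1, hx2⟩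
  refine ⟨?_, hx2⟩
  rcases h1.eq_or_lt with rfl | h1
  · exact hx1
  rcases h2.eq_or_lt with rfl | h2
  · linarith
  have hr := side_relation θ φ ψ (x - O)
  have s1 : 0 < sin (φ - θ) := sin_pos_of_pos_of_lt_pi (by linarith) (by linarith)
  have s2 : 0 < sin (ψ - φ) := sin_pos_of_pos_of_lt_pi (by linarith) (by linarith)
  have s3 : 0 ≤ sin (ψ - θ) := sin_nonneg_of_nonneg_of_le_pi (by linarith) (by linarith)
  by_contra! h
  linarith [mul_pos s1 (neg_pos.2 hx2), mul_nonneg s2.le (neg_nonneg.2 h), mul_nonneg s3 hx1.le]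

section Measure

variable {μ : Measure (ℝ × ℝ)}

lemma LineNull.ae_side_ne (hμ : LineNull μ) (θ : ℝ) (O : ℝ × ℝ) :
    ∀ᵐ x ∂μ, side θ (x - O) ≠ 0 := by
  rw [ae_iff]
  simpa [side_sub, sub_eq_zero] using hμ θ (side θ O)

lemma wedge_ae_eq_sector (hμ : LineNull μ) {θ φ : ℝ} (h1 : θ ≤ φ) (h2 : φ ≤ θ + π) (O : ℝ × ℝ) :
    Wedge O θ φ =ᵐ[μ] sector θ φ O := by
  refine eventuallyEq_set.2 ?_
  filter_upwards [hμ.ae_side_ne θ O, hμ.ae_side_ne φ O] with x hx1 hx2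
  constructor
  · rintro (rfl | ⟨r, hr, τ, ⟨hτ1, hτ2⟩, rfl⟩)
    · simp [side] at hx1
    · change side θ (O + r • dir τ - O) ≠ 0 at hx1
      change side φ (O + r • dir τ - O) ≠ 0 at hx2
      change 0 < side θ (O + r • dir τ - O) ∧ side φ (O + r • dir τ - O) < 0
      simp only [add_sub_cancel_left, side_smul, side_dir] at hx1 hx2 ⊢
      refine ⟨lt_of_le_of_ne (mul_nonneg hr.le ?_) hx1.symm, lt_of_le_of_ne ?_ hx2⟩
      · exact sin_nonneg_of_nonneg_of_le_pi (by linarith) (by linarith)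
      · exact mul_nonpos_of_nonneg_of_nonpos hr.le
          (sin_nonpos_of_nonpos_of_neg_pi_le (by linarith) (by linarith))
  · rintro ⟨hx1, hx2⟩
    set y := x - O with hy
    let z : ℂ := ⟨cos θ * y.1 + sin θ * y.2, side θ y⟩
    have hz : 0 < z.im := hx1
    have hz0 : z ≠ 0 := fun h => by simp [h] at hz
    have hr : 0 < ‖z‖ := norm_pos_iff.2 hz0
    have hp1 : 0 < z.arg := by
      refine lt_of_le_of_ne (Complex.arg_nonneg_iff.2 hz.le) fun h => ?_
      have := Complex.norm_mul_sin_arg z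
      rw [← h] at this; simp at this; linarith
    have hp2 := Complex.arg_le_pi z
    have hc := Complex.norm_mul_cos_arg z
    have hs := Complex.norm_mul_sin_arg z
    have hyr : y = ‖z‖ • dir (θ + z.arg) := by
      have e := sin_sq_add_cos_sq θ
      have hc' : ‖z‖ * cos z.arg = cos θ * y.1 + sin θ * y.2 := hc
      have hs' : ‖z‖ * sin z.arg = cos θ * y.2 - sin θ * y.1 := hs
      ext
      · simp only [dir, Prod.smul_fst, smul_eq_mul, cos_add]
        linear_combination -y.1 * e - cos θ * hc' + sin θ * hs'
      · simp only [dir, Prod.smul_snd, smul_eq_mul, sin_add]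
        linear_combination -y.2 * e - sin θ * hc' - cos θ * hs'
    refine Or.inr ⟨‖z‖, hr, θ + z.arg, ⟨by linarith, ?_⟩, ?_⟩
    · by_contra! hlt
      rw [hyr, side_smul, side_dir] at hx2
      exact hx2.not_ge (mul_nonneg hr.le (sin_nonneg_of_nonneg_of_le_pi (by linarith) (by linarith)))
    · change x = O + ‖z‖ • dir (θ + z.arg)
      rw [← hyr, hy]; abel

lemma measure_wedge [IsFiniteMeasure μ] (hμ : LineNull μ) {θ φ : ℝ} (h1 : θ ≤ φ)
    (h2 : φ ≤ θ + π) (O : ℝ × ℝ) :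
    μ (Wedge O θ φ) = ENNReal.ofReal (μ.real (sector θ φ O)) := by
  rw [measure_congr (wedge_ae_eq_sector hμ h1 h2 O), ofReal_measureReal]

/-- Three lines through `O` at angles `θ₁ ≤ θ₂ ≤ θ₃ ≤ θ₁ + π` cut the plane into six sectors of
masses `a, b, c, a, b, c`. -/
def IsSixPartition (μ : Measure (ℝ × ℝ)) (O : ℝ × ℝ) (θ₁ θ₂ θ₃ a b c : ℝ) : Prop :=
  (θ₁ ≤ θ₂ ∧ θ₂ ≤ θ₃ ∧ θ₃ ≤ θ₁ + π) ∧
    μ.real (sector θ₁ θ₂ O) = a ∧ μ.real (sector θ₂ θ₃ O) = b ∧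
    μ.real (sector θ₃ (θ₁ + π) O) = c ∧ μ.real (sector (θ₁ + π) (θ₂ + π) O) = a ∧
    μ.real (sector (θ₂ + π) (θ₃ + π) O) = b ∧ μ.real (sector (θ₃ + π) (θ₁ + 2 * π) O) = c

lemma IsSixPartition.rotate {O : ℝ × ℝ} {θ₁ θ₂ θ₃ a b c : ℝ}
    (h : IsSixPartition μ O θ₁ θ₂ θ₃ a b c) :
    IsSixPartition μ O θ₂ θ₃ (θ₁ + π) b c a := by
  obtain ⟨⟨h1, h2, h3⟩, ha, hb, hc, ha', hb', hc'⟩ := h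
  have e : θ₁ + π + π = θ₁ + 2 * π := by ring
  refine ⟨⟨h2, h3, by linarith⟩, hb, hc, ha', hb', ?_, ?_⟩
  · rwa [e]
  · rwa [e, sector_add_two_pi]

variable [IsProbabilityMeasure μ]

lemma tendsto_measureReal {ι : Type*} {l : Filter ι} [l.IsCountablyGenerated]
    {A : Set (ℝ × ℝ)} {As : ι → Set (ℝ × ℝ)} (hA : MeasurableSet A)
    (hAs : ∀ i, MeasurableSet (As i)) (h : ∀ᵐ x ∂μ, ∀ᶠ i in l, x ∈ As i ↔ x ∈ A) :
    Tendsto (fun i => μ.real (As i)) l (𝓝 (μ.real A)) :=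
  (ENNReal.tendsto_toReal (by finiteness)).comp
    (tendsto_measure_of_ae_tendsto_indicator_of_isFiniteMeasure l hA hAs h)

lemma continuous_measureReal_sector (hμ : LineNull μ) :
    Continuous fun q : ℝ × ℝ × (ℝ × ℝ) => μ.real (sector q.1 q.2.1 q.2.2) := by
  refine continuous_iff_continuousAt.2 fun q => ?_
  refine tendsto_measureReal (isOpen_sector _ _ _).measurableSet
    (fun _ => (isOpen_sector _ _ _).measurableSet) ?_
  filter_upwards [hμ.ae_side_ne q.1 q.2.2, hμ.ae_side_ne q.2.1 q.2.2] with x h1 h2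
  have c1 : ContinuousAt (fun q : ℝ × ℝ × (ℝ × ℝ) => side q.1 (x - q.2.2)) q := by
    unfold side; fun_prop
  have c2 : ContinuousAt (fun q : ℝ × ℝ × (ℝ × ℝ) => side q.2.1 (x - q.2.2)) q := by
    unfold side; fun_prop
  have e1 : ∀ᶠ p in 𝓝 q, (0 < side p.1 (x - p.2.2) ↔ 0 < side q.1 (x - q.2.2)) := by
    rcases lt_or_gt_of_ne h1 with h | h
    · filter_upwards [c1.eventually_lt continuousAt_const h] with p hp
      exact iff_of_false hp.not_gt h.not_gt
    · filter_upwards [continuousAt_const.eventually_lt c1 h] with p hp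
      exact iff_of_true hp h
  have e2 : ∀ᶠ p in 𝓝 q, (side p.2.1 (x - p.2.2) < 0 ↔ side q.2.1 (x - q.2.2) < 0) := by
    rcases lt_or_gt_of_ne h2 with h | h
    · filter_upwards [c2.eventually_lt continuousAt_const h] with p hp
      exact iff_of_true hp h
    · filter_upwards [continuousAt_const.eventually_lt c2 h] with p hp
      exact iff_of_false hp.not_gt h.not_gt
  filter_upwards [e1, e2] with p h1 h2
  exact and_congr h1 h2

lemma continuous_sector_comp (hμ : LineNull μ) {X : Type*} [TopologicalSpace X] {f g : X → ℝ}
    {P : X → ℝ × ℝ} (hf : Continuous f) (hg : Continuous g) (hP : Continuous P) :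
    Continuous fun x => μ.real (sector (f x) (g x) (P x)) :=
  Continuous.comp (f := fun x => (f x, g x, P x)) (continuous_measureReal_sector hμ)
    (hf.prodMk (hg.prodMk hP))

lemma measureReal_sector_add (hμ : LineNull μ) {θ φ ψ : ℝ} (h1 : θ ≤ φ) (h2 : φ ≤ ψ)
    (h3 : ψ ≤ θ + π) (O : ℝ × ℝ) :
    μ.real (sector θ φ O) + μ.real (sector φ ψ O) = μ.real (sector θ ψ O) := by
  rw [← measureReal_union _ (isOpen_sector _ _ _).measurableSet]
  · refine measureReal_congr (eventuallyEq_set.2 ?_)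
    filter_upwards [hμ.ae_side_ne φ O] with x hx
    constructor
    · rintro (h | h)
      · exact sector_subset_left h1 h2 h3 O h
      · exact sector_subset_right h1 h2 h3 O h
    · rintro ⟨ha, hb⟩
      rcases lt_or_gt_of_ne hx with h | h
      · exact Or.inl ⟨ha, h⟩
      · exact Or.inr ⟨h, hb⟩
  · exact Set.disjoint_left.2 fun x hx hx' => by linarith [hx.2, hx'.1]

/-- Complementary half-planes. -/
lemma measureReal_halfPlane_add (hμ : LineNull μ) (θ : ℝ) (O : ℝ × ℝ) :
    μ.real (sector θ (θ + π) O) + μ.real (sector (θ + π) (θ + 2 * π) O) = 1 := by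
  rw [← measureReal_union _ (isOpen_sector _ _ _).measurableSet]
  · rw [← probReal_univ (μ := μ)]
    refine measureReal_congr (eventuallyEq_set.2 ?_)
    filter_upwards [hμ.ae_side_ne θ O] with x hx
    refine iff_of_true ?_ trivial
    rcases lt_or_gt_of_ne hx with h | h
    · right
      have : side (θ + 2 * π) (x - O) = side θ (x - O) := by simp [side]
      exact ⟨by rw [side_add_pi]; linarith, by rw [this]; exact h⟩
    · left
      exact ⟨h, by rw [side_add_pi]; linarith⟩
  · refine Set.disjoint_left.2 fun x hx hx' => ?_
    linarith [hx.2, hx'.1]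

lemma measureReal_lt_of_isOpen [μ.IsOpenPosMeasure] {A B U : Set (ℝ × ℝ)} (hAB : A ⊆ B)
    (hUB : U ⊆ B) (hAU : Disjoint A U) (hU : IsOpen U) (hne : U.Nonempty) :
    μ.real A < μ.real B := by
  have h1 : μ.real (A ∪ U) = μ.real A + μ.real U := measureReal_union hAU hU.measurableSet
  have h2 : μ.real (A ∪ U) ≤ μ.real B := measureReal_mono (union_subset hAB hUB)
  have h3 : 0 < μ.real U := ENNReal.toReal_pos (hU.measure_pos μ hne).ne' (by finiteness)
  linarith

lemma measureReal_sector_pos [μ.IsOpenPosMeasure] {θ φ : ℝ} (h1 : θ < φ) (h2 : φ ≤ θ + π)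
    (O : ℝ × ℝ) : 0 < μ.real (sector θ φ O) := by
  refine ENNReal.toReal_pos ((isOpen_sector _ _ _).measure_pos μ
    ⟨O + dir ((θ + φ) / 2), ?_, ?_⟩).ne' (by finiteness)
  · rw [add_sub_cancel_left, side_dir]
    exact sin_pos_of_pos_of_lt_pi (by linarith) (by linarith)
  · rw [add_sub_cancel_left, side_dir]
    exact sin_neg_of_neg_of_neg_pi_lt (by linarith) (by linarith)

lemma strictMonoOn_measureReal_sector [μ.IsOpenPosMeasure] (hμ : LineNull μ) (θ : ℝ) (O : ℝ × ℝ) :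
    StrictMonoOn (fun α => μ.real (sector θ (θ + α) O)) (Icc 0 π) := by
  intro α hα β hβ hαβ
  have h := measureReal_sector_add hμ (θ := θ) (φ := θ + α) (ψ := θ + β)
    (by linarith [hα.1]) (by linarith) (by linarith [hβ.2]) O
  have h' := measureReal_sector_pos (μ := μ) (θ := θ + α) (φ := θ + β) (by linarith)
    (by linarith [hα.1, hβ.2]) O
  dsimp only
  linarith

lemma exists_halving (hμ : LineNull μ) (θ : ℝ) :
    ∃ k, μ.real (sector θ (θ + π) (framePoint θ k 0)) = 1 / 2 := by
  have hc : Continuous fun k => μ.real (sector θ (θ + π) (framePoint θ k 0)) :=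
    continuous_sector_comp hμ continuous_const continuous_const
      (continuous_framePoint continuous_const continuous_id continuous_const)
  have hmem : ∀ k x, x ∈ sector θ (θ + π) (framePoint θ k 0) ↔ k < side θ x := by
    intro k x
    simp [sector, side_add_pi, side_sub, side_framePoint_self]
  have htop : Tendsto (fun k => μ.real (sector θ (θ + π) (framePoint θ k 0))) atTop
      (𝓝 (μ.real ∅)) := by
    refine tendsto_measureReal MeasurableSet.empty
      (fun _ => (isOpen_sector _ _ _).measurableSet) (ae_of_all _ fun x => ?_)
    filter_upwards [eventually_ge_atTop (side θ x)] with k hk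
    simpa [hmem] using hk
  have hbot : Tendsto (fun k => μ.real (sector θ (θ + π) (framePoint θ k 0))) atBot
      (𝓝 (μ.real univ)) := by
    refine tendsto_measureReal MeasurableSet.univ
      (fun _ => (isOpen_sector _ _ _).measurableSet) (ae_of_all _ fun x => ?_)
    filter_upwards [eventually_lt_atBot (side θ x)] with k hk
    simpa [hmem] using hk
  rw [measureReal_empty] at htop
  rw [probReal_univ] at hbot
  obtain ⟨k₁, hk₁⟩ := (htop.eventually_lt_const (by norm_num : (0 : ℝ) < 1 / 2)).exists
  obtain ⟨k₂, hk₂⟩ := (hbot.eventually_const_lt (by norm_num : (1 / 2 : ℝ) < 1)).exists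
  exact mem_range_of_exists_le_of_exists_ge hc ⟨k₁, hk₁.le⟩ ⟨k₂, hk₂.le⟩

lemma strictAnti_measureReal_halfPlane [μ.IsOpenPosMeasure] (θ : ℝ) :
    StrictAnti fun k => μ.real (sector θ (θ + π) (framePoint θ k 0)) := by
  intro k l hkl
  have hmem : ∀ k x, x ∈ sector θ (θ + π) (framePoint θ k 0) ↔ k < side θ x := by
    intro k x
    simp [sector, side_add_pi, side_sub, side_framePoint_self]
  refine measureReal_lt_of_isOpen (U := {x | k < side θ x ∧ side θ x < l})
    (fun x hx => ?_) (fun x hx => (hmem _ _).2 hx.1) (Set.disjoint_left.2 fun x hx hx' => ?_) ?_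
    ⟨framePoint θ ((k + l) / 2) 0, ?_⟩
  · rw [hmem] at hx ⊢; linarith
  · rw [hmem] at hx; linarith [hx'.2]
  · exact (isOpen_lt continuous_const (continuous_side_right θ)).inter
      (isOpen_lt (continuous_side_right θ) continuous_const)
  · simp only [mem_ofPred_eq, side_framePoint_self]
    constructor <;> linarith

/-- The zero of a strictly monotone function depends continuously on parameters. -/
lemma continuous_of_strictMonoOn_zero {X : Type*} [TopologicalSpace X] {G : X → ℝ → ℝ} {p : X → ℝ}
    {S : Set ℝ} (hS : IsOpen S) (hG : ∀ t ∈ S, Continuous fun x => G x t)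
    (hmono : ∀ x, StrictMonoOn (G x) S) (hpS : ∀ x, p x ∈ S) (hp : ∀ x, G x (p x) = 0) :
    Continuous p := by
  refine continuous_iff_continuousAt.2 fun x₀ => Metric.tendsto_nhds.2 fun ε hε => ?_
  obtain ⟨δ, hδ, hball⟩ := Metric.isOpen_iff.1 hS (p x₀) (hpS x₀)
  obtain ⟨r, hr, hrε, hrδ⟩ : ∃ r, 0 < r ∧ r < ε ∧ r < δ :=
    ⟨min ε δ / 2, by positivity, by linarith [min_le_left ε δ, lt_min hε hδ],
      by linarith [min_le_right ε δ, lt_min hε hδ]⟩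
  have m1 : p x₀ - r ∈ S := hball (by simp [abs_of_pos hr, hrδ])
  have m2 : p x₀ + r ∈ S := hball (by simp [abs_of_pos hr, hrδ])
  have g1 : G x₀ (p x₀ - r) < 0 := hp x₀ ▸ hmono x₀ m1 (hpS x₀) (by linarith)
  have g2 : 0 < G x₀ (p x₀ + r) := hp x₀ ▸ hmono x₀ (hpS x₀) m2 (by linarith)
  filter_upwards [(hG _ m1).continuousAt.eventually_lt continuousAt_const g1,
    continuousAt_const.eventually_lt (hG _ m2).continuousAt g2] with x hx1 hx2
  rw [← hp x] at hx1 hx2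
  have := (hmono x).lt_iff_lt m1 (hpS x) |>.1 hx1
  have := (hmono x).lt_iff_lt (hpS x) m2 |>.1 hx2
  rw [Real.dist_eq, abs_lt]
  constructor <;> linarith

lemma sector_framePoint_zero (θ k t : ℝ) :
    sector θ (θ + π) (framePoint θ k t) = sector θ (θ + π) (framePoint θ k 0) := by
  simp [sector, side_add_pi, side_sub, side_framePoint_self]

lemma exists_continuous_halving [μ.IsOpenPosMeasure] (hμ : LineNull μ) :
    ∃ h : ℝ → ℝ, Continuous h ∧ (∀ θ, h (θ + π) = -h θ) ∧
      ∀ θ t, μ.real (sector θ (θ + π) (framePoint θ (h θ) t)) = 1 / 2 := by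
  choose h hh using exists_halving (μ := μ) hμ
  refine ⟨h, ?_, fun θ => ?_, fun θ t => by rw [sector_framePoint_zero, hh]⟩
  · refine continuous_of_strictMonoOn_zero (S := univ)
      (G := fun θ k => 1 / 2 - μ.real (sector θ (θ + π) (framePoint θ k 0))) isOpen_univ
      (fun k _ => ?_) (fun θ => ?_) (fun _ => mem_univ _) (fun θ => by simp [hh])
    · exact continuous_const.sub (continuous_sector_comp hμ continuous_id (by fun_prop)
        (continuous_framePoint continuous_id continuous_const continuous_const))
    · intro k _ l _ hkl
      have := strictAnti_measureReal_halfPlane (μ := μ) θ hkl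
      dsimp only at this ⊢
      linarith
  · refine (strictAnti_measureReal_halfPlane (μ := μ) (θ + π)).injective ?_
    have h1 := measureReal_halfPlane_add hμ θ (framePoint θ (h θ) 0)
    have h2 := framePoint_add_pi θ (h θ) 0
    rw [neg_zero] at h2
    rw [hh, h2, show θ + π + π = θ + 2 * π by ring]
    rw [hh] at h1
    linarith

/-- The angle cutting off mass `s` on the left of the halving line. -/
lemma exists_continuous_angle [μ.IsOpenPosMeasure] (hμ : LineNull μ) {h : ℝ → ℝ}
    (hcont : Continuous h)
    (hhalf : ∀ θ t, μ.real (sector θ (θ + π) (framePoint θ (h θ) t)) = 1 / 2)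
    {s : ℝ} (hs0 : 0 < s) (hs : s < 1 / 2) :
    ∃ α : ℝ → ℝ → ℝ, Continuous (fun q : ℝ × ℝ => α q.1 q.2) ∧ (∀ θ t, α θ t ∈ Ioo 0 π) ∧
      (∀ θ t, μ.real (sector θ (θ + α θ t) (framePoint θ (h θ) t)) = s) ∧
      ∀ θ, Monotone (α θ) := by
  have key : ∀ θ t, ∃ a ∈ Ioo 0 π,
      μ.real (sector θ (θ + a) (framePoint θ (h θ) t)) = s := by
    intro θ t
    have hc : Continuous fun a => μ.real (sector θ (θ + a) (framePoint θ (h θ) t)) :=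
      continuous_sector_comp hμ continuous_const (by fun_prop) continuous_const
    refine intermediate_value_Ioo pi_pos.le hc.continuousOn ⟨?_, ?_⟩
    · rw [add_zero, sector_self, measureReal_empty]; exact hs0
    · rw [hhalf]; exact hs
  choose A hA hAs using key
  refine ⟨A, ?_, hA, hAs, fun θ t t' htt => ?_⟩
  · refine continuous_of_strictMonoOn_zero (X := ℝ × ℝ) (p := fun q => A q.1 q.2)
      (S := Ioo 0 π)
      (G := fun q a => μ.real (sector q.1 (q.1 + a) (framePoint q.1 (h q.1) q.2)) - s) isOpen_Ioo
      (fun a _ => ?_) (fun q => ?_) (fun q => hA q.1 q.2) (fun q => by simp [hAs])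
    · exact (continuous_sector_comp hμ continuous_fst (by fun_prop) (continuous_framePoint
        continuous_fst (hcont.comp continuous_fst) continuous_snd)).sub continuous_const
    · intro a ha b hb hab
      have := strictMonoOn_measureReal_sector hμ q.1 (framePoint q.1 (h q.1) q.2)
        (Ioo_subset_Icc_self ha) (Ioo_subset_Icc_self hb) hab
      dsimp only at this ⊢
      linarith
  · have h1 : μ.real (sector θ (θ + A θ t) (framePoint θ (h θ) t')) ≤ s := by
      rw [← hAs θ t]
      refine measureReal_mono fun x hx => ?_
      have hsin : 0 < sin (A θ t) := sin_pos_of_pos_of_lt_pi (hA θ t).1 (hA θ t).2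
      simp only [sector, mem_ofPred_eq, side_sub, side_framePoint_self, side_framePoint] at hx ⊢
      exact ⟨hx.1, by nlinarith [hx.2, mul_le_mul_of_nonneg_right htt hsin.le]⟩
    rw [← hAs θ t'] at h1
    exact ((strictMonoOn_measureReal_sector hμ θ (framePoint θ (h θ) t')).le_iff_le
      (Ioo_subset_Icc_self (hA _ _)) (Ioo_subset_Icc_self (hA _ _))).1 h1

/-- On every halving line there is a point, depending continuously and equivariantly on the
direction, at which a second line cuts off mass `s` in opposite sectors. -/
lemma exists_continuous_balanced [μ.IsOpenPosMeasure] (hμ : LineNull μ) {h : ℝ → ℝ}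
    (hcont : Continuous h) (hneg : ∀ θ, h (θ + π) = -h θ)
    (hhalf : ∀ θ t, μ.real (sector θ (θ + π) (framePoint θ (h θ) t)) = 1 / 2)
    {s : ℝ} (hs0 : 0 < s) (hs : s < 1 / 2) :
    ∃ p : ℝ → ℝ, Continuous p ∧ (∀ θ, p (θ + π) = -p θ) ∧ ∀ θ, ∃ α ∈ Ioo 0 π,
      μ.real (sector θ (θ + α) (framePoint θ (h θ) (p θ))) = s ∧
      μ.real (sector (θ + π) (θ + π + α) (framePoint θ (h θ) (p θ))) = s := by
  obtain ⟨α, hαc, hα, hαs, hαm⟩ := exists_continuous_angle hμ hcont hhalf hs0 hs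
  have hmem : ∀ θ a t x, x ∈ sector (θ + π) (θ + π + a) (framePoint θ (h θ) t) ↔
      side θ x < h θ ∧ h θ * cos a < side (θ + a) x + t * sin a := by
    intro θ a t x
    rw [show θ + π + a = θ + a + π by ring]
    simp only [sector, mem_ofPred_eq, side_add_pi, side_sub, side_framePoint, sin_pi, cos_pi]
    constructor <;> rintro ⟨u, v⟩ <;> constructor <;> linarith
  let G : ℝ → ℝ → ℝ := fun θ t =>
    μ.real (sector (θ + π) (θ + π + α θ t) (framePoint θ (h θ) t)) - s
  have hGc : Continuous fun q : ℝ × ℝ => G q.1 q.2 :=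
    (continuous_sector_comp hμ (by fun_prop) ((continuous_fst.add continuous_const).add hαc)
      (continuous_framePoint continuous_fst (hcont.comp continuous_fst) continuous_snd)).sub
      continuous_const
  have hmono : ∀ θ, StrictMono (G θ) := by
    intro θ t t' htt
    have hsin : 0 < sin (α θ t) := sin_pos_of_pos_of_lt_pi (hα _ _).1 (hα _ _).2
    have htt' := mul_lt_mul_of_pos_right htt hsin
    have h1 : μ.real (sector (θ + π) (θ + π + α θ t) (framePoint θ (h θ) t)) <
        μ.real (sector (θ + π) (θ + π + α θ t) (framePoint θ (h θ) t')) := by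
      refine measureReal_lt_of_isOpen (U := {x | side θ x < h θ ∧
        (side (θ + α θ t) x + t * sin (α θ t) < h θ * cos (α θ t) ∧
          h θ * cos (α θ t) < side (θ + α θ t) x + t' * sin (α θ t))})
        (fun x hx => ?_) (fun x hx => (hmem _ _ _ _).2 ⟨hx.1, hx.2.2⟩)
        (Set.disjoint_left.2 fun x hx hx' => ?_) ?_
        ⟨framePoint θ (h θ) ((t + t') / 2) + (-1 : ℝ) • dir (θ + α θ t), ?_, ?_, ?_⟩
      · rw [hmem] at hx ⊢; exact ⟨hx.1, by linarith [hx.2]⟩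
      · rw [hmem] at hx; linarith [hx.2, hx'.2.1]
      · have c1 := continuous_side_right θ
        have c2 := continuous_side_right (θ + α θ t)
        exact (isOpen_lt c1 continuous_const).inter
          ((isOpen_lt (c2.add continuous_const) continuous_const).inter
            (isOpen_lt continuous_const (c2.add continuous_const)))
      · rw [side_add, side_framePoint_self, side_smul, side_dir, add_sub_cancel_left]
        linarith
      · rw [side_add, side_framePoint, side_smul, side_dir, sub_self, sin_zero]
        linarith
      · rw [side_add, side_framePoint, side_smul, side_dir, sub_self, sin_zero]
        linarith
    have h2 : μ.real (sector (θ + π) (θ + π + α θ t) (framePoint θ (h θ) t')) ≤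
        μ.real (sector (θ + π) (θ + π + α θ t') (framePoint θ (h θ) t')) :=
      (strictMonoOn_measureReal_sector hμ (θ + π) _).monotoneOn
        (Ioo_subset_Icc_self (hα _ _)) (Ioo_subset_Icc_self (hα _ _)) (hαm θ htt.le)
    change _ - s < _ - s
    linarith
  have hzero : ∀ θ, ∃ t, G θ t = 0 := by
    intro θ
    have hsin : 0 < sin (α θ 0) := sin_pos_of_pos_of_lt_pi (hα _ _).1 (hα _ _).2
    have hle : ∀ {t t'}, t ≤ t' → ∀ t₀,
        μ.real (sector (θ + π) (θ + π + α θ t) (framePoint θ (h θ) t₀)) ≤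
        μ.real (sector (θ + π) (θ + π + α θ t') (framePoint θ (h θ) t₀)) := fun htt t₀ =>
      (strictMonoOn_measureReal_sector hμ (θ + π) _).monotoneOn
        (Ioo_subset_Icc_self (hα _ _)) (Ioo_subset_Icc_self (hα _ _)) (hαm θ htt)
    have hbot : Tendsto (fun t => μ.real (sector (θ + π) (θ + π + α θ 0) (framePoint θ (h θ) t)))
        atBot (𝓝 (μ.real ∅)) := by
      refine tendsto_measureReal MeasurableSet.empty
        (fun _ => (isOpen_sector _ _ _).measurableSet) (ae_of_all _ fun x => ?_)
      filter_upwards [(tendsto_id.atBot_mul_const hsin).eventually_le_atBot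
        (h θ * cos (α θ 0) - side (θ + α θ 0) x)] with t ht
      rw [hmem]
      simp only [id, mem_empty_iff_false, iff_false] at ht ⊢
      rintro ⟨-, hx⟩
      linarith
    have htop : Tendsto (fun t => μ.real (sector (θ + π) (θ + π + α θ 0) (framePoint θ (h θ) t)))
        atTop (𝓝 (μ.real {x | side θ x < h θ})) := by
      refine tendsto_measureReal
        (isOpen_lt (continuous_side_right θ) continuous_const).measurableSet
        (fun _ => (isOpen_sector _ _ _).measurableSet) (ae_of_all _ fun x => ?_)
      filter_upwards [(tendsto_id.atTop_mul_const hsin).eventually_gt_atTop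
        (h θ * cos (α θ 0) - side (θ + α θ 0) x)] with t ht
      rw [hmem]
      simp only [id] at ht
      exact ⟨fun hx => hx.1, fun hx => ⟨hx, by linarith⟩⟩
    have hright : μ.real {x | side θ x < h θ} = 1 / 2 := by
      have h1 := measureReal_halfPlane_add hμ θ (framePoint θ (h θ) 0)
      rw [hhalf, show θ + 2 * π = θ + π + π by ring] at h1
      have : {x | side θ x < h θ} = sector (θ + π) (θ + π + π) (framePoint θ (h θ) 0) := by
        ext x; simp [sector, side_add_pi, side_sub, side_framePoint_self]
      rw [this]; linarith
    rw [measureReal_empty] at hbot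
    rw [hright] at htop
    obtain ⟨t₁, ht₁, ht₁'⟩ := ((hbot.eventually_lt_const hs0).and (eventually_le_atBot 0)).exists
    obtain ⟨t₂, ht₂, ht₂'⟩ := ((htop.eventually_const_lt hs).and (eventually_ge_atTop 0)).exists
    have hc : Continuous (G θ) := Continuous.comp (f := fun t => (θ, t)) hGc (by fun_prop)
    refine mem_range_of_exists_le_of_exists_ge hc ⟨t₁, ?_⟩ ⟨t₂, ?_⟩
    · have := hle ht₁' t₁
      change _ - s ≤ 0
      linarith
    · have := hle ht₂' t₂
      change 0 ≤ _ - s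
      linarith
  choose p hp using hzero
  have hp' : ∀ θ, μ.real (sector (θ + π) (θ + π + α θ (p θ)) (framePoint θ (h θ) (p θ))) = s :=
    fun θ => sub_eq_zero.1 (hp θ)
  refine ⟨p, ?_, fun θ => ?_, fun θ => ⟨α θ (p θ), hα _ _, hαs _ _, hp' θ⟩⟩
  · exact continuous_of_strictMonoOn_zero (S := univ) (G := G) isOpen_univ
      (fun t _ => Continuous.comp (f := fun θ => (θ, t)) hGc (by fun_prop))
      (fun θ => (hmono θ).strictMonoOn _) (fun _ => mem_univ _) hp
  · refine (hmono (θ + π)).injective ?_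
    rw [hp]
    symm
    have hO : framePoint (θ + π) (h (θ + π)) (-p θ) = framePoint θ (h θ) (p θ) := by
      rw [hneg, framePoint_add_pi]
    have hα' : α (θ + π) (-p θ) = α θ (p θ) := by
      refine (strictMonoOn_measureReal_sector hμ (θ + π) (framePoint θ (h θ) (p θ))).injOn
        (Ioo_subset_Icc_self (hα _ _)) (Ioo_subset_Icc_self (hα _ _)) ?_
      rw [hp', ← hO, hαs]
    change μ.real _ - s = 0
    rw [hO, hα', show θ + π + π = θ + 2 * π by ring,
      show θ + 2 * π + α θ (p θ) = θ + α θ (p θ) + 2 * π by ring, sector_add_two_pi, hαs, sub_self]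

lemma exists_isSixPartition_of_isOpenPosMeasure [μ.IsOpenPosMeasure] (hμ : LineNull μ)
    {a b c : ℝ} (ha : 0 < a) (hb : 0 ≤ b) (hc : 0 < c) (habc : a + b + c = 1 / 2) :
    ∃ O θ₁ θ₂ θ₃, θ₁ ∈ Icc 0 π ∧ IsSixPartition μ O θ₁ θ₂ θ₃ a b c := by
  obtain ⟨h, hcont, hneg, hhalf⟩ := exists_continuous_halving hμ
  obtain ⟨p, hpc, hpneg, hp⟩ :=
    exists_continuous_balanced hμ hcont hneg hhalf (s := a) ha (by linarith)
  obtain ⟨q, hqc, hqneg, hq⟩ :=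
    exists_continuous_balanced hμ hcont hneg hhalf (s := a + b) (by linarith) (by linarith)
  obtain ⟨θ, hθ, hpq⟩ : ∃ θ ∈ Icc 0 π, p θ - q θ = 0 := by
    have hp0 := hpneg 0
    have hq0 := hqneg 0
    rw [zero_add] at hp0 hq0
    have hd : Continuous fun θ => p θ - q θ := hpc.sub hqc
    rcases le_total (p 0 - q 0) 0 with h0 | h0
    · exact intermediate_value_Icc pi_pos.le hd.continuousOn ⟨h0, by linarith⟩
    · exact intermediate_value_Icc' pi_pos.le hd.continuousOn ⟨by linarith, h0⟩
  obtain ⟨α, hα, hα1, hα2⟩ := hp θ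
  obtain ⟨β, hβ, hβ1, hβ2⟩ := hq θ
  rw [← sub_eq_zero.1 hpq] at hβ1 hβ2
  have hH := hhalf θ (p θ)
  have hH' := measureReal_halfPlane_add hμ θ (framePoint θ (h θ) (p θ))
  generalize framePoint θ (h θ) (p θ) = O at *
  have hαβ : α ≤ β := by
    refine ((strictMonoOn_measureReal_sector hμ θ O).le_iff_le (Ioo_subset_Icc_self hα)
      (Ioo_subset_Icc_self hβ)).1 ?_
    linarith
  have e1 : θ + α + π = θ + π + α := by ring
  have e2 : θ + β + π = θ + π + β := by ring
  have s1 := measureReal_sector_add hμ (θ := θ) (φ := θ + α) (ψ := θ + β) (by linarith [hα.1])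
    (by linarith) (by linarith [hβ.2]) O
  have s2 := measureReal_sector_add hμ (θ := θ) (φ := θ + β) (ψ := θ + π) (by linarith [hβ.1])
    (by linarith [hβ.2]) le_rfl O
  have s3 := measureReal_sector_add hμ (θ := θ + π) (φ := θ + π + α) (ψ := θ + π + β)
    (by linarith [hα.1]) (by linarith) (by linarith [hβ.2]) O
  have s4 := measureReal_sector_add hμ (θ := θ + π) (φ := θ + π + β) (ψ := θ + 2 * π)
    (by linarith [hβ.1]) (by linarith [hβ.2]) (by linarith) O
  refine ⟨O, θ, θ + α, θ + β, hθ,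
    ⟨by linarith [hα.1], by linarith, by linarith [hβ.2]⟩, hα1, ?_, ?_, ?_, ?_, ?_⟩
  · linarith
  · linarith
  · rw [e1]; exact hα2
  · rw [e1, e2]; linarith
  · rw [e2]; linarith

lemma exists_isSixPartition_half (hμ : LineNull μ) :
    ∃ O θ₁ θ₂ θ₃, IsSixPartition μ O θ₁ θ₂ θ₃ (1 / 2) 0 0 := by
  obtain ⟨k, hk⟩ := exists_halving hμ 0
  have h := measureReal_halfPlane_add hμ 0 (framePoint 0 k 0)
  rw [hk] at h
  simp only [zero_add] at hk h
  have e : π + π = 2 * π := by ring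
  refine ⟨framePoint 0 k 0, 0, π, π, ⟨pi_pos.le, le_rfl, by simp⟩, hk, ?_, ?_, ?_, ?_, ?_⟩
  · rw [sector_self, measureReal_empty]
  · rw [zero_add, sector_self, measureReal_empty]
  · rw [zero_add, e]; linarith
  · rw [sector_self, measureReal_empty]
  · rw [zero_add, e, sector_self, measureReal_empty]

lemma volume_side_eq (θ k : ℝ) : volume {x : ℝ × ℝ | side θ x = k} = 0 := by
  let f : ℝ × ℝ →ₗ[ℝ] ℝ :=
    { toFun := side θ, map_add' := side_add θ, map_smul' := side_smul θ }
  let s : AffineSubspace ℝ (ℝ × ℝ) := AffineSubspace.mk' (framePoint θ k 0) f.ker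
  have hs : (s : Set (ℝ × ℝ)) = {x | side θ x = k} := by
    ext x
    simp only [s, SetLike.mem_coe, AffineSubspace.mem_mk', LinearMap.mem_ker, vsub_eq_sub,
      mem_ofPred_eq]
    change side θ (x - framePoint θ k 0) = 0 ↔ _
    rw [side_sub, side_framePoint_self, sub_eq_zero]
  rw [← hs]
  refine Measure.addHaar_affineSubspace volume s fun htop => ?_
  have : framePoint θ (k + 1) 0 ∈ (s : Set (ℝ × ℝ)) := by rw [htop]; trivial
  rw [hs, mem_ofPred_eq, side_framePoint_self] at this
  linarith

/-- A line-null measure can be approximated by one which charges all open sets. -/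
lemma exists_isOpenPosMeasure_near (hμ : LineNull μ) {ε : ℝ} (hε : 0 < ε) (hε1 : ε ≤ 1) :
    ∃ ν : Measure (ℝ × ℝ), IsProbabilityMeasure ν ∧ ν.IsOpenPosMeasure ∧ LineNull ν ∧
      ∀ S, |ν.real S - μ.real S| ≤ ε := by
  let g := ProbabilityTheory.gaussianReal 0 1
  let γ : Measure (ℝ × ℝ) := g.prod g
  have hγ1 : γ ≪ volume :=
    (ProbabilityTheory.gaussianReal_absolutelyContinuous 0 one_ne_zero).prod
      (ProbabilityTheory.gaussianReal_absolutelyContinuous 0 one_ne_zero)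
  have hγ2 : volume ≪ γ :=
    (ProbabilityTheory.gaussianReal_absolutelyContinuous' 0 one_ne_zero).prod
      (ProbabilityTheory.gaussianReal_absolutelyContinuous' 0 one_ne_zero)
  have hreal : ∀ S, (ENNReal.ofReal (1 - ε) • μ + ENNReal.ofReal ε • γ).real S =
      (1 - ε) * μ.real S + ε * γ.real S := by
    intro S
    have h1 : (ENNReal.ofReal (1 - ε)).toReal = 1 - ε := ENNReal.toReal_ofReal (by linarith)
    have h2 : (ENNReal.ofReal ε).toReal = ε := ENNReal.toReal_ofReal hε.le
    rw [measureReal_def, Measure.add_apply, Measure.smul_apply, Measure.smul_apply, smul_eq_mul,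
      smul_eq_mul, ENNReal.toReal_add (by finiteness) (by finiteness), ENNReal.toReal_mul,
      ENNReal.toReal_mul, h1, h2]
    rfl
  refine ⟨ENNReal.ofReal (1 - ε) • μ + ENNReal.ofReal ε • γ, ⟨?_⟩, ⟨fun U hU hne h0 => ?_⟩,
    fun θ k => ?_, fun S => ?_⟩
  · simp only [Measure.coe_add, Measure.coe_smul, Pi.add_apply, Pi.smul_apply, measure_univ,
      smul_eq_mul, mul_one]
    rw [← ENNReal.ofReal_add (by linarith) hε.le, sub_add_cancel, ENNReal.ofReal_one]
  · simp only [Measure.coe_add, Measure.coe_smul, Pi.add_apply, Pi.smul_apply, smul_eq_mul,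
      add_eq_zero, mul_eq_zero, ENNReal.ofReal_eq_zero] at h0
    rcases h0.2 with h | h
    · linarith
    · exact hU.measure_ne_zero volume hne (hγ2 h)
  · simp [hμ θ k, hγ1 (volume_side_eq θ k)]
  · rw [hreal, show (1 - ε) * μ.real S + ε * γ.real S - μ.real S = ε * (γ.real S - μ.real S) by ring,
      abs_mul, abs_of_pos hε]
    have : |γ.real S - μ.real S| ≤ 1 :=
      abs_sub_le_of_nonneg_of_le measureReal_nonneg measureReal_le_one measureReal_nonneg
        measureReal_le_one
    nlinarith

lemma exists_closedBall_compl_lt {δ : ℝ} (hδ : 0 < δ) :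
    ∃ R, μ.real (Metric.closedBall (0 : ℝ × ℝ) R)ᶜ < δ := by
  have : Tendsto (fun R => μ.real (Metric.closedBall (0 : ℝ × ℝ) R)ᶜ) atTop (𝓝 (μ.real ∅)) := by
    refine tendsto_measureReal MeasurableSet.empty
      (fun _ => Metric.isClosed_closedBall.measurableSet.compl) (ae_of_all _ fun x => ?_)
    filter_upwards [eventually_ge_atTop ‖x‖] with R hR
    simpa using hR
  rw [measureReal_empty] at this
  exact (this.eventually_lt_const hδ).exists

lemma exists_nonempty_inter {S K : Set (ℝ × ℝ)} (h : μ.real Kᶜ < μ.real S) : ∃ x ∈ S, x ∈ K := by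
  by_contra! hne
  exact h.not_ge (measureReal_mono hne)

lemma exists_mem_side_eq_zero {K : Set (ℝ × ℝ)} (hK : Convex ℝ K) {φ : ℝ} {O x y : ℝ × ℝ}
    (hx : x ∈ K) (hy : y ∈ K) (hxs : side φ (x - O) < 0) (hys : 0 < side φ (y - O)) :
    ∃ z ∈ K, side φ (z - O) = 0 ∧ ∃ w₁ w₂, 0 < w₁ ∧ 0 < w₂ ∧
      ∀ ψ, side ψ (z - O) = w₁ * side ψ (x - O) + w₂ * side ψ (y - O) := by
  have hd : 0 < side φ (y - O) - side φ (x - O) := by linarith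
  set w₁ := side φ (y - O) / (side φ (y - O) - side φ (x - O)) with hw₁
  set w₂ := -side φ (x - O) / (side φ (y - O) - side φ (x - O)) with hw₂
  have h1 : 0 < w₁ := div_pos hys hd
  have h2 : 0 < w₂ := div_pos (by linarith) hd
  have hsum : w₁ + w₂ = 1 := by rw [hw₁, hw₂]; field_simp; ring
  have hside : ∀ ψ, side ψ (w₁ • x + w₂ • y - O) = w₁ * side ψ (x - O) + w₂ * side ψ (y - O) := by
    intro ψ
    simp only [side_sub, side_add, side_smul]
    linear_combination side ψ O * hsum
  refine ⟨w₁ • x + w₂ • y, hK hx hy h1.le h2.le hsum, ?_, w₁, w₂, h1, h2, hside⟩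
  rw [hside, hw₁, hw₂]
  field_simp
  ring

lemma apex_mem_of_convex {K : Set (ℝ × ℝ)} (hK : Convex ℝ K) {θ φ : ℝ} (h1 : θ < φ)
    (h2 : φ < θ + π) {O x y x' y' : ℝ × ℝ} (hx : x ∈ sector θ φ O) (hy : y ∈ sector φ (θ + π) O)
    (hx' : x' ∈ sector (θ + π) (φ + π) O) (hy' : y' ∈ sector (φ + π) (θ + 2 * π) O)
    (hxK : x ∈ K) (hyK : y ∈ K) (hxK' : x' ∈ K) (hyK' : y' ∈ K) : O ∈ K := by
  have e : θ + 2 * π = θ + π + π := by ring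
  simp only [e, sector, mem_ofPred_eq, side_add_pi, neg_neg, neg_neg_iff_pos, neg_pos]
    at hx hy hx' hy'
  obtain ⟨z, hzK, hz0, w₁, w₂, hw₁, hw₂, hz⟩ := exists_mem_side_eq_zero hK hxK hyK hx.2 hy.1
  obtain ⟨z', hzK', hz0', v₁, v₂, hv₁, hv₂, hz'⟩ :=
    exists_mem_side_eq_zero hK hyK' hxK' hy'.1 hx'.2
  have hzs : 0 < side θ (z - O) := by
    rw [hz]; exact add_pos (mul_pos hw₁ hx.1) (mul_pos hw₂ hy.2)
  have hzs' : side θ (z' - O) < 0 := by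
    rw [hz']; exact add_neg (mul_neg_of_pos_of_neg hv₁ hy'.2) (mul_neg_of_pos_of_neg hv₂ hx'.1)
  obtain ⟨o, hoK, ho0, u₁, u₂, -, -, ho⟩ := exists_mem_side_eq_zero hK hzK' hzK hzs' hzs
  have ho1 : side φ (o - O) = 0 := by rw [ho, hz0, hz0']; ring
  have hsin : sin (φ - θ) ≠ 0 :=
    (sin_pos_of_pos_of_lt_pi (by linarith) (by linarith)).ne'
  have hoO : o - O = 0 := by
    generalize o - O = v at ho0 ho1
    unfold side at ho0 ho1
    rw [sin_sub] at hsin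
    ext
    · refine (mul_eq_zero.1 ?_).resolve_left hsin
      linear_combination cos φ * ho0 - cos θ * ho1
    · refine (mul_eq_zero.1 ?_).resolve_left hsin
      linear_combination sin φ * ho0 - sin θ * ho1
  rwa [← sub_eq_zero.1 hoO]

lemma IsSixPartition.apex_mem {O : ℝ × ℝ} {θ₁ θ₂ θ₃ a b c : ℝ} (hμ : LineNull μ)
    (h : IsSixPartition μ O θ₁ θ₂ θ₃ a b c) {K : Set (ℝ × ℝ)} (hK : Convex ℝ K)
    (ha : μ.real Kᶜ < a) (hbc : μ.real Kᶜ < b + c) : O ∈ K := by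
  obtain ⟨⟨h1, h2, h3⟩, ha1, hb1, hc1, ha2, hb2, hc2⟩ := h
  have s1 := measureReal_sector_add hμ h2 h3 (by linarith) O
  have s2 := measureReal_sector_add hμ (θ := θ₂ + π) (φ := θ₃ + π) (ψ := θ₁ + 2 * π)
    (by linarith) (by linarith) (by linarith) O
  have hnn : 0 ≤ μ.real Kᶜ := measureReal_nonneg
  have hlt1 : θ₁ < θ₂ := by
    refine h1.lt_of_ne fun he => ?_
    rw [he, sector_self, measureReal_empty] at ha1
    linarith
  have hlt2 : θ₂ < θ₁ + π := by
    refine (h2.trans h3).lt_of_ne fun he => ?_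
    rw [← he, sector_self, measureReal_empty] at s1
    rw [← he] at hc1
    linarith
  obtain ⟨x, hx, hxK⟩ := exists_nonempty_inter (μ := μ) (K := K) (ha1 ▸ ha)
  obtain ⟨x', hx', hxK'⟩ := exists_nonempty_inter (μ := μ) (K := K) (ha2 ▸ ha)
  obtain ⟨y, hy, hyK⟩ := exists_nonempty_inter (μ := μ) (K := K)
    (show _ < μ.real (sector θ₂ (θ₁ + π) O) by linarith)
  obtain ⟨y', hy', hyK'⟩ := exists_nonempty_inter (μ := μ) (K := K)
    (show _ < μ.real (sector (θ₂ + π) (θ₁ + 2 * π) O) by linarith)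
  exact apex_mem_of_convex hK hlt1 hlt2 hx hy hx' hy' hxK hyK hxK' hyK'

lemma exists_isSixPartition_of_pos (hμ : LineNull μ) {a b c : ℝ} (ha : 0 < a) (hb : 0 ≤ b)
    (hc : 0 < c) (habc : a + b + c = 1 / 2) :
    ∃ O θ₁ θ₂ θ₃, IsSixPartition μ O θ₁ θ₂ θ₃ a b c := by
  obtain ⟨δ, hδ, hδa, hδc⟩ : ∃ δ, 0 < δ ∧ 2 * δ < a ∧ 2 * δ < c :=
    ⟨min a c / 3, by positivity, by linarith [min_le_left a c, lt_min ha hc],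
      by linarith [min_le_right a c, lt_min ha hc]⟩
  obtain ⟨R, hR⟩ := exists_closedBall_compl_lt (μ := μ) hδ
  set K := Metric.closedBall (0 : ℝ × ℝ) R
  let C : Set (ℝ × ℝ × ℝ × (ℝ × ℝ)) :=
    (Icc 0 (2 * π) ×ˢ Icc 0 (2 * π) ×ˢ Icc 0 (2 * π) ×ˢ K) ∩
      {q | q.1 ≤ q.2.1 ∧ q.2.1 ≤ q.2.2.1 ∧ q.2.2.1 ≤ q.1 + π}
  have hC : IsCompact C := by
    refine (isCompact_Icc.prod (isCompact_Icc.prod (isCompact_Icc.prod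
      (isCompact_closedBall 0 R)))).inter_right ?_
    exact (isClosed_le continuous_fst continuous_snd.fst).inter
      ((isClosed_le continuous_snd.fst continuous_snd.snd.fst).inter
        (isClosed_le continuous_snd.snd.fst (continuous_fst.add continuous_const)))
  let Φ : ℝ × ℝ × ℝ × (ℝ × ℝ) → ℝ := fun q =>
    |μ.real (sector q.1 q.2.1 q.2.2.2) - a| + |μ.real (sector q.2.1 q.2.2.1 q.2.2.2) - b| +
    |μ.real (sector q.2.2.1 (q.1 + π) q.2.2.2) - c| +
    |μ.real (sector (q.1 + π) (q.2.1 + π) q.2.2.2) - a| +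
    |μ.real (sector (q.2.1 + π) (q.2.2.1 + π) q.2.2.2) - b| +
    |μ.real (sector (q.2.2.1 + π) (q.1 + 2 * π) q.2.2.2) - c|
  have hcomp : ∀ {f g : ℝ × ℝ × ℝ × (ℝ × ℝ) → ℝ} (r : ℝ), Continuous f → Continuous g →
      Continuous fun q => |μ.real (sector (f q) (g q) q.2.2.2) - r| := fun r hf hg =>
    ((continuous_sector_comp hμ hf hg (by fun_prop)).sub continuous_const).abs
  have hΦ : Continuous Φ := by
    refine (((((hcomp a ?_ ?_).add (hcomp b ?_ ?_)).add (hcomp c ?_ ?_)).add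
      (hcomp a ?_ ?_)).add (hcomp b ?_ ?_)).add (hcomp c ?_ ?_) <;> fun_prop
  have happrox : ∀ ε, 0 < ε → ε ≤ 1 → ε < δ → ∃ q ∈ C, Φ q ≤ 6 * ε := by
    intro ε hε hε1 hεδ
    obtain ⟨ν, hν, hνo, hνl, hνμ⟩ := exists_isOpenPosMeasure_near hμ hε hε1
    obtain ⟨O, θ₁, θ₂, θ₃, hθ, hsix⟩ :=
      exists_isSixPartition_of_isOpenPosMeasure hνl ha hb hc habc
    have hνK : ν.real Kᶜ < 2 * δ := by linarith [(abs_le.1 (hνμ Kᶜ)).2]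
    have hO : O ∈ K := hsix.apex_mem hνl (convex_closedBall 0 R) (by linarith) (by linarith)
    obtain ⟨⟨h1, h2, h3⟩, e1, e2, e3, e4, e5, e6⟩ := hsix
    refine ⟨(θ₁, θ₂, θ₃, O), ⟨⟨⟨hθ.1, by linarith [hθ.2, pi_pos]⟩,
      ⟨by linarith [hθ.1], by linarith [hθ.2]⟩, ⟨by linarith [hθ.1], by linarith [hθ.2]⟩, hO⟩,
      h1, h2, h3⟩, ?_⟩
    have hS : ∀ S r, ν.real S = r → |μ.real S - r| ≤ ε := by
      rintro S r rfl
      rw [abs_sub_comm]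
      exact hνμ S
    dsimp only [Φ]
    linarith [hS _ _ e1, hS _ _ e2, hS _ _ e3, hS _ _ e4, hS _ _ e5, hS _ _ e6]
  obtain ⟨q₀, hq₀, -⟩ := happrox (min 1 (δ / 2)) (by positivity) (min_le_left _ _)
    ((min_le_right _ _).trans_lt (by linarith))
  obtain ⟨⟨θ₁, θ₂, θ₃, O⟩, hq, hmin⟩ := hC.exists_isMinOn ⟨q₀, hq₀⟩ hΦ.continuousOn
  have hle : Φ (θ₁, θ₂, θ₃, O) ≤ 0 := by
    by_contra! hpos
    set m := Φ (θ₁, θ₂, θ₃, O)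
    obtain ⟨q', hq', hle⟩ := happrox (min (min 1 (δ / 2)) (m / 12)) (by positivity)
      ((min_le_left _ _).trans (min_le_left _ _))
      (((min_le_left _ _).trans (min_le_right _ _)).trans_lt (by linarith))
    have h1 : m ≤ Φ q' := hmin hq'
    linarith [min_le_right (min 1 (δ / 2)) (m / 12)]
  dsimp only [Φ] at hle
  have n1 := abs_nonneg (μ.real (sector θ₁ θ₂ O) - a)
  have n2 := abs_nonneg (μ.real (sector θ₂ θ₃ O) - b)
  have n3 := abs_nonneg (μ.real (sector θ₃ (θ₁ + π) O) - c)
  have n4 := abs_nonneg (μ.real (sector (θ₁ + π) (θ₂ + π) O) - a)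
  have n5 := abs_nonneg (μ.real (sector (θ₂ + π) (θ₃ + π) O) - b)
  have n6 := abs_nonneg (μ.real (sector (θ₃ + π) (θ₁ + 2 * π) O) - c)
  refine ⟨O, θ₁, θ₂, θ₃, hq.2, ?_, ?_, ?_, ?_, ?_, ?_⟩ <;>
    exact sub_eq_zero.1 (abs_nonpos_iff.1 (by linarith))

lemma exists_isSixPartition (hμ : LineNull μ) {a b c : ℝ} (ha : 0 ≤ a) (hb : 0 ≤ b) (hc : 0 ≤ c)
    (habc : a + b + c = 1 / 2) : ∃ O θ₁ θ₂ θ₃, IsSixPartition μ O θ₁ θ₂ θ₃ a b c := by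
  rcases ha.eq_or_lt with rfl | ha' <;> rcases hb.eq_or_lt with rfl | hb' <;>
    rcases hc.eq_or_lt with rfl | hc'
  · norm_num at habc
  · obtain ⟨O, θ₁, θ₂, θ₃, h⟩ := exists_isSixPartition_half hμ
    obtain rfl : c = 1 / 2 := by linarith
    exact ⟨_, _, _, _, h.rotate⟩
  · obtain ⟨O, θ₁, θ₂, θ₃, h⟩ := exists_isSixPartition_half hμ
    obtain rfl : b = 1 / 2 := by linarith
    exact ⟨_, _, _, _, h.rotate.rotate⟩
  · obtain ⟨O, θ₁, θ₂, θ₃, h⟩ := exists_isSixPartition_of_pos hμ hc' le_rfl hb' (by linarith)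
    exact ⟨_, _, _, _, h.rotate⟩
  · obtain ⟨O, θ₁, θ₂, θ₃, h⟩ := exists_isSixPartition_half hμ
    obtain rfl : a = 1 / 2 := by linarith
    exact ⟨_, _, _, _, h⟩
  · exact exists_isSixPartition_of_pos hμ ha' le_rfl hc' habc
  · obtain ⟨O, θ₁, θ₂, θ₃, h⟩ := exists_isSixPartition_of_pos hμ hb' le_rfl ha' (by linarith)
    exact ⟨_, _, _, _, h.rotate.rotate⟩
  · exact exists_isSixPartition_of_pos hμ ha' hb hc' habc

end Measure

lemma isAffineLine_side_eq (θ k : ℝ) : IsAffineLine {x | side θ x = k} := by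
  have e := sin_sq_add_cos_sq θ
  refine ⟨framePoint θ k 0, dir θ, fun h => ?_, ?_⟩
  · simp only [dir, Prod.mk_eq_zero] at h
    rw [h.1, h.2] at e
    norm_num at e
  · ext x
    constructor
    · rintro rfl
      refine ⟨cos θ * x.1 + sin θ * x.2, ?_⟩
      ext
      · simp [framePoint, dir, side, cos_add_pi_div_two]
        linear_combination -x.1 * e
      · simp [framePoint, dir, side, sin_add_pi_div_two]
        linear_combination -x.2 * e
    · rintro ⟨t, rfl⟩
      rw [mem_ofPred_eq, side_add, side_framePoint_self, side_smul, side_dir]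
      simp

end MassPartition

/-- Generalized Buck–Buck: for any mass and any `a, b, c ≥ 0` with `a + b + c = 1/2`,
three concurrent lines split the plane into six wedges of measures `a, b, c, a, b, c`. -/
theorem buck_buck_generalized (μ : Measure (ℝ × ℝ)) (hμ : IsMass μ) (a b c : ℝ)
    (ha : 0 ≤ a) (hb : 0 ≤ b) (hc : 0 ≤ c) (habc : a + b + c = 1 / 2) :
    ∃ (O : ℝ × ℝ) (θ₁ θ₂ θ₃ : ℝ), θ₁ ≤ θ₂ ∧ θ₂ ≤ θ₃ ∧ θ₃ ≤ θ₁ + Real.pi ∧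
      μ (Wedge O θ₁ θ₂) = ENNReal.ofReal a ∧
      μ (Wedge O θ₂ θ₃) = ENNReal.ofReal b ∧
      μ (Wedge O θ₃ (θ₁ + Real.pi)) = ENNReal.ofReal c ∧
      μ (Wedge O (θ₁ + Real.pi) (θ₂ + Real.pi)) = ENNReal.ofReal a ∧
      μ (Wedge O (θ₂ + Real.pi) (θ₃ + Real.pi)) = ENNReal.ofReal b ∧
      μ (Wedge O (θ₃ + Real.pi) (θ₁ + 2 * Real.pi)) = ENNReal.ofReal c := by
  obtain ⟨hprob, hline⟩ := hμ
  have hnull : MassPartition.LineNull μ := fun θ k =>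
    hline _ (MassPartition.isAffineLine_side_eq θ k)
  obtain ⟨O, θ₁, θ₂, θ₃, ⟨h1, h2, h3⟩, e1, e2, e3, e4, e5, e6⟩ :=
    MassPartition.exists_isSixPartition hnull ha hb hc habc
  refine ⟨O, θ₁, θ₂, θ₃, h1, h2, h3, ?_, ?_, ?_, ?_, ?_, ?_⟩
  · rw [MassPartition.measure_wedge hnull h1 (by linarith), e1]
  · rw [MassPartition.measure_wedge hnull h2 (by linarith), e2]
  · rw [MassPartition.measure_wedge hnull h3 (by linarith), e3]
  · rw [MassPartition.measure_wedge hnull (by linarith) (by linarith), e4]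
  · rw [MassPartition.measure_wedge hnull (by linarith) (by linarith), e5]
  · rw [MassPartition.measure_wedge hnull (by linarith) (by linarith), e6]
end
end

section
/- Every mass μ on ℝ² admits a non-spiral (8,3)-equicovering: there exist eight closed convex subsets P_1, …, P_8 of ℝ², each of μ-measure 3/8, and a finite collection of affine lines with union N, such that every point x ∈ ℝ² \ N belongs to exactly 3 of the sets P_1, …, P_8, and moreover there is no point O ∈ ℝ² and no angles θ_1 ≤ θ_2 ≤ ⋯ ≤ θ_8 ≤ θ_1 + 2π (extended by θ_{j+8} = θ_j + 2π) such that {P_1, …, P_8} = {W(O, θ_i, θ_{i+3}) : i = 1, …, 8}. -/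
open MeasureTheory

noncomputable section

open Set Filter Topology

/-- The closed upper half-plane above height `t`. -/
def upperHalf (t : ℝ) : Set (ℝ × ℝ) := {p | t ≤ p.2}

/-- The closed lower half-plane below height `t`. -/
def lowerHalf (t : ℝ) : Set (ℝ × ℝ) := {p | p.2 ≤ t}

/-- The closed half-plane to the right of the line `x = s + c (y - t)`. -/
def rightOf (t s c : ℝ) : Set (ℝ × ℝ) := {p | s + c * (p.2 - t) ≤ p.1}

/-- The closed half-plane to the left of the line `x = s + c (y - t)`. -/
def leftOf (t s c : ℝ) : Set (ℝ × ℝ) := {p | p.1 ≤ s + c * (p.2 - t)}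

/-- The horizontal line at height `t`. -/
def horizontalLine (t : ℝ) : Set (ℝ × ℝ) := {p | p.2 = t}

/-- The line `x = s + c (y - t)`. -/
def slantLine (t s c : ℝ) : Set (ℝ × ℝ) := {p | p.1 = s + c * (p.2 - t)}

lemma isAffineLine_horizontalLine (t : ℝ) : IsAffineLine (horizontalLine t) := by
  refine ⟨(0, t), (1, 0), by simp, ?_⟩
  ext ⟨x, y⟩
  simp [horizontalLine, Prod.ext_iff]

lemma isAffineLine_slantLine (t s c : ℝ) : IsAffineLine (slantLine t s c) := by
  refine ⟨(s, t), (c, 1), by simp, ?_⟩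
  ext ⟨x, y⟩
  simp only [slantLine, mem_ofPred_eq, Prod.ext_iff, Prod.fst_add, Prod.snd_add, Prod.smul_fst,
    Prod.smul_snd, smul_eq_mul, mul_one]
  constructor
  · intro h
    exact ⟨y - t, by linarith, by ring⟩
  · rintro ⟨r, h, h'⟩
    rw [h, h']
    ring

lemma isClosed_upperHalf (t : ℝ) : IsClosed (upperHalf t) :=
  isClosed_le (by fun_prop) (by fun_prop)

lemma isClosed_lowerHalf (t : ℝ) : IsClosed (lowerHalf t) :=
  isClosed_le (by fun_prop) (by fun_prop)

lemma isClosed_rightOf (t s c : ℝ) : IsClosed (rightOf t s c) :=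
  isClosed_le (by fun_prop) (by fun_prop)

lemma isClosed_leftOf (t s c : ℝ) : IsClosed (leftOf t s c) :=
  isClosed_le (by fun_prop) (by fun_prop)

lemma convex_upperHalf (t : ℝ) : Convex ℝ (upperHalf t) :=
  convex_halfSpace_ge (f := fun p : ℝ × ℝ => p.2) ⟨fun _ _ => rfl, fun _ _ => rfl⟩ t

lemma convex_lowerHalf (t : ℝ) : Convex ℝ (lowerHalf t) :=
  convex_halfSpace_le (f := fun p : ℝ × ℝ => p.2) ⟨fun _ _ => rfl, fun _ _ => rfl⟩ t

lemma isLinearMap_sub_mul (c : ℝ) : IsLinearMap ℝ fun p : ℝ × ℝ => p.1 - c * p.2 :=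
  ⟨fun p q => by simp only [Prod.fst_add, Prod.snd_add]; ring,
    fun a p => by simp only [Prod.smul_fst, Prod.smul_snd, smul_eq_mul]; ring⟩

lemma convex_rightOf (t s c : ℝ) : Convex ℝ (rightOf t s c) := by
  have h : rightOf t s c = {p | s - c * t ≤ p.1 - c * p.2} := by
    ext p
    simp only [rightOf, mem_ofPred_eq]
    constructor <;> intro h <;> linarith
  exact h ▸ convex_halfSpace_ge (isLinearMap_sub_mul c) (s - c * t)

lemma convex_leftOf (t s c : ℝ) : Convex ℝ (leftOf t s c) := by
  have h : leftOf t s c = {p | p.1 - c * p.2 ≤ s - c * t} := by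
    ext p
    simp only [leftOf, mem_ofPred_eq]
    constructor <;> intro h <;> linarith
  exact h ▸ convex_halfSpace_le (isLinearMap_sub_mul c) (s - c * t)

section Mass

variable {μ : Measure (ℝ × ℝ)}

lemma IsMass.ae_snd_ne (hμ : IsMass μ) (t : ℝ) : ∀ᵐ p ∂μ, p.2 ≠ t :=
  measure_eq_zero_iff_ae_notMem.1 (hμ.2 _ (isAffineLine_horizontalLine t))

lemma IsMass.ae_fst_ne (hμ : IsMass μ) (t s c : ℝ) : ∀ᵐ p ∂μ, p.1 ≠ s + c * (p.2 - t) :=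
  measure_eq_zero_iff_ae_notMem.1 (hμ.2 _ (isAffineLine_slantLine t s c))

lemma tendsto_measureReal_inter [IsFiniteMeasure μ] {ι : Type*} {l : Filter ι}
    [l.IsCountablyGenerated] {A B : Set (ℝ × ℝ)} {S : ι → Set (ℝ × ℝ)} (hA : MeasurableSet A)
    (hB : MeasurableSet B) (hS : ∀ i, MeasurableSet (S i))
    (h : ∀ᵐ p ∂μ, p ∈ A → ∀ᶠ i in l, p ∈ S i ↔ p ∈ B) :
    Tendsto (fun i => μ.real (A ∩ S i)) l (𝓝 (μ.real (A ∩ B))) := by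
  refine (ENNReal.tendsto_toReal (measure_ne_top μ _)).comp
    (tendsto_measure_of_ae_tendsto_indicator_of_isFiniteMeasure l (hA.inter hB)
      (fun i => hA.inter (hS i)) ?_)
  filter_upwards [h] with p hp
  by_cases hpA : p ∈ A
  · simpa [hpA] using hp hpA
  · simp [hpA]

lemma continuous_measureReal_inter_rightOf (hμ : IsMass μ) {A : Set (ℝ × ℝ)}
    (hA : MeasurableSet A) (t : ℝ) :
    Continuous fun z : ℝ × ℝ => μ.real (A ∩ rightOf t z.1 z.2) := by
  have := hμ.1
  refine continuous_iff_continuousAt.2 fun z => tendsto_measureReal_inter hA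
    (isClosed_rightOf t z.1 z.2).measurableSet
    (fun w => (isClosed_rightOf t w.1 w.2).measurableSet) ?_
  filter_upwards [hμ.ae_fst_ne t z.1 z.2] with p hp _
  have hc : Continuous fun w : ℝ × ℝ => w.1 + w.2 * (p.2 - t) := by fun_prop
  rcases lt_or_gt_of_ne hp with h | h
  · filter_upwards [hc.continuousAt.eventually (lt_mem_nhds h)] with w hw
    simp only [rightOf, mem_ofPred_eq]
    exact ⟨fun h' => absurd hw (not_lt.2 h'), fun h' => absurd h (not_lt.2 h')⟩
  · filter_upwards [hc.continuousAt.eventually (gt_mem_nhds h)] with w hw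
    simp only [rightOf, mem_ofPred_eq]
    exact ⟨fun _ => h.le, fun _ => hw.le⟩

lemma antitone_measureReal_inter_rightOf [IsFiniteMeasure μ] (A : Set (ℝ × ℝ)) (t c : ℝ) :
    Antitone fun s => μ.real (A ∩ rightOf t s c) := fun s s' h =>
  measureReal_mono (inter_subset_inter_right A fun p hp => by
    simp only [rightOf, mem_ofPred_eq] at hp ⊢
    linarith)

lemma antitone_measureReal_upperHalf_inter_rightOf [IsFiniteMeasure μ] (t s : ℝ) :
    Antitone fun c => μ.real (upperHalf t ∩ rightOf t s c) := fun c c' h =>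
  measureReal_mono fun p hp => by
    simp only [upperHalf, rightOf, mem_inter_iff, mem_ofPred_eq] at hp ⊢
    exact ⟨hp.1, by nlinarith⟩

lemma monotone_measureReal_lowerHalf_inter_rightOf [IsFiniteMeasure μ] (t s : ℝ) :
    Monotone fun c => μ.real (lowerHalf t ∩ rightOf t s c) := fun c c' h =>
  measureReal_mono fun p hp => by
    simp only [lowerHalf, rightOf, mem_inter_iff, mem_ofPred_eq] at hp ⊢
    exact ⟨hp.1, by nlinarith⟩

lemma tendsto_measureReal_inter_rightOf_zero [IsFiniteMeasure μ] {ι : Type*} {l : Filter ι}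
    [l.IsCountablyGenerated] {A : Set (ℝ × ℝ)} (hA : MeasurableSet A) {t : ℝ} {f g : ι → ℝ}
    (h : ∀ᵐ p ∂μ, p ∈ A → Tendsto (fun i => f i + g i * (p.2 - t)) l atTop) :
    Tendsto (fun i => μ.real (A ∩ rightOf t (f i) (g i))) l (𝓝 0) := by
  have := tendsto_measureReal_inter (μ := μ) (l := l) (B := ∅) hA .empty
    (fun i => (isClosed_rightOf t (f i) (g i)).measurableSet) ?_
  · simpa using this
  filter_upwards [h] with p hp hpA
  filter_upwards [(hp hpA).eventually_gt_atTop p.1] with i hi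
  simpa [rightOf] using hi

lemma tendsto_measureReal_inter_rightOf_self [IsFiniteMeasure μ] {ι : Type*} {l : Filter ι}
    [l.IsCountablyGenerated] {A : Set (ℝ × ℝ)} (hA : MeasurableSet A) {t : ℝ} {f g : ι → ℝ}
    (h : ∀ᵐ p ∂μ, p ∈ A → Tendsto (fun i => f i + g i * (p.2 - t)) l atBot) :
    Tendsto (fun i => μ.real (A ∩ rightOf t (f i) (g i))) l (𝓝 (μ.real A)) := by
  have := tendsto_measureReal_inter (μ := μ) (l := l) (B := univ) hA .univ
    (fun i => (isClosed_rightOf t (f i) (g i)).measurableSet) ?_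
  · simpa using this
  filter_upwards [h] with p hp hpA
  filter_upwards [(hp hpA).eventually_le_atBot p.1] with i hi
  simpa [rightOf] using hi

lemma tendsto_apex_atTop [IsFiniteMeasure μ] {A : Set (ℝ × ℝ)} (hA : MeasurableSet A) (t c : ℝ) :
    Tendsto (fun s => μ.real (A ∩ rightOf t s c)) atTop (𝓝 0) :=
  tendsto_measureReal_inter_rightOf_zero hA <| .of_forall fun _ _ =>
    tendsto_atTop_add_const_right _ _ tendsto_id

lemma tendsto_apex_atBot [IsFiniteMeasure μ] {A : Set (ℝ × ℝ)} (hA : MeasurableSet A) (t c : ℝ) :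
    Tendsto (fun s => μ.real (A ∩ rightOf t s c)) atBot (𝓝 (μ.real A)) :=
  tendsto_measureReal_inter_rightOf_self hA <| .of_forall fun _ _ =>
    tendsto_atBot_add_const_right _ _ tendsto_id

lemma IsMass.tendsto_upperHalf_atTop (hμ : IsMass μ) (t s : ℝ) :
    Tendsto (fun c => μ.real (upperHalf t ∩ rightOf t s c)) atTop (𝓝 0) := by
  have := hμ.1
  refine tendsto_measureReal_inter_rightOf_zero (isClosed_upperHalf t).measurableSet ?_
  filter_upwards [hμ.ae_snd_ne t] with p hp hpA
  exact tendsto_atTop_add_const_left _ _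
    (tendsto_id.atTop_mul_const (sub_pos.2 (lt_of_le_of_ne hpA hp.symm)))

lemma IsMass.tendsto_upperHalf_atBot (hμ : IsMass μ) (t s : ℝ) :
    Tendsto (fun c => μ.real (upperHalf t ∩ rightOf t s c)) atBot (𝓝 (μ.real (upperHalf t))) := by
  have := hμ.1
  refine tendsto_measureReal_inter_rightOf_self (isClosed_upperHalf t).measurableSet ?_
  filter_upwards [hμ.ae_snd_ne t] with p hp hpA
  exact tendsto_atBot_add_const_left _ _
    (tendsto_id.atBot_mul_const (sub_pos.2 (lt_of_le_of_ne hpA hp.symm)))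

lemma IsMass.tendsto_lowerHalf_atTop (hμ : IsMass μ) (t s : ℝ) :
    Tendsto (fun c => μ.real (lowerHalf t ∩ rightOf t s c)) atTop (𝓝 (μ.real (lowerHalf t))) := by
  have := hμ.1
  refine tendsto_measureReal_inter_rightOf_self (isClosed_lowerHalf t).measurableSet ?_
  filter_upwards [hμ.ae_snd_ne t] with p hp hpA
  exact tendsto_atBot_add_const_left _ _
    (tendsto_id.atTop_mul_const_of_neg (sub_neg.2 (lt_of_le_of_ne hpA hp)))

lemma IsMass.tendsto_lowerHalf_atBot (hμ : IsMass μ) (t s : ℝ) :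
    Tendsto (fun c => μ.real (lowerHalf t ∩ rightOf t s c)) atBot (𝓝 0) := by
  have := hμ.1
  refine tendsto_measureReal_inter_rightOf_zero (isClosed_lowerHalf t).measurableSet ?_
  filter_upwards [hμ.ae_snd_ne t] with p hp hpA
  exact tendsto_atTop_add_const_left _ _
    (tendsto_id.atBot_mul_const_of_neg (sub_neg.2 (lt_of_le_of_ne hpA hp)))

lemma measureReal_union_of_inter_subset (hμ : IsMass μ) {S T : Set (ℝ × ℝ)}
    (hT : MeasurableSet T) {L : Set (ℝ × ℝ)} (hL : IsAffineLine L) (h : S ∩ T ⊆ L) :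
    μ.real (S ∪ T) = μ.real S + μ.real T := by
  have := hμ.1
  exact measureReal_union₀ hT.nullMeasurableSet (measure_mono_null h (hμ.2 L hL))

lemma measureReal_inter_leftOf (hμ : IsMass μ) {A : Set (ℝ × ℝ)} (hA : MeasurableSet A)
    (t s c : ℝ) : μ.real (A ∩ leftOf t s c) = μ.real A - μ.real (A ∩ rightOf t s c) := by
  rw [eq_sub_iff_add_eq, ← measureReal_union_of_inter_subset hμ
    (hA.inter (isClosed_rightOf t s c).measurableSet) (isAffineLine_slantLine t s c)
    fun p hp => le_antisymm hp.1.2 hp.2.2, ← inter_union_distrib_left]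
  congr 1
  exact inter_eq_left.2 fun p _ => le_total p.1 _

lemma measureReal_eq_upperHalf_add_lowerHalf (hμ : IsMass μ) {S : Set (ℝ × ℝ)}
    (hS : MeasurableSet S) (t : ℝ) :
    μ.real S = μ.real (upperHalf t ∩ S) + μ.real (lowerHalf t ∩ S) := by
  rw [← measureReal_union_of_inter_subset hμ ((isClosed_lowerHalf t).measurableSet.inter hS)
    (isAffineLine_horizontalLine t) fun p hp => le_antisymm hp.2.1 hp.1.1,
    ← union_inter_distrib_right]
  congr 1
  exact (inter_eq_right.2 fun p _ => le_total t p.2).symm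

lemma measureReal_rightOf_inter_rightOf (hμ : IsMass μ) (t s : ℝ) {c d : ℝ} (h : d ≤ c) :
    μ.real (rightOf t s c ∩ rightOf t s d) =
      μ.real (upperHalf t ∩ rightOf t s c) + μ.real (lowerHalf t ∩ rightOf t s d) := by
  rw [measureReal_eq_upperHalf_add_lowerHalf hμ ((isClosed_rightOf t s c).measurableSet.inter
    (isClosed_rightOf t s d).measurableSet) t]
  congr 2 <;> ext p <;>
    simp only [upperHalf, lowerHalf, rightOf, mem_inter_iff, mem_ofPred_eq] <;>
    constructor <;> rintro ⟨h₁, h₂⟩ <;>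
    first
    | exact ⟨h₁, h₂.1⟩
    | exact ⟨h₁, h₂.2⟩
    | exact ⟨h₁, by nlinarith, by nlinarith⟩

lemma measureReal_leftOf_inter_leftOf (hμ : IsMass μ) (t s : ℝ) {c d : ℝ} (h : c ≤ d) :
    μ.real (leftOf t s c ∩ leftOf t s d) =
      μ.real (upperHalf t ∩ leftOf t s c) + μ.real (lowerHalf t ∩ leftOf t s d) := by
  rw [measureReal_eq_upperHalf_add_lowerHalf hμ ((isClosed_leftOf t s c).measurableSet.inter
    (isClosed_leftOf t s d).measurableSet) t]
  congr 2 <;> ext p <;>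
    simp only [upperHalf, lowerHalf, leftOf, mem_inter_iff, mem_ofPred_eq] <;>
    constructor <;> rintro ⟨h₁, h₂⟩ <;>
    first
    | exact ⟨h₁, h₂.1⟩
    | exact ⟨h₁, h₂.2⟩
    | exact ⟨h₁, by nlinarith, by nlinarith⟩

lemma IsMass.exists_halving_height (hμ : IsMass μ) :
    ∃ t, μ.real (upperHalf t) = 1 / 2 ∧ μ.real (lowerHalf t) = 1 / 2 := by
  have := hμ.1
  have hsum (t : ℝ) : μ.real (upperHalf t) + μ.real (lowerHalf t) = 1 := by
    simpa using (measureReal_eq_upperHalf_add_lowerHalf hμ MeasurableSet.univ t).symm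
  have hcont : Continuous fun t => μ.real (upperHalf t) := by
    refine continuous_iff_continuousAt.2 fun t => ?_
    have := tendsto_measureReal_inter (μ := μ) (l := 𝓝 t) (S := upperHalf) .univ
      (isClosed_upperHalf t).measurableSet (fun s => (isClosed_upperHalf s).measurableSet) ?_
    · simpa [ContinuousAt] using this
    filter_upwards [hμ.ae_snd_ne t] with p hp _
    rcases lt_or_gt_of_ne hp with h | h
    · filter_upwards [lt_mem_nhds h] with s hs
      simp [upperHalf, h.not_ge, hs.not_ge]
    · filter_upwards [gt_mem_nhds h] with s hs
      simp [upperHalf, h.le, hs.le]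
  have htop : Tendsto (fun t => μ.real (upperHalf t)) atTop (𝓝 0) := by
    have := tendsto_measureReal_inter (μ := μ) (l := atTop) (S := upperHalf) (B := ∅) .univ
      .empty (fun s => (isClosed_upperHalf s).measurableSet) <| .of_forall fun p _ => by
        filter_upwards [eventually_gt_atTop p.2] with s hs
        simpa [upperHalf] using hs
    simpa using this
  have hbot : Tendsto (fun t => μ.real (upperHalf t)) atBot (𝓝 1) := by
    have := tendsto_measureReal_inter (μ := μ) (l := atBot) (S := upperHalf) (B := univ) .univ
      .univ (fun s => (isClosed_upperHalf s).measurableSet) <| .of_forall fun p _ => by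
        filter_upwards [eventually_le_atBot p.2] with s hs
        simpa [upperHalf] using hs
    simpa using this
  obtain ⟨t, ht⟩ := mem_range_of_exists_le_of_exists_ge hcont
    (htop.eventually (ge_mem_nhds (show (0 : ℝ) < 1 / 2 by norm_num))).exists
    (hbot.eventually (le_mem_nhds (show (1 / 2 : ℝ) < 1 by norm_num))).exists
  exact ⟨t, ht, by linarith [hsum t]⟩

end Mass

/-- Two functions of an apex and a slope, both decreasing in the apex and moving oppositely in the
slope, attain any pair of intermediate values simultaneously. -/
lemma exists_eq_and_eq_of_antitone {F G : ℝ → ℝ → ℝ} {p q : ℝ}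
    (hF : Continuous fun z : ℝ × ℝ => F z.1 z.2) (hG : Continuous fun z : ℝ × ℝ => G z.1 z.2)
    (hFs : ∀ c, Antitone fun s => F s c) (hGs : ∀ c, Antitone fun s => G s c)
    (hFc : ∀ s, Antitone (F s)) (hlt : ∀ c, ∃ s, F s c < p) (hgt : ∀ c, ∃ s, p < F s c)
    (hneg : ∃ c ≤ 0, p ≤ F 0 c ∧ G 0 c ≤ q) (hpos : ∃ c ≥ 0, F 0 c ≤ p ∧ q ≤ G 0 c) :
    ∃ s c, F s c = p ∧ G s c = q := by
  have hsec (c : ℝ) : Continuous fun s => F s c :=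
    hF.comp (Continuous.prodMk continuous_id continuous_const)
  have hsecG (c : ℝ) : Continuous fun s => G s c :=
    hG.comp (Continuous.prodMk continuous_id continuous_const)
  obtain ⟨c₁, hc₁, hF₁, hG₁⟩ := hneg
  obtain ⟨c₂, hc₂, hF₂, hG₂⟩ := hpos
  obtain ⟨b, hb⟩ := hlt c₁
  obtain ⟨a, ha⟩ := hgt c₂
  have hbound {s c : ℝ} (hc : c ∈ Icc c₁ c₂) (h : F s c = p) : s ∈ Icc a b := by
    constructor
    · by_contra! hs
      linarith [hFs c hs.le, hFc a hc.2]
    · by_contra! hs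
      linarith [hFs c hs.le, hFc b hc.1]
  have hlevel : IsCompact ((Icc a b ×ˢ Icc c₁ c₂) ∩ {z : ℝ × ℝ | F z.1 z.2 = p}) :=
    (isCompact_Icc.prod isCompact_Icc).inter_right (isClosed_eq hF continuous_const)
  have hU := ((hlevel.inter_right (isClosed_le continuous_const hG :
    IsClosed {z : ℝ × ℝ | q ≤ G z.1 z.2})).image continuous_snd).isClosed
  have hL := ((hlevel.inter_right (isClosed_le hG continuous_const :
    IsClosed {z : ℝ × ℝ | G z.1 z.2 ≤ q})).image continuous_snd).isClosed
  have hlevel_mem {c : ℝ} (hc : c ∈ Icc c₁ c₂) : ∃ s, F s c = p ∧ s ∈ Icc a b := by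
    obtain ⟨s, hs⟩ : p ∈ range fun s => F s c := mem_range_of_exists_le_of_exists_ge (hsec c)
      ((hlt c).imp fun _ => le_of_lt) ((hgt c).imp fun _ => le_of_lt)
    exact ⟨s, hs, hbound hc hs⟩
  have hc₁₂ : c₁ ≤ c₂ := hc₁.trans hc₂
  obtain ⟨c, -, ⟨⟨s, _⟩, ⟨⟨-, hs⟩, hsq⟩, rfl⟩, ⟨⟨r, d⟩, ⟨⟨-, hr⟩, hrq⟩, hd⟩⟩ :=
    isPreconnected_closed_iff.1 isPreconnected_Icc _ _ hU hL
      (fun c hc => by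
        obtain ⟨s, hs, hsab⟩ := hlevel_mem hc
        rcases le_total q (G s c) with h | h
        · exact Or.inl ⟨(s, c), ⟨⟨⟨hsab, hc⟩, hs⟩, h⟩, rfl⟩
        · exact Or.inr ⟨(s, c), ⟨⟨⟨hsab, hc⟩, hs⟩, h⟩, rfl⟩)
      ⟨c₂, right_mem_Icc.2 hc₁₂, by
        have ha0 : a ≤ 0 := by
          by_contra! h
          linarith [hFs c₂ h.le]
        obtain ⟨s, hs, hsp⟩ := intermediate_value_Icc' ha0 (hsec c₂).continuousOn ⟨hF₂, ha.le⟩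
        have hc := right_mem_Icc.2 hc₁₂
        exact ⟨(s, c₂), ⟨⟨⟨hbound hc hsp, hc⟩, hsp⟩, hG₂.trans (hGs c₂ hs.2)⟩, rfl⟩⟩
      ⟨c₁, left_mem_Icc.2 hc₁₂, by
        have hb0 : 0 ≤ b := by
          by_contra! h
          linarith [hFs c₁ h.le]
        obtain ⟨s, hs, hsp⟩ := intermediate_value_Icc' hb0 (hsec c₁).continuousOn ⟨hb.le, hF₁⟩
        have hc := left_mem_Icc.2 hc₁₂
        exact ⟨(s, c₁), ⟨⟨⟨hbound hc hsp, hc⟩, hsp⟩, (hGs c₁ hs.1).trans hG₁⟩, rfl⟩⟩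
  dsimp only at hd
  subst hd
  simp only [mem_ofPred_eq] at hs hr hsq hrq
  obtain ⟨u, hu, huq⟩ := intermediate_value_uIcc (hsecG d).continuousOn
    (mem_uIcc.2 (Or.inr ⟨hrq, hsq⟩) : q ∈ uIcc (G s d) (G r d))
  refine ⟨u, d, ?_, huq⟩
  rcases mem_uIcc.1 hu with h | h
  · exact le_antisymm (hs ▸ hFs d h.1) (hr ▸ hFs d h.2)
  · exact le_antisymm (hr ▸ hFs d h.1) (hs ▸ hFs d h.2)

/-- A ham-sandwich theorem with prescribed ratios for the two parts of a mass on either side of a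
horizontal line. -/
lemma IsMass.exists_slant {μ : Measure (ℝ × ℝ)} (hμ : IsMass μ) {t p q : ℝ} (hp : 0 < p)
    (hpU : p < μ.real (upperHalf t)) (hq : 0 < q) (hqL : q < μ.real (lowerHalf t)) :
    ∃ s c, μ.real (upperHalf t ∩ rightOf t s c) = p ∧ μ.real (lowerHalf t ∩ rightOf t s c) = q := by
  have := hμ.1
  have hU := (isClosed_upperHalf t).measurableSet
  have hL := (isClosed_lowerHalf t).measurableSet
  refine exists_eq_and_eq_of_antitone (continuous_measureReal_inter_rightOf hμ hU t)
    (continuous_measureReal_inter_rightOf hμ hL t) (antitone_measureReal_inter_rightOf _ t)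
    (antitone_measureReal_inter_rightOf _ t) (antitone_measureReal_upperHalf_inter_rightOf t)
    (fun c => ((tendsto_apex_atTop hU t c).eventually (gt_mem_nhds hp)).exists)
    (fun c => ((tendsto_apex_atBot hU t c).eventually (lt_mem_nhds hpU)).exists) ?_ ?_
  · exact ((eventually_le_atBot 0).and (((hμ.tendsto_upperHalf_atBot t 0).eventually
      (le_mem_nhds hpU)).and ((hμ.tendsto_lowerHalf_atBot t 0).eventually (ge_mem_nhds hq)))).exists
  · exact ((eventually_ge_atTop 0).and (((hμ.tendsto_upperHalf_atTop t 0).eventually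
      (ge_mem_nhds hp)).and ((hμ.tendsto_lowerHalf_atTop t 0).eventually (le_mem_nhds hqL)))).exists

lemma exists_le_eq_of_tendsto_atBot {f : ℝ → ℝ} (hf : Continuous f) {a b v : ℝ}
    (h : Tendsto f atBot (𝓝 a)) (hv : a < v ∧ v ≤ f b ∨ v < a ∧ f b ≤ v) :
    ∃ c ≤ b, f c = v := by
  rcases hv with ⟨hav, hvb⟩ | ⟨hva, hbv⟩
  · obtain ⟨d, hd, hdb⟩ := ((h.eventually (ge_mem_nhds hav)).and (eventually_le_atBot b)).exists
    exact (intermediate_value_Icc hdb hf.continuousOn ⟨hd, hvb⟩).imp fun c hc => ⟨hc.1.2, hc.2⟩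
  · obtain ⟨d, hd, hdb⟩ := ((h.eventually (le_mem_nhds hva)).and (eventually_le_atBot b)).exists
    exact (intermediate_value_Icc' hdb hf.continuousOn ⟨hbv, hd⟩).imp fun c hc => ⟨hc.1.2, hc.2⟩

lemma exists_ge_eq_of_tendsto_atTop {f : ℝ → ℝ} (hf : Continuous f) {a b v : ℝ}
    (h : Tendsto f atTop (𝓝 a)) (hv : a < v ∧ v ≤ f b ∨ v < a ∧ f b ≤ v) :
    ∃ c ≥ b, f c = v := by
  obtain ⟨c, hc, hcv⟩ := exists_le_eq_of_tendsto_atBot (hf.comp continuous_neg) (b := -b)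
    (h.comp tendsto_neg_atBot_atTop) (by simpa using hv)
  exact ⟨-c, le_neg.1 hc, hcv⟩

/-- Two lines crossing the line at height `t` at different points, the first halving the upper
half-plane and the second halving the lower one, both with controlled mass on the other side. -/
lemma IsMass.exists_two_slants {μ : Measure (ℝ × ℝ)} (hμ : IsMass μ) {t : ℝ}
    (hU : μ.real (upperHalf t) = 1 / 2) (hL : μ.real (lowerHalf t) = 1 / 2) :
    ∃ s c s' c', s ≠ s' ∧ μ.real (upperHalf t ∩ rightOf t s c) = 1 / 4 ∧
      μ.real (lowerHalf t ∩ rightOf t s c) ∈ Icc (1 / 8) (3 / 8) ∧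
      μ.real (lowerHalf t ∩ rightOf t s' c') = 1 / 4 ∧
      μ.real (upperHalf t ∩ rightOf t s' c') ∈ Icc (1 / 8) (3 / 8) := by
  have := hμ.1
  have hslant (p q : ℝ) (hp : 0 < p ∧ p < 1 / 2) (hq : 0 < q ∧ q < 1 / 2) :=
    hμ.exists_slant (t := t) hp.1 (hU ▸ hp.2) hq.1 (hL ▸ hq.2)
  obtain ⟨s₁, c₁, hU₁, hL₁⟩ := hslant (1 / 4) (1 / 8) (by norm_num) (by norm_num)
  obtain ⟨s₂, c₂, hU₂, hL₂⟩ := hslant (1 / 4) (3 / 8) (by norm_num) (by norm_num)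
  obtain ⟨s₃, c₃, hU₃, hL₃⟩ := hslant (1 / 8) (1 / 4) (by norm_num) (by norm_num)
  by_cases h₁ : s₁ = s₃
  · by_cases h₂ : s₂ = s₃
    · subst h₁ h₂
      have hmono := monotone_measureReal_lowerHalf_inter_rightOf (μ := μ) t s₂
      have h : c₃ < c₂ := hmono.reflect_lt (by simp only [hL₂, hL₃]; norm_num)
      have := antitone_measureReal_upperHalf_inter_rightOf (μ := μ) t s₂ h.le
      simp only [hU₂, hU₃] at this
      norm_num at this
    · exact ⟨s₂, c₂, s₃, c₃, h₂, hU₂, by rw [hL₂]; norm_num, hL₃, by rw [hU₃]; norm_num⟩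
  · exact ⟨s₁, c₁, s₃, c₃, h₁, hU₁, by rw [hL₁]; norm_num, hL₃, by rw [hU₃]; norm_num⟩

lemma apex_mem_wedge (O : ℝ × ℝ) (α β : ℝ) : O ∈ Wedge O α β := Or.inl rfl

/-- The eight sets: each line through the apex `s` or `s'` is bent at height `t`. -/
def bentCover (t s c₂ c₅ c₇ s' c₁ c₃ c₆ : ℝ) : Fin 8 → Set (ℝ × ℝ) :=
  ![upperHalf t ∩ rightOf t s' c₃, upperHalf t ∩ leftOf t s' c₁,
    lowerHalf t ∩ leftOf t s c₇, lowerHalf t ∩ rightOf t s c₅,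
    rightOf t s c₂ ∩ rightOf t s c₇, leftOf t s c₂ ∩ leftOf t s c₅,
    rightOf t s' c₁ ∩ rightOf t s' c₆, leftOf t s' c₃ ∩ leftOf t s' c₆]

/-- The horizontal line and the six slanted lines bounding the sets of `bentCover`. -/
def bentCoverLines (t s c₂ c₅ c₇ s' c₁ c₃ c₆ : ℝ) : Fin 7 → Set (ℝ × ℝ) :=
  ![horizontalLine t, slantLine t s c₂, slantLine t s c₅, slantLine t s c₇,
    slantLine t s' c₁, slantLine t s' c₃, slantLine t s' c₆]

lemma ncard_mem_bentCover {t s c₂ c₅ c₇ s' c₁ c₃ c₆ : ℝ} (h₇ : c₇ ≤ c₂) (h₅ : c₂ ≤ c₅)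
    (h₃ : c₃ ≤ c₆) (h₁ : c₆ ≤ c₁) {x : ℝ × ℝ}
    (hx : x ∉ ⋃ k, bentCoverLines t s c₂ c₅ c₇ s' c₁ c₃ c₆ k) :
    {i : Fin 8 | x ∈ bentCover t s c₂ c₅ c₇ s' c₁ c₃ c₆ i}.ncard = 3 := by
  classical
  simp only [mem_iUnion, not_exists] at hx
  have hx0 : x.2 ≠ t := hx 0
  have hx2 : x.1 ≠ s + c₂ * (x.2 - t) := hx 1
  have hx5 : x.1 ≠ s + c₅ * (x.2 - t) := hx 2
  have hx7 : x.1 ≠ s + c₇ * (x.2 - t) := hx 3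
  have hx1 : x.1 ≠ s' + c₁ * (x.2 - t) := hx 4
  have hx3 : x.1 ≠ s' + c₃ * (x.2 - t) := hx 5
  have hx6 : x.1 ≠ s' + c₆ * (x.2 - t) := hx 6
  clear hx
  rw [Set.ncard_eq_toFinset_card', Set.toFinset_ofPred, Finset.card_filter, Fin.sum_univ_eight]
  simp only [bentCover, upperHalf, lowerHalf, rightOf, leftOf, Matrix.cons_val, mem_inter_iff,
    mem_ofPred_eq]
  rcases lt_or_gt_of_ne hx0 with h | h
  · have h7 := mul_le_mul_of_nonpos_right h₇ (sub_neg.2 h).le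
    have h5 := mul_le_mul_of_nonpos_right h₅ (sub_neg.2 h).le
    have h3 := mul_le_mul_of_nonpos_right h₃ (sub_neg.2 h).le
    have h1 := mul_le_mul_of_nonpos_right h₁ (sub_neg.2 h).le
    generalize c₂ * (x.2 - t) = a₂, c₅ * (x.2 - t) = a₅, c₇ * (x.2 - t) = a₇,
      c₁ * (x.2 - t) = a₁, c₃ * (x.2 - t) = a₃, c₆ * (x.2 - t) = a₆ at *
    have e7 (h : s + a₇ ≤ x.1) : s + a₂ ≤ x.1 := by linarith
    have e5 (h : x.1 ≤ s + a₅) : x.1 ≤ s + a₂ := by linarith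
    have e1 (h : s' + a₆ ≤ x.1) : s' + a₁ ≤ x.1 := by linarith
    have e3 (h : x.1 ≤ s' + a₆) : x.1 ≤ s' + a₃ := by linarith
    simp only [and_iff_right_of_imp e7, and_iff_right_of_imp e5, and_iff_right_of_imp e1,
      and_iff_right_of_imp e3]
    rcases lt_or_gt_of_ne hx7 with k7 | k7 <;> rcases lt_or_gt_of_ne hx5 with k5 | k5 <;>
      rcases lt_or_gt_of_ne hx6 with k6 | k6 <;>
      simp [h.le, h.not_ge, k7.le, k7.not_ge, k5.le, k5.not_ge, k6.le, k6.not_ge]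
  · have h7 := mul_le_mul_of_nonneg_right h₇ (sub_pos.2 h).le
    have h5 := mul_le_mul_of_nonneg_right h₅ (sub_pos.2 h).le
    have h3 := mul_le_mul_of_nonneg_right h₃ (sub_pos.2 h).le
    have h1 := mul_le_mul_of_nonneg_right h₁ (sub_pos.2 h).le
    generalize c₂ * (x.2 - t) = a₂, c₅ * (x.2 - t) = a₅, c₇ * (x.2 - t) = a₇,
      c₁ * (x.2 - t) = a₁, c₃ * (x.2 - t) = a₃, c₆ * (x.2 - t) = a₆ at *
    have e7 (h : s + a₂ ≤ x.1) : s + a₇ ≤ x.1 := by linarith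
    have e5 (h : x.1 ≤ s + a₂) : x.1 ≤ s + a₅ := by linarith
    have e1 (h : s' + a₁ ≤ x.1) : s' + a₆ ≤ x.1 := by linarith
    have e3 (h : x.1 ≤ s' + a₃) : x.1 ≤ s' + a₆ := by linarith
    simp only [and_iff_left_of_imp e7, and_iff_left_of_imp e5, and_iff_left_of_imp e1,
      and_iff_left_of_imp e3]
    rcases lt_or_gt_of_ne hx2 with k2 | k2 <;> rcases lt_or_gt_of_ne hx1 with k1 | k1 <;>
      rcases lt_or_gt_of_ne hx3 with k3 | k3 <;>
      simp [h.le, h.not_ge, k2.le, k2.not_ge, k1.le, k1.not_ge, k3.le, k3.not_ge]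

/-- Every mass admits a non-spiral `(8,3)`-equicovering. -/
theorem exists_nonspiral_eight_three_equicovering (μ : Measure (ℝ × ℝ)) (hμ : IsMass μ) :
    ∃ P : Fin 8 → Set (ℝ × ℝ),
      (∀ i, IsClosed (P i) ∧ Convex ℝ (P i) ∧ μ (P i) = ENNReal.ofReal (3 / 8)) ∧
      (∃ (n : ℕ) (L : Fin n → Set (ℝ × ℝ)), (∀ k, IsAffineLine (L k)) ∧
        ∀ x : ℝ × ℝ, x ∉ ⋃ k, L k → {i : Fin 8 | x ∈ P i}.ncard = 3) ∧
      ¬ ∃ (O : ℝ × ℝ) (θ : ℤ → ℝ),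
          (∀ j : ℤ, θ (j + 8) = θ j + 2 * Real.pi) ∧
          (∀ j : ℤ, θ j ≤ θ (j + 1)) ∧
          Set.range P = {S : Set (ℝ × ℝ) | ∃ i : ℤ, S = Wedge O (θ i) (θ (i + 3))} := by
  have := hμ.1
  obtain ⟨t, hU, hL⟩ := hμ.exists_halving_height
  obtain ⟨s, c₂, s', c₆, hss, hU₂, hL₂, hL₆, hU₆⟩ := hμ.exists_two_slants hU hL
  have hmU := (isClosed_upperHalf t).measurableSet
  have hmL := (isClosed_lowerHalf t).measurableSet
  have hcU (s : ℝ) : Continuous fun c => μ.real (upperHalf t ∩ rightOf t s c) :=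
    (continuous_measureReal_inter_rightOf hμ hmU t).comp (Continuous.prodMk_right s)
  have hcL (s : ℝ) : Continuous fun c => μ.real (lowerHalf t ∩ rightOf t s c) :=
    (continuous_measureReal_inter_rightOf hμ hmL t).comp (Continuous.prodMk_right s)
  obtain ⟨c₇, h₇, hL₇⟩ := exists_le_eq_of_tendsto_atBot (v := 1 / 8) (hcL s)
    (hμ.tendsto_lowerHalf_atBot t s) (Or.inl ⟨by norm_num, hL₂.1⟩)
  obtain ⟨c₅, h₅, hL₅⟩ := exists_ge_eq_of_tendsto_atTop (v := 3 / 8) (hcL s)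
    (hμ.tendsto_lowerHalf_atTop t s) (Or.inr ⟨by rw [hL]; norm_num, hL₂.2⟩)
  obtain ⟨c₃, h₃, hU₃⟩ := exists_le_eq_of_tendsto_atBot (v := 3 / 8) (hcU s')
    (hμ.tendsto_upperHalf_atBot t s') (Or.inr ⟨by rw [hU]; norm_num, hU₆.2⟩)
  obtain ⟨c₁, h₁, hU₁⟩ := exists_ge_eq_of_tendsto_atTop (v := 1 / 8) (hcU s')
    (hμ.tendsto_upperHalf_atTop t s') (Or.inl ⟨by norm_num, hU₆.1⟩)
  refine ⟨bentCover t s c₂ c₅ c₇ s' c₁ c₃ c₆, fun i => ⟨?_, ?_, ?_⟩,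
    ⟨7, bentCoverLines t s c₂ c₅ c₇ s' c₁ c₃ c₆, fun k => ?_,
      fun x hx => ncard_mem_bentCover h₇ h₅ h₃ h₁ hx⟩, ?_⟩
  · fin_cases i <;> refine IsClosed.inter ?_ ?_ <;>
      first
      | exact isClosed_upperHalf _
      | exact isClosed_lowerHalf _
      | exact isClosed_rightOf _ _ _
      | exact isClosed_leftOf _ _ _
  · fin_cases i <;> refine Convex.inter ?_ ?_ <;>
      first
      | exact convex_upperHalf _
      | exact convex_lowerHalf _
      | exact convex_rightOf _ _ _
      | exact convex_leftOf _ _ _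
  · rw [← ofReal_measureReal]
    congr 1
    fin_cases i
    · exact hU₃
    · exact (measureReal_inter_leftOf hμ hmU t s' c₁).trans (by rw [hU, hU₁]; norm_num)
    · exact (measureReal_inter_leftOf hμ hmL t s c₇).trans (by rw [hL, hL₇]; norm_num)
    · exact hL₅
    · exact (measureReal_rightOf_inter_rightOf hμ t s h₇).trans (by rw [hU₂, hL₇]; norm_num)
    · exact (measureReal_leftOf_inter_leftOf hμ t s h₅).trans (by
        rw [measureReal_inter_leftOf hμ hmU, measureReal_inter_leftOf hμ hmL, hU, hL, hU₂, hL₅]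
        norm_num)
    · exact (measureReal_rightOf_inter_rightOf hμ t s' h₁).trans (by rw [hU₁, hL₆]; norm_num)
    · exact (measureReal_leftOf_inter_leftOf hμ t s' h₃).trans (by
        rw [measureReal_inter_leftOf hμ hmU, measureReal_inter_leftOf hμ hmL, hU, hL, hU₃, hL₆]
        norm_num)
  · fin_cases k <;>
      first
      | exact isAffineLine_horizontalLine _
      | exact isAffineLine_slantLine _ _ _
  · rintro ⟨O, θ, -, -, h⟩
    have hO (i : Fin 8) : O ∈ bentCover t s c₂ c₅ c₇ s' c₁ c₃ c₆ i := by
      obtain ⟨j, hj⟩ := h.subset (mem_range_self i)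
      rw [hj]
      exact apex_mem_wedge _ _ _
    have h0 : t ≤ O.2 ∧ s' + c₃ * (O.2 - t) ≤ O.1 := hO 0
    have h1 : t ≤ O.2 ∧ O.1 ≤ s' + c₁ * (O.2 - t) := hO 1
    have h2 : O.2 ≤ t ∧ O.1 ≤ s + c₇ * (O.2 - t) := hO 2
    have h3 : O.2 ≤ t ∧ s + c₅ * (O.2 - t) ≤ O.1 := hO 3
    have hOt : O.2 - t = 0 := by linarith
    simp only [hOt, mul_zero, add_zero] at h0 h1 h2 h3
    exact hss (by linarith)
end
end

section
/- Let μ be a mass on ℝ² and let ℓ be an affine line whose two closed half-planes H⁺ and H⁻ satisfy μ(H⁺) = μ(H⁻) = 1/2. Then there exist a point O ∈ ℓ, four convex wedges P_1, P_2, P_3, P_4 with apex O (i.e., each P_j = W(O, α_j, β_j) with β_j − α_j ≤ π), each of μ-measure 3/8, and a finite collection of affine lines with union N, such that every point of the open half-plane bounded by ℓ on the H⁺ side that is not in N belongs to exactly 2 of the sets P_1, …, P_4, and every point of the open half-plane bounded by ℓ on the H⁻ side that is not in N belongs to exactly 1 of them. -/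
open MeasureTheory

noncomputable section

section

open Set Filter Topology

/-- The signed distance functional with unit normal `(-sin θ, cos θ)`. -/
def normalForm (θ : ℝ) (x : ℝ × ℝ) : ℝ := -Real.sin θ * x.1 + Real.cos θ * x.2

lemma measurable_normalForm (θ : ℝ) : Measurable (normalForm θ) := by
  unfold normalForm; fun_prop

lemma abs_normalForm_le (θ : ℝ) (x : ℝ × ℝ) : |normalForm θ x| ≤ |x.1| + |x.2| := by
  unfold normalForm
  refine (abs_add_le _ _).trans (add_le_add ?_ ?_) <;> rw [abs_mul]
  · rw [abs_neg]
    exact mul_le_of_le_one_left (abs_nonneg _) (Real.abs_sin_le_one θ)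
  · exact mul_le_of_le_one_left (abs_nonneg _) (Real.abs_cos_le_one θ)

lemma continuous_measureReal_normalForm_le (ν : Measure (ℝ × ℝ)) [IsFiniteMeasure ν]
    (hν : ∀ θ s, ν {x | normalForm θ x = s} = 0) :
    Continuous fun p : ℝ × ℝ => ν.real {x | normalForm p.1 x ≤ p.2} := by
  rw [continuous_iff_continuousAt]
  intro p
  have hae : ∀ᵐ x ∂ν, normalForm p.1 x ≠ p.2 := by
    rw [ae_iff]; simpa using hν p.1 p.2
  have hlim : ∀ᵐ x ∂ν, ∀ᶠ q : ℝ × ℝ in 𝓝 p,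
      (normalForm q.1 x ≤ q.2 ↔ normalForm p.1 x ≤ p.2) := by
    filter_upwards [hae] with x hx
    have hc : Continuous fun q : ℝ × ℝ => normalForm q.1 x := by
      unfold normalForm; fun_prop
    rcases lt_or_gt_of_ne hx with h | h
    · have h' := hc.continuousAt.eventually_lt continuous_snd.continuousAt h
      exact h'.mono fun q hq => iff_of_true (le_of_lt hq) h.le
    · have h' := continuous_snd.continuousAt.eventually_lt hc.continuousAt h
      exact h'.mono fun q hq => iff_of_false (not_le_of_gt hq) h.not_ge
  have hm : ∀ q : ℝ × ℝ, MeasurableSet {x | normalForm q.1 x ≤ q.2} := fun q =>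
    measurableSet_le (measurable_normalForm _) measurable_const
  have h := tendsto_measure_of_ae_tendsto_indicator_of_isFiniteMeasure (μ := ν) (𝓝 p)
    (A := {x | normalForm p.1 x ≤ p.2}) (As := fun q : ℝ × ℝ => {x | normalForm q.1 x ≤ q.2})
    (hm p) hm hlim
  exact (ENNReal.tendsto_toReal (measure_ne_top ν _)).comp h

/-- Two families of continuous monotone functions whose crossing order is reversed between the
ends of an interval of parameters attain the value `v` simultaneously. -/
lemma exists_common_value {F G : ℝ × ℝ → ℝ} (hF : Continuous F) (hG : Continuous G)
    (mF : ∀ θ, Monotone fun s => F (θ, s)) (mG : ∀ θ, Monotone fun s => G (θ, s))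
    {v R a b : ℝ} (hR : -R ≤ R) (hab : a ≤ b)
    (hF0 : ∀ θ, F (θ, -R) ≤ v) (hF1 : ∀ θ, v ≤ F (θ, R))
    (ha : ∃ s ∈ Icc (-R) R, F (a, s) ≤ v ∧ v ≤ G (a, s))
    (hb : ∃ s ∈ Icc (-R) R, v ≤ F (b, s) ∧ G (b, s) ≤ v) :
    ∃ θ ∈ Icc a b, ∃ s, F (θ, s) = v ∧ G (θ, s) = v := by
  have closed : ∀ {P : ℝ × ℝ → Prop}, IsClosed {p | P p} →
      IsClosed {θ | ∃ s ∈ Icc (-R) R, P (θ, s)} := by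
    intro P hP
    have h := isClosedMap_fst_of_compactSpace (X := ℝ) (Y := Icc (-R) R) _
      (hP.preimage (by fun_prop : Continuous fun q : ℝ × Icc (-R) R => (q.1, (q.2 : ℝ))))
    convert h using 1
    ext θ
    simp
  obtain ⟨θ, hθ, ⟨s₁, -, h₁⟩, ⟨s₂, -, h₂⟩⟩ :=
    isPreconnected_closed_iff.1 (isPreconnected_Icc (a := a) (b := b)) _ _
      (closed ((isClosed_le hF continuous_const).inter (isClosed_le continuous_const hG)))
      (closed ((isClosed_le continuous_const hF).inter (isClosed_le hG continuous_const)))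
      (by
        intro θ _
        obtain ⟨s, hs, hsv⟩ := intermediate_value_Icc hR
          (hF.comp (by fun_prop : Continuous fun s : ℝ => (θ, s))).continuousOn
          ⟨hF0 θ, hF1 θ⟩
        simp only [Function.comp] at hsv
        rcases le_total v (G (θ, s)) with h | h
        · exact Or.inl ⟨s, hs, hsv.le, h⟩
        · exact Or.inr ⟨s, hs, hsv.ge, h⟩)
      ⟨a, left_mem_Icc.2 hab, ha⟩ ⟨b, right_mem_Icc.2 hab, hb⟩
  refine ⟨θ, hθ, ?_⟩
  have cF : Continuous fun s => F (θ, s) := by fun_prop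
  have cG : Continuous fun s => G (θ, s) := by fun_prop
  rcases le_total s₁ s₂ with h | h
  · obtain ⟨s, hs, hsv⟩ := intermediate_value_Icc h cF.continuousOn ⟨h₁.1, h₂.1⟩
    exact ⟨s, hsv, le_antisymm ((mG θ hs.2).trans h₂.2) (h₁.2.trans (mG θ hs.1))⟩
  · obtain ⟨s, hs, hsv⟩ := intermediate_value_Icc h cG.continuousOn ⟨h₂.2, h₁.2⟩
    exact ⟨s, le_antisymm ((mF θ hs.2).trans h₁.1) (h₂.1.trans (mF θ hs.1)), hsv⟩

lemma eventually_measureReal_tail_le (ν : Measure (ℝ × ℝ)) [IsFiniteMeasure ν] {ε : ℝ}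
    (hε : 0 < ε) : ∀ᶠ R : ℝ in atTop, ν.real {x | R ≤ |x.1| + |x.2|} ≤ ε := by
  have h := tendsto_measure_iInter_atTop (μ := ν) (s := fun R : ℝ => {x : ℝ × ℝ | R ≤ |x.1| + |x.2|})
    (fun R => (measurableSet_le measurable_const (by fun_prop)).nullMeasurableSet)
    (fun R R' h x hx => le_trans h hx) ⟨0, measure_ne_top _ _⟩
  have he : (⋂ R : ℝ, {x : ℝ × ℝ | R ≤ |x.1| + |x.2|}) = ∅ := by
    ext x
    simp only [mem_iInter, mem_ofPred_eq, mem_empty_iff_false, iff_false, not_forall, not_le]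
    exact exists_gt _
  rw [he, measure_empty] at h
  have h' := (ENNReal.tendsto_toReal ENNReal.zero_ne_top).comp h
  exact h'.eventually (Iic_mem_nhds (by simpa using hε))

lemma measureReal_normalForm_ge (ν : Measure (ℝ × ℝ)) [IsFiniteMeasure ν]
    (hν : ∀ θ s, ν {x | normalForm θ x = s} = 0) (θ s : ℝ) :
    ν.real {x | s ≤ normalForm θ x} = ν.real univ - ν.real {x | normalForm θ x ≤ s} := by
  rw [← measureReal_compl (measurableSet_le (measurable_normalForm _) measurable_const)]
  refine measureReal_congr ?_
  have hae : ∀ᵐ x ∂ν, normalForm θ x ≠ s := by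
    rw [ae_iff]; simpa using hν θ s
  filter_upwards [hae] with x hx
  refine propext ?_
  change s ≤ normalForm θ x ↔ ¬ (normalForm θ x ≤ s)
  rw [not_le]
  exact ⟨fun h => lt_of_le_of_ne h hx.symm, le_of_lt⟩

lemma normalForm_add_pi (θ : ℝ) (x : ℝ × ℝ) : normalForm (θ + Real.pi) x = -normalForm θ x := by
  simp [normalForm]; ring

/-- A line bisecting both of two measures that are separated by a line. -/
lemma exists_bisector_of_separated (ν₁ ν₂ : Measure (ℝ × ℝ)) [IsFiniteMeasure ν₁]
    [IsFiniteMeasure ν₂] (hν₁ : ∀ θ s, ν₁ {x | normalForm θ x = s} = 0)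
    (hν₂ : ∀ θ s, ν₂ {x | normalForm θ x = s} = 0) {v : ℝ} (hv : 0 < v)
    (m₁ : ν₁.real univ = 2 * v) (m₂ : ν₂.real univ = 2 * v) {δ c : ℝ}
    (h₁ : ν₁.real {x | normalForm δ x ≤ c} = 0)
    (h₂ : ν₂.real {x | normalForm δ x ≤ c} = 2 * v) :
    ∃ φ ∈ Icc 0 Real.pi, ∃ s, ν₁.real {x | normalForm (δ + φ) x ≤ s} = v ∧
      ν₂.real {x | normalForm (δ + φ) x ≤ s} = v := by
  obtain ⟨R, hR, hRc⟩ :=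
    ((eventually_measureReal_tail_le ν₁ hv).and (eventually_ge_atTop |c|)).exists
  have hRc' := abs_le.1 hRc
  have hlow : ∀ θ, ν₁.real {x | normalForm θ x ≤ -R} ≤ v := fun θ =>
    (measureReal_mono fun x (hx : normalForm θ x ≤ -R) => show R ≤ _ by
      linarith [neg_abs_le (normalForm θ x), abs_normalForm_le θ x]).trans hR
  have hupp : ∀ θ, v ≤ ν₁.real {x | normalForm θ x ≤ R} := fun θ => by
    have h := (measureReal_mono (μ := ν₁) fun x (hx : R ≤ normalForm θ x) =>
      show R ≤ |x.1| + |x.2| by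
        linarith [le_abs_self (normalForm θ x), abs_normalForm_le θ x]).trans hR
    have h' := measureReal_normalForm_ge ν₁ hν₁ θ R
    change ν₁.real {x | R ≤ normalForm θ x} ≤ v at h
    linarith
  have mono : ∀ (ν : Measure (ℝ × ℝ)) [IsFiniteMeasure ν] (θ : ℝ),
      Monotone fun s => ν.real {x | normalForm θ x ≤ s} := fun ν _ θ s t hst =>
    measureReal_mono fun x hx => le_trans hx hst
  have hneg : ∀ ν : Measure (ℝ × ℝ), ν.real {x | normalForm (δ + Real.pi) x ≤ -c} =
      ν.real {x | c ≤ normalForm δ x} := fun ν => by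
    simp only [normalForm_add_pi, neg_le_neg_iff]
  obtain ⟨θ, hθ, s, hs⟩ := exists_common_value
    (F := fun p => ν₁.real {x | normalForm p.1 x ≤ p.2})
    (G := fun p => ν₂.real {x | normalForm p.1 x ≤ p.2})
    (continuous_measureReal_normalForm_le ν₁ hν₁) (continuous_measureReal_normalForm_le ν₂ hν₂)
    (mono ν₁) (mono ν₂) (a := δ) (b := δ + Real.pi) (v := v) (R := R)
    (by linarith [abs_nonneg c]) (by linarith [Real.pi_pos]) hlow hupp
    ⟨c, hRc', by simp only [h₁]; exact hv.le, by simp only [h₂]; linarith⟩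
    ⟨-c, ⟨by linarith, by linarith⟩, by
      simp only [hneg, measureReal_normalForm_ge ν₁ hν₁, h₁]; linarith, by
      simp only [hneg, measureReal_normalForm_ge ν₂ hν₂, h₂]; linarith⟩
  exact ⟨θ - δ, ⟨by linarith [hθ.1], by linarith [hθ.2]⟩, s, by simpa using hs⟩

lemma normalForm_add_polar (θ τ r : ℝ) (O : ℝ × ℝ) :
    normalForm θ (O + r • (Real.cos τ, Real.sin τ)) = normalForm θ O + r * Real.sin (τ - θ) := by
  simp [normalForm, Real.sin_sub]; ring

lemma isAffineLine_normalForm (θ s : ℝ) : IsAffineLine {x | normalForm θ x = s} := by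
  refine ⟨(-s * Real.sin θ, s * Real.cos θ), (Real.cos θ, Real.sin θ), ?_, ?_⟩
  · intro h
    have h1 : Real.cos θ = 0 := congrArg Prod.fst h
    have h2 : Real.sin θ = 0 := congrArg Prod.snd h
    simpa [h1, h2] using Real.sin_sq_add_cos_sq θ
  · ext x
    simp only [mem_ofPred_eq, normalForm]
    constructor
    · rintro rfl
      refine ⟨Real.cos θ * x.1 + Real.sin θ * x.2, Prod.ext ?_ ?_⟩ <;> simp
      · linear_combination -x.1 * Real.sin_sq_add_cos_sq θ
      · linear_combination -x.2 * Real.sin_sq_add_cos_sq θ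
    · rintro ⟨t, rfl⟩
      simp
      linear_combination s * Real.sin_sq_add_cos_sq θ

lemma mem_wedge_polar_iff {O : ℝ × ℝ} {r τ α β : ℝ} (hr : 0 < r) :
    O + r • (Real.cos τ, Real.sin τ) ∈ Wedge O α β ↔
      ∃ k : ℤ, α ≤ τ + k * (2 * Real.pi) ∧ τ + k * (2 * Real.pi) ≤ β := by
  constructor
  · rintro (h | ⟨r', hr', θ, hθ, h⟩)
    · have h' : r • (Real.cos τ, Real.sin τ) = (0 : ℝ × ℝ) := by simpa using h
      have h1 : r * Real.cos τ = 0 := congrArg Prod.fst h'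
      have h2 : r * Real.sin τ = 0 := congrArg Prod.snd h'
      have := Real.sin_sq_add_cos_sq τ
      simp_all [hr.ne']
    · have h' := add_left_cancel h
      have h1 : r * Real.cos τ = r' * Real.cos θ := congrArg Prod.fst h'
      have h2 : r * Real.sin τ = r' * Real.sin θ := congrArg Prod.snd h'
      have hsq : r ^ 2 = r' ^ 2 := by
        linear_combination (r * Real.cos τ + r' * Real.cos θ) * h1 +
          (r * Real.sin τ + r' * Real.sin θ) * h2 - r ^ 2 * Real.sin_sq_add_cos_sq τ +
          r' ^ 2 * Real.sin_sq_add_cos_sq θ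
      obtain rfl : r = r' := by
        rwa [sq_eq_sq₀ hr.le hr'.le] at hsq
      have hang : (θ : Real.Angle) = τ := Real.Angle.cos_sin_inj
        (mul_left_cancel₀ hr.ne' h1).symm (mul_left_cancel₀ hr.ne' h2).symm
      obtain ⟨k, hk⟩ := Real.Angle.angle_eq_iff_two_pi_dvd_sub.1 hang
      refine ⟨k, ?_⟩
      have : τ + k * (2 * Real.pi) = θ := by linarith
      rw [this]
      exact hθ
  · rintro ⟨k, hk⟩
    exact Or.inr ⟨r, hr, _, hk, by rw [Real.cos_add_int_mul_two_pi, Real.sin_add_int_mul_two_pi]⟩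

lemma wedge_add_two_pi (O : ℝ × ℝ) (α β : ℝ) :
    Wedge O (α + 2 * Real.pi) (β + 2 * Real.pi) = Wedge O α β := by
  unfold Wedge
  congr 1
  ext x
  constructor
  · rintro ⟨r, hr, θ, hθ, rfl⟩
    exact ⟨r, hr, θ - 2 * Real.pi, ⟨by linarith [hθ.1], by linarith [hθ.2]⟩, by simp⟩
  · rintro ⟨r, hr, θ, hθ, rfl⟩
    exact ⟨r, hr, θ + 2 * Real.pi, ⟨by linarith [hθ.1], by linarith [hθ.2]⟩, by simp⟩

/-- The angular coordinate about `O`, measured from the direction `δ`, of a point on the positive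
side of the line through `O` in direction `δ`. -/
lemma exists_angle {δ : ℝ} {O x : ℝ × ℝ} (h : normalForm δ O < normalForm δ x) :
    ∃ τ, 0 < τ ∧ τ < Real.pi ∧
      (∀ θ, 0 ≤ θ → θ ≤ Real.pi →
        (normalForm (δ + θ) x ≤ normalForm (δ + θ) O ↔ τ ≤ θ) ∧
        (normalForm (δ + θ) O ≤ normalForm (δ + θ) x ↔ θ ≤ τ)) ∧
      ∀ α β, -Real.pi ≤ α → β ≤ 2 * Real.pi →
        (x ∈ Wedge O (δ + α) (δ + β) ↔ α ≤ τ ∧ τ ≤ β) := by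
  set z : ℂ := ⟨Real.cos δ * (x.1 - O.1) + Real.sin δ * (x.2 - O.2),
    normalForm δ x - normalForm δ O⟩ with hz
  have him : 0 < z.im := sub_pos.2 h
  have hz0 : z ≠ 0 := fun h0 => by simp [h0] at him
  have hτ0 : 0 < z.arg := by
    refine lt_of_le_of_ne (Complex.arg_nonneg_iff.2 him.le) fun h0 => ?_
    exact him.ne' (Complex.arg_eq_zero_iff.1 h0.symm).2
  have hτπ : z.arg < Real.pi := by
    refine lt_of_le_of_ne (Complex.arg_le_pi z) fun h0 => ?_
    exact him.ne' (Complex.arg_eq_pi_iff.1 h0).2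
  have hr : 0 < ‖z‖ := norm_pos_iff.2 hz0
  have hx : x = O + ‖z‖ • (Real.cos (δ + z.arg), Real.sin (δ + z.arg)) := by
    have h1 : ‖z‖ * Real.cos z.arg = Real.cos δ * (x.1 - O.1) + Real.sin δ * (x.2 - O.2) :=
      Complex.norm_mul_cos_arg z
    have h2 : ‖z‖ * Real.sin z.arg = normalForm δ x - normalForm δ O :=
      Complex.norm_mul_sin_arg z
    simp only [normalForm] at h2
    refine Prod.ext ?_ ?_
    · simp only [Prod.fst_add, Prod.smul_fst, smul_eq_mul, Real.cos_add]
      linear_combination -Real.cos δ * h1 + Real.sin δ * h2 -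
        (x.1 - O.1) * Real.sin_sq_add_cos_sq δ
    · simp only [Prod.snd_add, Prod.smul_snd, smul_eq_mul, Real.sin_add]
      linear_combination -Real.sin δ * h1 - Real.cos δ * h2 -
        (x.2 - O.2) * Real.sin_sq_add_cos_sq δ
  clear_value z
  clear hz him hz0
  generalize z.arg = τ at *
  generalize ‖z‖ = r at *
  subst hx
  refine ⟨τ, hτ0, hτπ, fun θ h0 hπ => ?_, fun α β hα hβ => ?_⟩
  · rw [normalForm_add_polar, show δ + τ - (δ + θ) = τ - θ by ring]
    rcases lt_trichotomy τ θ with hlt | rfl | hgt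
    · have := mul_neg_of_pos_of_neg hr
        (Real.sin_neg_of_neg_of_neg_pi_lt (sub_neg.2 hlt) (by linarith))
      constructor <;> constructor <;> intro _ <;> linarith
    · simp
    · have := mul_pos hr (Real.sin_pos_of_pos_of_lt_pi (sub_pos.2 hgt) (by linarith))
      constructor <;> constructor <;> intro _ <;> linarith
  · rw [mem_wedge_polar_iff hr]
    constructor
    · rintro ⟨k, h1, h2⟩
      have hk : k = 0 := by
        have hπ := Real.pi_pos
        rcases lt_trichotomy k 0 with hk | hk | hk
        · have : (k : ℝ) ≤ -1 := by exact_mod_cast Int.le_sub_one_of_lt hk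
          nlinarith
        · exact hk
        · have : (1 : ℝ) ≤ k := by exact_mod_cast hk
          nlinarith
      subst hk
      constructor <;> push_cast at h1 h2 <;> linarith
    · rintro ⟨h1, h2⟩
      exact ⟨0, by push_cast; linarith, by push_cast; linarith⟩

section Membership

variable {δ A B φ : ℝ} {O x : ℝ × ℝ}

lemma mem_wedges_of_lt (hA : A ∈ Icc 0 φ) (hB : B ∈ Icc φ Real.pi)
    (h : normalForm δ O < normalForm δ x) :
    (x ∈ Wedge O δ (δ + B) ↔ normalForm (δ + B) x ≤ normalForm (δ + B) O) ∧
    (x ∈ Wedge O (δ + B) (δ + (Real.pi + φ)) ↔ normalForm (δ + B) O ≤ normalForm (δ + B) x) ∧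
    (x ∈ Wedge O (δ + (φ - Real.pi)) (δ + A) ↔ normalForm (δ + A) x ≤ normalForm (δ + A) O) ∧
    (x ∈ Wedge O (δ + A) (δ + Real.pi) ↔ normalForm (δ + A) O ≤ normalForm (δ + A) x) := by
  obtain ⟨τ, h0, hπ, hN, hW⟩ := exists_angle h
  obtain ⟨hA0, hAφ⟩ := hA
  obtain ⟨hφB, hBπ⟩ := hB
  have hW1 := hW 0 B (by linarith) (by linarith)
  rw [add_zero] at hW1
  rw [(hN B (by linarith) hBπ).1, (hN B (by linarith) hBπ).2, (hN A hA0 (by linarith)).1,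
    (hN A hA0 (by linarith)).2, hW1, hW _ _ (by linarith) (by linarith),
    hW _ _ (by linarith) (by linarith), hW _ _ (by linarith) (by linarith)]
  refine ⟨?_, ?_, ?_, ?_⟩ <;> constructor <;> intro _ <;> (try constructor) <;> linarith

lemma mem_wedges_of_gt (hA : A ∈ Icc 0 φ) (hB : B ∈ Icc φ Real.pi)
    (h : normalForm δ x < normalForm δ O) :
    x ∉ Wedge O δ (δ + B) ∧
    (x ∈ Wedge O (δ + B) (δ + (Real.pi + φ)) ↔ normalForm (δ + φ) O ≤ normalForm (δ + φ) x) ∧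
    (x ∈ Wedge O (δ + (φ - Real.pi)) (δ + A) ↔ normalForm (δ + φ) x ≤ normalForm (δ + φ) O) ∧
    x ∉ Wedge O (δ + A) (δ + Real.pi) := by
  have h' : normalForm (δ + Real.pi) O < normalForm (δ + Real.pi) x := by
    simpa only [normalForm_add_pi, neg_lt_neg_iff] using h
  obtain ⟨τ, h0, hπ, hN, hW⟩ := exists_angle h'
  obtain ⟨hA0, hAφ⟩ := hA
  obtain ⟨hφB, hBπ⟩ := hB
  have hN' := hN φ (by linarith) (by linarith)
  rw [show δ + Real.pi + φ = δ + φ + Real.pi by ring] at hN'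
  simp only [normalForm_add_pi, neg_le_neg_iff] at hN'
  have hW1 := hW (-Real.pi) (B - Real.pi) (by linarith) (by linarith)
  have hW2 := hW (B - Real.pi) φ (by linarith) (by linarith)
  have hW3 := hW φ (A + Real.pi) (by linarith) (by linarith)
  have hW4 := hW (A - Real.pi) 0 (by linarith) (by linarith)
  rw [show δ + Real.pi + -Real.pi = δ by ring,
    show δ + Real.pi + (B - Real.pi) = δ + B by ring] at hW1
  rw [show δ + Real.pi + (B - Real.pi) = δ + B by ring, add_assoc] at hW2
  rw [show δ + Real.pi + φ = δ + (φ - Real.pi) + 2 * Real.pi by ring,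
    show δ + Real.pi + (A + Real.pi) = δ + A + 2 * Real.pi by ring, wedge_add_two_pi] at hW3
  rw [show δ + Real.pi + (A - Real.pi) = δ + A by ring, add_zero] at hW4
  rw [hW1, hW2, hW3, hW4, hN'.1, hN'.2]
  refine ⟨fun _ => by linarith, ?_, ?_, fun _ => by linarith⟩ <;> constructor <;> intro _ <;>
    (try constructor) <;> linarith

end Membership

lemma ncard_fin_four_eq_two {p : Fin 4 → Prop} (h01 : p 0 ↔ ¬p 1) (h23 : p 2 ↔ ¬p 3) :
    {j | p j}.ncard = 2 := by
  classical
  have h : {j | p j} = ((Finset.univ.filter p : Finset (Fin 4)) : Set (Fin 4)) := by simp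
  rw [h, Set.ncard_coe_finset, Finset.card_filter, Fin.sum_univ_four]
  by_cases h1 : p 1 <;> by_cases h3 : p 3 <;> simp [h01, h23, h1, h3]

lemma ncard_fin_four_eq_one {p : Fin 4 → Prop} (h0 : ¬p 0) (h12 : p 1 ↔ ¬p 2) (h3 : ¬p 3) :
    {j | p j}.ncard = 1 := by
  classical
  have h : {j | p j} = ((Finset.univ.filter p : Finset (Fin 4)) : Set (Fin 4)) := by simp
  rw [h, Set.ncard_coe_finset, Finset.card_filter, Fin.sum_univ_four]
  by_cases h2 : p 2 <;> simp [h12, h0, h2, h3]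

lemma exists_normalForm_eq (δ c : ℝ) {φ : ℝ} (s : ℝ) (hφ : Real.sin φ ≠ 0) :
    ∃ O, normalForm δ O = c ∧ normalForm (δ + φ) O = s := by
  set t := (c * Real.cos φ - s) / Real.sin φ with ht
  have ht' : t * Real.sin φ = c * Real.cos φ - s := div_mul_cancel₀ _ hφ
  refine ⟨(-c * Real.sin δ + t * Real.cos δ, c * Real.cos δ + t * Real.sin δ), ?_, ?_⟩
  · simp only [normalForm]
    linear_combination c * Real.sin_sq_add_cos_sq δ
  · simp only [normalForm, Real.sin_add, Real.cos_add]
    linear_combination (c * Real.cos φ - t * Real.sin φ) * Real.sin_sq_add_cos_sq δ - ht'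

lemma four_wedges_of_normalForm (μ : Measure (ℝ × ℝ)) (hμ : IsMass μ) (δ c : ℝ)
    (hU : μ {x | c ≤ normalForm δ x} = ENNReal.ofReal (1 / 2))
    (hL : μ {x | normalForm δ x ≤ c} = ENNReal.ofReal (1 / 2)) :
    ∃ O : ℝ × ℝ, normalForm δ O = c ∧
      ∃ α β : Fin 4 → ℝ,
        (∀ j, α j ≤ β j ∧ β j - α j ≤ Real.pi ∧
          μ (Wedge O (α j) (β j)) = ENNReal.ofReal (3 / 8)) ∧
        ∃ (n : ℕ) (L : Fin n → Set (ℝ × ℝ)), (∀ k, IsAffineLine (L k)) ∧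
          (∀ x : ℝ × ℝ, c < normalForm δ x → x ∉ ⋃ k, L k →
            {j : Fin 4 | x ∈ Wedge O (α j) (β j)}.ncard = 2) ∧
          (∀ x : ℝ × ℝ, normalForm δ x < c → x ∉ ⋃ k, L k →
            {j : Fin 4 | x ∈ Wedge O (α j) (β j)}.ncard = 1) := by
  have := hμ.1
  have hπ := Real.pi_pos
  have hμl : ∀ θ s, μ {x | normalForm θ x = s} = 0 := fun θ s =>
    hμ.2 _ (isAffineLine_normalForm θ s)
  have mU : MeasurableSet {x | c ≤ normalForm δ x} :=
    measurableSet_le measurable_const (measurable_normalForm δ)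
  have mL : MeasurableSet {x | normalForm δ x ≤ c} :=
    measurableSet_le (measurable_normalForm δ) measurable_const
  obtain ⟨ν₁, hν₁⟩ : ∃ ν, ν = μ.restrict {x | c ≤ normalForm δ x} := ⟨_, rfl⟩
  obtain ⟨ν₂, hν₂⟩ : ∃ ν, ν = μ.restrict {x | normalForm δ x ≤ c} := ⟨_, rfl⟩
  have f₁ : IsFiniteMeasure ν₁ := by rw [hν₁]; infer_instance
  have f₂ : IsFiniteMeasure ν₂ := by rw [hν₂]; infer_instance
  have hl₁ : ∀ θ s, ν₁ {x | normalForm θ x = s} = 0 := fun θ s => by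
    rw [hν₁]; exact Measure.restrict_le_self.absolutelyContinuous (hμl θ s)
  have hl₂ : ∀ θ s, ν₂ {x | normalForm θ x = s} = 0 := fun θ s => by
    rw [hν₂]; exact Measure.restrict_le_self.absolutelyContinuous (hμl θ s)
  have ae₁ : ∀ᵐ x ∂ν₁, c < normalForm δ x := by
    have hne : ∀ᵐ x ∂ν₁, normalForm δ x ≠ c := by rw [ae_iff]; simpa using hl₁ δ c
    have hle : ∀ᵐ x ∂ν₁, c ≤ normalForm δ x := by rw [hν₁]; exact ae_restrict_mem mU
    filter_upwards [hne, hle] with x h h' using lt_of_le_of_ne h' h.symm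
  have ae₂ : ∀ᵐ x ∂ν₂, normalForm δ x < c := by
    have hne : ∀ᵐ x ∂ν₂, normalForm δ x ≠ c := by rw [ae_iff]; simpa using hl₂ δ c
    have hle : ∀ᵐ x ∂ν₂, normalForm δ x ≤ c := by rw [hν₂]; exact ae_restrict_mem mL
    filter_upwards [hne, hle] with x h h' using lt_of_le_of_ne h' h
  have hsum : ∀ S, μ.real S = ν₁.real S + ν₂.real S := fun S => by
    have h : ν₂ = μ.restrict {x | c ≤ normalForm δ x}ᶜ := by
      rw [hν₂]
      refine Measure.restrict_congr_set ?_
      have hne : ∀ᵐ x ∂μ, normalForm δ x ≠ c := by rw [ae_iff]; simpa using hμl δ c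
      filter_upwards [hne] with x hx
      refine propext ?_
      change normalForm δ x ≤ c ↔ ¬ (c ≤ normalForm δ x)
      rw [not_le]
      exact ⟨fun h => lt_of_le_of_ne h hx, le_of_lt⟩
    rw [← measureReal_add_apply, h, hν₁, Measure.restrict_add_restrict_compl mU]
  have t₁ : ν₁.real univ = 1 / 2 := by
    rw [hν₁, measureReal_restrict_apply_univ, measureReal_def, hU,
      ENNReal.toReal_ofReal (by norm_num)]
  have t₂ : ν₂.real univ = 1 / 2 := by
    rw [hν₂, measureReal_restrict_apply_univ, measureReal_def, hL,
      ENNReal.toReal_ofReal (by norm_num)]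
  have z₁ : ν₁.real {x | normalForm δ x ≤ c} = 0 := by
    rw [measureReal_eq_zero_iff, ← compl_compl {x | normalForm δ x ≤ c}]
    exact mem_ae_iff.1 (ae₁.mono fun x hx => not_le_of_gt hx)
  have z₂ : ν₂.real {x | c ≤ normalForm δ x} = 0 := by
    rw [measureReal_eq_zero_iff, ← compl_compl {x | c ≤ normalForm δ x}]
    exact mem_ae_iff.1 (ae₂.mono fun x hx => not_le_of_gt hx)
  have z₂' := measureReal_normalForm_ge ν₂ hl₂ δ c
  obtain ⟨φ, ⟨hφ0, hφπ⟩, s, hs₁, hs₂⟩ := exists_bisector_of_separated ν₁ ν₂ hl₁ hl₂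
    (v := 1 / 4) (by norm_num) (by rw [t₁]; norm_num) (by rw [t₂]; norm_num) (δ := δ) (c := c)
    z₁ (by linarith)
  have hsin : Real.sin φ ≠ 0 := by
    have hparallel : ∀ t, ν₁.real {x | normalForm δ x ≤ t} = 1 / 4 →
        ν₂.real {x | normalForm δ x ≤ t} = 1 / 4 → False := fun t h₁ h₂ => by
      rcases le_total t c with htc | htc
      · have := measureReal_mono (μ := ν₁) (s₁ := {x | normalForm δ x ≤ t})
          (s₂ := {x | normalForm δ x ≤ c}) fun x hx => le_trans hx htc
        linarith
      · have := measureReal_mono (μ := ν₂) (s₁ := {x | normalForm δ x ≤ c})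
          (s₂ := {x | normalForm δ x ≤ t}) fun x hx => le_trans hx htc
        linarith
    intro h0
    rcases hφ0.eq_or_lt with rfl | hpos
    · rw [add_zero] at hs₁ hs₂
      exact hparallel s hs₁ hs₂
    · rcases hφπ.eq_or_lt with rfl | hlt
      · have hset : {x | normalForm (δ + Real.pi) x ≤ s} = {x | -s ≤ normalForm δ x} := by
          ext x
          simp only [mem_ofPred_eq, normalForm_add_pi]
          exact neg_le
        rw [hset, measureReal_normalForm_ge _ hl₁] at hs₁
        rw [hset, measureReal_normalForm_ge _ hl₂] at hs₂
        exact hparallel (-s) (by linarith) (by linarith)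
      · exact (Real.sin_pos_of_pos_of_lt_pi hpos hlt).ne' h0
  obtain ⟨O, hO, hOs⟩ := exists_normalForm_eq δ c s hsin
  have hF : Continuous fun θ =>
      ν₁.real {x | normalForm (δ + θ) x ≤ normalForm (δ + θ) O} := by
    have hc : Continuous fun θ : ℝ => (δ + θ, normalForm (δ + θ) O) := by
      unfold normalForm; fun_prop
    have h := (continuous_measureReal_normalForm_le ν₁ hl₁).comp hc
    simpa only [Function.comp_def] using h
  have hFφ : ν₁.real {x | normalForm (δ + φ) x ≤ normalForm (δ + φ) O} = 1 / 4 := by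
    rw [hOs, hs₁]
  have hGφ : ν₂.real {x | normalForm (δ + φ) x ≤ normalForm (δ + φ) O} = 1 / 4 := by
    rw [hOs, hs₂]
  have hF0 : ν₁.real {x | normalForm (δ + 0) x ≤ normalForm (δ + 0) O} = 0 := by
    rw [add_zero, hO, z₁]
  have hFπ : ν₁.real {x | normalForm (δ + Real.pi) x ≤ normalForm (δ + Real.pi) O} = 1 / 2 := by
    simp only [normalForm_add_pi, neg_le_neg_iff, hO]
    rw [measureReal_normalForm_ge ν₁ hl₁, z₁, t₁, sub_zero]
  obtain ⟨A, hA, hFA⟩ := intermediate_value_Icc hφ0 hF.continuousOn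
    (show (1 / 8 : ℝ) ∈ Icc _ _ by rw [hF0, hFφ]; norm_num)
  obtain ⟨B, hB, hFB⟩ := intermediate_value_Icc hφπ hF.continuousOn
    (show (3 / 8 : ℝ) ∈ Icc _ _ by rw [hFφ, hFπ]; norm_num)
  simp only at hFA hFB
  have hcongr : ∀ {ν : Measure (ℝ × ℝ)} {S : Set (ℝ × ℝ)} {P : ℝ × ℝ → Prop},
      (∀ᵐ x ∂ν, (x ∈ S ↔ P x)) → ν.real S = ν.real {x | P x} := fun h =>
    measureReal_congr (h.mono fun x hx => propext hx)
  have hzero : ∀ {ν : Measure (ℝ × ℝ)} {S : Set (ℝ × ℝ)}, (∀ᵐ x ∂ν, x ∉ S) → ν.real S = 0 :=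
    fun h => by rw [measureReal_def, measure_eq_zero_iff_ae_notMem.2 h, ENNReal.toReal_zero]
  have up := ae₁.mono fun x hx => mem_wedges_of_lt hA hB (hO.trans_lt hx)
  have dn := ae₂.mono fun x hx => mem_wedges_of_gt hA hB (hx.trans_eq hO.symm)
  have toMass : ∀ S, ν₁.real S + ν₂.real S = 3 / 8 → μ S = ENNReal.ofReal (3 / 8) :=
    fun S h => by rw [← h, ← hsum, ofReal_measureReal]
  refine ⟨O, hO, ![δ, δ + B, δ + (φ - Real.pi), δ + A],
    ![δ + B, δ + (Real.pi + φ), δ + A, δ + Real.pi], ?_, 3,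
    ![{x | normalForm (δ + A) x = normalForm (δ + A) O},
      {x | normalForm (δ + B) x = normalForm (δ + B) O},
      {x | normalForm (δ + φ) x = normalForm (δ + φ) O}], ?_, ?_, ?_⟩
  · obtain ⟨hA0, hAφ⟩ := hA
    obtain ⟨hφB, hBπ⟩ := hB
    refine Fin.forall_fin_succ.2 ⟨?_, Fin.forall_fin_succ.2 ⟨?_, Fin.forall_fin_two.2 ⟨?_, ?_⟩⟩⟩
    · refine ⟨show δ ≤ δ + B by linarith, show δ + B - δ ≤ Real.pi by linarith, toMass _ ?_⟩
      change ν₁.real (Wedge O δ (δ + B)) + ν₂.real (Wedge O δ (δ + B)) = 3 / 8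
      rw [hcongr (up.mono fun x hx => hx.1),
        hzero (dn.mono fun x hx => hx.1)]
      linarith
    · refine ⟨show δ + B ≤ δ + (Real.pi + φ) by linarith,
        show δ + (Real.pi + φ) - (δ + B) ≤ Real.pi by linarith, toMass _ ?_⟩
      change ν₁.real (Wedge O (δ + B) (δ + (Real.pi + φ))) +
        ν₂.real (Wedge O (δ + B) (δ + (Real.pi + φ))) = 3 / 8
      rw [hcongr (up.mono fun x hx => hx.2.1), hcongr (dn.mono fun x hx => hx.2.1)]
      have h₁ := measureReal_normalForm_ge ν₁ hl₁ (δ + B) (normalForm (δ + B) O)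
      have h₂ := measureReal_normalForm_ge ν₂ hl₂ (δ + φ) (normalForm (δ + φ) O)
      linarith
    · refine ⟨show δ + (φ - Real.pi) ≤ δ + A by linarith,
        show δ + A - (δ + (φ - Real.pi)) ≤ Real.pi by linarith, toMass _ ?_⟩
      change ν₁.real (Wedge O (δ + (φ - Real.pi)) (δ + A)) +
        ν₂.real (Wedge O (δ + (φ - Real.pi)) (δ + A)) = 3 / 8
      rw [hcongr (up.mono fun x hx => hx.2.2.1), hcongr (dn.mono fun x hx => hx.2.2.1)]
      linarith
    · refine ⟨show δ + A ≤ δ + Real.pi by linarith,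
        show δ + Real.pi - (δ + A) ≤ Real.pi by linarith, toMass _ ?_⟩
      change ν₁.real (Wedge O (δ + A) (δ + Real.pi)) +
        ν₂.real (Wedge O (δ + A) (δ + Real.pi)) = 3 / 8
      rw [hcongr (up.mono fun x hx => hx.2.2.2),
        hzero (dn.mono fun x hx => hx.2.2.2)]
      have h₁ := measureReal_normalForm_ge ν₁ hl₁ (δ + A) (normalForm (δ + A) O)
      linarith
  · exact Fin.forall_fin_succ.2 ⟨isAffineLine_normalForm _ _, Fin.forall_fin_two.2
      ⟨isAffineLine_normalForm _ _, isAffineLine_normalForm _ _⟩⟩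
  · intro x hx hxL
    obtain ⟨w₀, w₁, w₂, w₃⟩ := mem_wedges_of_lt hA hB (hO.trans_lt hx)
    have nA : normalForm (δ + A) x ≠ normalForm (δ + A) O := fun h =>
      hxL (mem_iUnion.2 ⟨0, h⟩)
    have nB : normalForm (δ + B) x ≠ normalForm (δ + B) O := fun h =>
      hxL (mem_iUnion.2 ⟨1, h⟩)
    refine ncard_fin_four_eq_two ?_ ?_
    · refine w₀.trans (Iff.trans ?_ (not_congr w₁).symm)
      rw [not_le]
      exact ⟨fun h => lt_of_le_of_ne h nB, le_of_lt⟩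
    · refine w₂.trans (Iff.trans ?_ (not_congr w₃).symm)
      rw [not_le]
      exact ⟨fun h => lt_of_le_of_ne h nA, le_of_lt⟩
  · intro x hx hxL
    obtain ⟨w₀, w₁, w₂, w₃⟩ := mem_wedges_of_gt hA hB (hx.trans_eq hO.symm)
    have nφ : normalForm (δ + φ) x ≠ normalForm (δ + φ) O := fun h =>
      hxL (mem_iUnion.2 ⟨2, h⟩)
    refine ncard_fin_four_eq_one w₀ ?_ w₃
    refine w₁.trans (Iff.trans ?_ (not_congr w₂).symm)
    rw [not_le]
    exact ⟨fun h => lt_of_le_of_ne h nφ.symm, le_of_lt⟩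

end

/-- Half of the non-spiral `(8,3)` construction: four convex wedges of measure `3/8` with a
common apex on a bisecting line, covering one open side twice and the other once (off a
finite union of lines). -/
theorem four_wedges_half_construction (μ : Measure (ℝ × ℝ)) (hμ : IsMass μ) (a : ℝ × ℝ)
    (c : ℝ) (ha : a ≠ 0)
    (h1 : μ {x : ℝ × ℝ | c ≤ a.1 * x.1 + a.2 * x.2} = ENNReal.ofReal (1 / 2))
    (h2 : μ {x : ℝ × ℝ | a.1 * x.1 + a.2 * x.2 ≤ c} = ENNReal.ofReal (1 / 2)) :
    ∃ O : ℝ × ℝ, a.1 * O.1 + a.2 * O.2 = c ∧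
      ∃ α β : Fin 4 → ℝ,
        (∀ j, α j ≤ β j ∧ β j - α j ≤ Real.pi ∧
          μ (Wedge O (α j) (β j)) = ENNReal.ofReal (3 / 8)) ∧
        ∃ (n : ℕ) (L : Fin n → Set (ℝ × ℝ)), (∀ k, IsAffineLine (L k)) ∧
          (∀ x : ℝ × ℝ, c < a.1 * x.1 + a.2 * x.2 → x ∉ ⋃ k, L k →
            {j : Fin 4 | x ∈ Wedge O (α j) (β j)}.ncard = 2) ∧
          (∀ x : ℝ × ℝ, a.1 * x.1 + a.2 * x.2 < c → x ∉ ⋃ k, L k →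
            {j : Fin 4 | x ∈ Wedge O (α j) (β j)}.ncard = 1) := by
  obtain ⟨ρ, δ, hρ, h⟩ : ∃ ρ δ : ℝ, 0 < ρ ∧
      ∀ x : ℝ × ℝ, a.1 * x.1 + a.2 * x.2 = ρ * normalForm δ x := by
    let z : ℂ := ⟨a.2, -a.1⟩
    have h₁ : ‖z‖ * Real.cos z.arg = a.2 := Complex.norm_mul_cos_arg z
    have h₂ : ‖z‖ * Real.sin z.arg = -a.1 := Complex.norm_mul_sin_arg z
    refine ⟨‖z‖, z.arg, norm_pos_iff.2 fun hz => ha ?_, fun x => ?_⟩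
    · have hre : a.2 = 0 := congrArg Complex.re hz
      have him : -a.1 = 0 := congrArg Complex.im hz
      exact Prod.ext (neg_eq_zero.1 him) hre
    · simp only [normalForm]
      linear_combination -x.2 * h₁ + x.1 * h₂
  have heq : ∀ y, ρ * y = c ↔ y = c / ρ := fun y => by rw [eq_div_iff hρ.ne', mul_comm]
  simp only [h, ← div_le_iff₀' hρ, ← le_div_iff₀' hρ, ← div_lt_iff₀' hρ, ← lt_div_iff₀' hρ, heq] at h1 h2 ⊢
  exact four_wedges_of_normalForm μ hμ δ (c / ρ) h1 h2
end
end
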